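/- Let k be an algebraically closed field of characteristic zero, let f : X → Y be a finite étale surjective morphism of varieties over k, and let Δ ⊂ X be a closed subset. If X is arithmetically hyperbolic modulo Δ over k, then Y is arithmetically hyperbolic modulo f(Δ) over k. -/

import Mathlib

/-!
Formalization of a statement from "The Lang–Vojta conjectures on projective
pseudo-hyperbolic varieties" (Javanpeykar).

Notions not available in Mathlib (analytifications, genus, ample degrees, Hom-schemes, ...)
are encoded by explicit definitions or structures below; see the docstrings for the
conventions used.
-/

open CategoryTheory AlgebraicGeometry Limits

noncomputable section

/-- `Spec R` as a scheme, for a commutative ring `R`. -/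
abbrev SR (R : Type) [CommRing R] : Scheme := Spec (CommRingCat.of R)

/-- The category of schemes over `Spec R`. -/
abbrev OverR (R : Type) [CommRing R] := Over (SR R)

/-- A morphism of schemes over `Spec R` is constant if it factors through the base `Spec R`. -/
def IsConstant {R : Type} [CommRing R] {X Y : OverR R} (f : X ⟶ Y) : Prop :=
  ∃ y : SR R ⟶ Y.left, f.left = X.hom ≫ y

/-- A morphism `g : V ⟶ W` of schemes, where `V` has structure morphism `sV` to `Spec R`,
is constant if it factors through `Spec R`. -/
def IsConstantHom {R : Type} [CommRing R] {V W : Scheme} (sV : V ⟶ SR R) (g : V ⟶ W) : Prop :=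
  ∃ y : SR R ⟶ W, g = sV ≫ y

/-- A variety over `R`: a finite type, separated scheme over `Spec R`. -/
def IsVarietyOver {R : Type} [CommRing R] (X : OverR R) : Prop :=
  LocallyOfFiniteType X.hom ∧ QuasiCompact X.hom ∧ IsSeparated X.hom

/-- The multiplicative group scheme `𝔾ₘ` over `R`, i.e. the spectrum of the Laurent
polynomial ring over `R` (only its underlying scheme over `Spec R` is needed). -/
def GmO (R : Type) [CommRing R] : OverR R :=
  Over.mk (Spec.map (CommRingCat.ofHom (algebraMap R (LaurentPolynomial R))))

/-- The affine line over `R`. -/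
def A1O (R : Type) [CommRing R] : OverR R :=
  Over.mk (Spec.map (CommRingCat.ofHom (algebraMap R (Polynomial R))))

/-- `Spec R` as the terminal object of the category of schemes over `Spec R`. -/
def ptO (R : Type) [CommRing R] : OverR R := Over.mk (𝟙 (SR R))

/-- A group scheme over `R`, presented via a group structure on its functor of points:
by the Yoneda lemma this is the same as a group object in the category of schemes
over `Spec R`. -/
structure GroupScheme (R : Type) [CommRing R] where
  G : OverR R
  mul : ∀ {T : OverR R}, (T ⟶ G) → (T ⟶ G) → (T ⟶ G)
  one : ∀ (T : OverR R), T ⟶ G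
  inv : ∀ {T : OverR R}, (T ⟶ G) → (T ⟶ G)
  mul_assoc : ∀ {T : OverR R} (a b c : T ⟶ G), mul (mul a b) c = mul a (mul b c)
  one_mul : ∀ {T : OverR R} (a : T ⟶ G), mul (one T) a = a
  inv_mul : ∀ {T : OverR R} (a : T ⟶ G), mul (inv a) a = one T
  mul_natural : ∀ {T T' : OverR R} (f : T ⟶ T') (a b : T' ⟶ G),
    f ≫ mul a b = mul (f ≫ a) (f ≫ b)
  one_natural : ∀ {T T' : OverR R} (f : T ⟶ T'), f ≫ one T' = one T

/-- A finite type, connected group scheme over `R`. -/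
def GroupScheme.IsFiniteTypeConnected {R : Type} [CommRing R] (Γ : GroupScheme R) : Prop :=
  LocallyOfFiniteType Γ.G.hom ∧ QuasiCompact Γ.G.hom ∧ ConnectedSpace Γ.G.left

/-- An abelian variety over `R`: a connected finite type proper group scheme. (Over an
algebraically closed field of characteristic zero this agrees with the usual definition,
since group schemes are then automatically smooth by Cartier's theorem.) -/
def GroupScheme.IsAbelianVariety {R : Type} [CommRing R] (Γ : GroupScheme R) : Prop :=
  Γ.IsFiniteTypeConnected ∧ IsProper Γ.G.hom

/-- A scheme over `R` is groupless if every morphism to it from `𝔾ₘ` and from any abelian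
variety over `R` is constant. -/
def IsGroupless (R : Type) [CommRing R] (X : OverR R) : Prop :=
  (∀ f : GmO R ⟶ X, IsConstant f) ∧
  (∀ Γ : GroupScheme R, Γ.IsAbelianVariety → ∀ f : Γ.G ⟶ X, IsConstant f)

/-- A subset `Z` of a topological space has codimension at least two: every point of
`Z` admits a chain of two strict generizations (this computes the codimension of the
closure of each point of `Z` via the specialization order). -/
def CodimAtLeastTwo {T : Type} [TopologicalSpace T] (Z : Set T) : Prop :=
  ∀ z ∈ Z, ∃ x y : T, x ⤳ y ∧ y ⤳ z ∧ ¬(y ⤳ x) ∧ ¬(z ⤳ y)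

/-- `X` is groupless modulo the closed subset `Δ` if for every finite type connected group
scheme `G` over `R` and every dense open `U ⊆ G` whose complement has codimension at least
two, every non-constant morphism `U ⟶ X` over `R` factors over `Δ`. -/
def GrouplessModulo (R : Type) [CommRing R] (X : OverR R) (Δ : Set X.left) : Prop :=
  ∀ (Γ : GroupScheme R), Γ.IsFiniteTypeConnected →
    ∀ (U : Γ.G.left.Opens), Dense (U : Set Γ.G.left) →
      CodimAtLeastTwo ((U : Set Γ.G.left)ᶜ) →
      ∀ g : U.toScheme ⟶ X.left, g ≫ X.hom = U.ι ≫ Γ.G.hom →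
        ¬ IsConstantHom (U.ι ≫ Γ.G.hom) g → Set.range g.base ⊆ Δ

/-- `X` is pseudo-groupless if it is groupless modulo some proper closed subset. -/
def PseudoGroupless (R : Type) [CommRing R] (X : OverR R) : Prop :=
  ∃ Δ : Set X.left, IsClosed Δ ∧ Δ ≠ Set.univ ∧ GrouplessModulo R X Δ

/-- The unique point of `Spec k`, for `k` a field. -/
def specPt (k : Type) [Field k] : SR k := (⟨⊥, Ideal.bot_prime⟩ : PrimeSpectrum k)

/-- A model of `X` over a subring `A ⊆ k`: a finite type separated scheme over `Spec A`
together with an identification of its base change to `k` with `X`. -/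
structure SchemeModel (k : Type) [Field k] (A : Subring k) (X : OverR k) where
  M : Scheme
  str : M ⟶ SR ↥A
  lft : LocallyOfFiniteType str
  qc : QuasiCompact str
  sep : IsSeparated str
  base : pullback str (Spec.map (CommRingCat.ofHom A.subtype)) ≅ X.left
  base_w : base.hom ≫ X.hom = pullback.snd str (Spec.map (CommRingCat.ofHom A.subtype))

/-- `x` is the `k`-point of `X` induced (via the base change identification) by the
`k`-valued point `m` of the model. -/
def SchemeModel.InducesPoint {k : Type} [Field k] {A : Subring k} {X : OverR k}
    (𝒳 : SchemeModel k A X) (m : SR k ⟶ 𝒳.M) (x : X.left) : Prop :=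
  ∃ q : SR k ⟶ X.left,
    q ≫ 𝒳.base.inv ≫ pullback.fst 𝒳.str (Spec.map (CommRingCat.ofHom A.subtype)) = m ∧
    q ≫ 𝒳.base.inv ≫ pullback.snd 𝒳.str (Spec.map (CommRingCat.ofHom A.subtype)) = 𝟙 (SR k) ∧
    x = q.base (specPt k)

/-- Every positive-dimensional irreducible component of the closure of `s` is contained
in `Δ`. -/
def ComponentsModulo {X : Scheme} (Δ s : Set X) : Prop :=
  ∀ T : Set X, IsIrreducible T → IsClosed T → T ⊆ closure s →
    (∀ T' : Set X, IsIrreducible T' → IsClosed T' → T' ⊆ closure s → T ⊆ T' → T = T') →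
    ¬ T.Subsingleton → T ⊆ Δ

/-- `X` is arithmetically hyperbolic modulo `Δ` over `k`: for every finitely generated
subring `A ⊆ k` and every model `𝒳` of `X` over `A`, every positive-dimensional
irreducible component of the Zariski closure of the set of `A`-points `𝒳(A)` in `X`
is contained in `Δ`. -/
def ArithmeticallyHyperbolicModulo (k : Type) [Field k] (X : OverR k) (Δ : Set X.left) :
    Prop :=
  ∀ A : Subring k, Algebra.FiniteType ℤ ↥A →
    ∀ 𝒳 : SchemeModel k A X,
      ComponentsModulo Δ {x : X.left | ∃ s : SR ↥A ⟶ 𝒳.M, s ≫ 𝒳.str = 𝟙 (SR ↥A) ∧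
        𝒳.InducesPoint (Spec.map (CommRingCat.ofHom A.subtype) ≫ s) x}

namespace CW

section Analytic

open Polynomial Topology

variable {g : ℂ[X]} {Q : Type} [CommRing Q] [Algebra ℂ[X] Q]

/-- Evaluation of elements of `ℂ[X][1/g]` at a point where `g` does not vanish. -/
def evQ (g : ℂ[X]) (Q : Type) [CommRing Q] [Algebra ℂ[X] Q] [IsLocalization.Away g Q]
    (z : ℂ) (hz : g.eval z ≠ 0) : Q →+* ℂ :=
  IsLocalization.Away.lift (R := ℂ[X]) (S := Q) g (g := Polynomial.evalRingHom z)
    (by simpa using hz)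

open Classical in
/-- The function on `ℂ` attached to an element of `ℂ[X][1/g]`. -/
def qf (g : ℂ[X]) {Q : Type} [CommRing Q] [Algebra ℂ[X] Q] [IsLocalization.Away g Q]
    (q : Q) (z : ℂ) : ℂ :=
  if hz : g.eval z ≠ 0 then evQ g Q z hz q else 0

variable [IsLocalization.Away g Q]

lemma qf_eq (q : Q) (z : ℂ) (hz : g.eval z ≠ 0) : qf g q z = evQ g Q z hz q := by
  simp [qf, hz]

lemma evQ_algebraMap (z : ℂ) (hz : g.eval z ≠ 0) (p : ℂ[X]) :
    evQ g Q z hz (algebraMap ℂ[X] Q p) = p.eval z := by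
  simp [evQ]

lemma exists_qf_eq (g : ℂ[X]) {Q : Type} [CommRing Q] [Algebra ℂ[X] Q] [IsLocalization.Away g Q]
    (q : Q) : ∃ (p : ℂ[X]) (n : ℕ), q * algebraMap ℂ[X] Q g ^ n = algebraMap ℂ[X] Q p ∧
      ∀ z, g.eval z ≠ 0 → qf g q z = p.eval z / (g.eval z) ^ n := by
  obtain ⟨n, p, h⟩ := IsLocalization.Away.surj (S := Q) g q
  refine ⟨p, n, h, fun z hz => ?_⟩
  rw [qf_eq q z hz, eq_div_iff (pow_ne_zero _ hz)]
  have := congrArg (evQ g Q z hz) h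
  simpa [evQ_algebraMap] using this

lemma isOpen_U (g : ℂ[X]) : IsOpen {z : ℂ | g.eval z ≠ 0} :=
  isOpen_ne_fun g.continuous continuous_const

lemma qf_contDiffAt (q : Q) (z : ℂ) (hz : g.eval z ≠ 0) : ContDiffAt ℂ ⊤ (qf g q) z := by
  obtain ⟨p, n, -, h⟩ := exists_qf_eq g q
  have h1 : ContDiffAt ℂ ⊤ (fun z => p.eval z / (g.eval z) ^ n) z := by
    have hp : ContDiff ℂ ⊤ (fun z => p.eval z) := by simpa [Polynomial.coe_aeval_eq_eval] using p.contDiff_aeval (𝕜 := ℂ) ⊤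
    have hg : ContDiff ℂ ⊤ (fun z => g.eval z) := by simpa [Polynomial.coe_aeval_eq_eval] using g.contDiff_aeval (𝕜 := ℂ) ⊤
    exact hp.contDiffAt.div (hg.contDiffAt.pow n) (pow_ne_zero _ hz)
  refine h1.congr_of_eventuallyEq ?_
  filter_upwards [(isOpen_U g).mem_nhds hz] with w hw using h w hw

/-- A polynomial over `ℂ[X][1/g]` as a function of two variables. -/
def Fp (g : ℂ[X]) {Q : Type} [CommRing Q] [Algebra ℂ[X] Q] [IsLocalization.Away g Q]
    (p : Q[X]) (u : ℂ × ℂ) : ℂ := ∑ i ∈ p.support, qf g (p.coeff i) u.1 * u.2 ^ i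

lemma Fp_eq (p : Q[X]) (z w : ℂ) (hz : g.eval z ≠ 0) :
    Fp g p (z, w) = p.eval₂ (evQ g Q z hz) w := by
  simp only [Fp, eval₂_eq_sum, Polynomial.sum, qf_eq _ z hz]

lemma Fp_contDiffAt (p : Q[X]) (u : ℂ × ℂ) (hz : g.eval u.1 ≠ 0) :
    ContDiffAt ℂ ⊤ (Fp g p) u := by
  unfold Fp
  refine ContDiffAt.sum fun i _ => ?_
  exact ((qf_contDiffAt (p.coeff i) u.1 hz).comp u contDiffAt_fst).mul (contDiffAt_snd.pow i)

lemma Fp_hasDerivAt (p : Q[X]) (z w : ℂ) (hz : g.eval z ≠ 0) :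
    HasDerivAt (fun w => Fp g p (z, w)) (Fp g (derivative p) (z, w)) w := by
  simp only [Fp_eq _ z _ hz, eval₂_eq_eval_map, ← derivative_map]
  exact Polynomial.hasDerivAt _ _

lemma root_exists (p : Q[X]) (z0 w0 : ℂ) (hz : g.eval z0 ≠ 0) (h0 : Fp g p (z0, w0) = 0)
    (h1 : Fp g (derivative p) (z0, w0) ≠ 0) :
    ∃ r : ℂ → ℂ, r z0 = w0 ∧ (∀ᶠ z in 𝓝 z0, Fp g p (z, r z) = 0) ∧ ContDiffAt ℂ ⊤ r z0 := by
  have cdf := Fp_contDiffAt p (z0, w0) hz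
  have pn : (⊤ : WithTop ℕ∞) ≠ 0 := by simp
  have hd : HasFDerivAt (Fp g p) (fderiv ℂ (Fp g p) (z0, w0)) (z0, w0) :=
    (cdf.differentiableAt pn).hasFDerivAt
  have h2 : HasFDerivAt (fun w => Fp g p (z0, w))
      (fderiv ℂ (Fp g p) (z0, w0) ∘L .inr ℂ ℂ ℂ) w0 :=
    HasFDerivAt.comp w0 hd (hasFDerivAt_prodMk_right z0 w0)
  have h3 := h2.unique (Fp_hasDerivAt p z0 w0 hz).hasFDerivAt
  have if2 : (fderiv ℂ (Fp g p) (z0, w0) ∘L .inr ℂ ℂ ℂ).IsInvertible := by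
    rw [h3]
    refine ⟨ContinuousLinearEquiv.unitsEquivAut ℂ (Units.mk0 _ h1), ?_⟩
    ext
    simp
  refine ⟨cdf.implicitFunction pn if2, cdf.implicitFunction_apply_self pn if2, ?_,
    cdf.contDiffAt_implicitFunction pn if2⟩
  have := cdf.eventually_apply_implicitFunction pn if2
  rw [h0] at this
  exact this

variable {D : Type} [CommRing D] [Algebra ℂ[X] D]

/-- `ξ : D → ℂ` is a point lying over `z`. -/
def IsPt (ξ : D →+* ℂ) (z : ℂ) : Prop := ∀ q : ℂ[X], ξ (algebraMap ℂ[X] D q) = q.eval z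

variable [Algebra Q D] [IsScalarTower ℂ[X] Q D]

include Q in
lemma IsPt.ne {ξ : D →+* ℂ} {z : ℂ} (h : IsPt ξ z) : g.eval z ≠ 0 := by
  rw [← h g, IsScalarTower.algebraMap_apply ℂ[X] Q D]
  exact (((IsLocalization.Away.algebraMap_isUnit (S := Q) g).map (algebraMap Q D)).map ξ).ne_zero

lemma IsPt.comp {ξ : D →+* ℂ} {z : ℂ} (h : IsPt ξ z) (hz : g.eval z ≠ 0) :
    ξ.comp (algebraMap Q D) = evQ g Q z hz := by
  apply IsLocalization.ringHom_ext (Submonoid.powers g)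
  ext1 
  · ext a
    simpa [evQ_algebraMap, ← IsScalarTower.algebraMap_apply] using h (C a)
  · simpa [evQ_algebraMap, ← IsScalarTower.algebraMap_apply] using h X

lemma IsPt.apply {ξ : D →+* ℂ} {z : ℂ} (h : IsPt ξ z) (q : Q) :
    ξ (algebraMap Q D q) = qf g q z := by
  rw [qf_eq q z (h.ne (g := g) (Q := Q)), ← h.comp]
  rfl

lemma IsPt.iff {ξ : D →+* ℂ} {z : ℂ} (hz : g.eval z ≠ 0) (h : ξ.comp (algebraMap Q D) = evQ g Q z hz) :
    IsPt ξ z := by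
  intro q
  rw [IsScalarTower.algebraMap_apply ℂ[X] Q D, ← evQ_algebraMap (Q := Q) z hz, ← h]
  rfl

lemma local_section (g : ℂ[X]) (Q : Type) [CommRing Q] [Algebra ℂ[X] Q] [IsLocalization.Away g Q]
    {D : Type} [CommRing D] [Algebra ℂ[X] D] [Algebra Q D] [IsScalarTower ℂ[X] Q D]
    [Algebra.Etale Q D] (ξ0 : D →+* ℂ) (z0 : ℂ) (h0 : IsPt ξ0 z0) :
    ∃ ψ : ℂ → (D →+* ℂ), ψ z0 = ξ0 ∧ ∀ᶠ z in 𝓝 z0, IsPt (ψ z) z ∧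
      ∀ y, DifferentiableAt ℂ (fun z => ψ z y) z := by
  classical
  have hz0 : g.eval z0 ≠ 0 := h0.ne (g := g) (Q := Q)
  let I : Ideal D := RingHom.ker ξ0
  have : I.IsPrime := RingHom.ker_isPrime ξ0
  obtain ⟨f, hf, hst⟩ := Algebra.IsEtaleAt.exists_isStandardEtale (R := Q) I
  obtain ⟨P⟩ := hst.nonempty_standardEtalePresentation
  let S := Localization.Away f
  -- the extension of ξ0 to S
  let ξS : S →+* ℂ := IsLocalization.Away.lift (S := S) f (g := ξ0)
    (by rw [isUnit_iff_ne_zero]; exact hf)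
  have hξS : ∀ d : D, ξS (algebraMap D S d) = ξ0 d := fun d => by simp [ξS]
  have hξQ : ξS.comp (algebraMap Q S) = evQ g Q z0 hz0 := by
    rw [← h0.comp]
    ext q
    simp [IsScalarTower.algebraMap_apply Q D S, hξS]
  let w0 := ξS P.x
  have key : ∀ p : Q[X], Fp g p (z0, w0) = ξS (aeval P.x p) := by
    intro p
    rw [Fp_eq _ _ _ hz0, ← hξQ, aeval_def, hom_eval₂]
  have hP := P.hasMap
  obtain ⟨r, hr0, hr, hrd⟩ := root_exists (g := g) P.f z0 w0 hz0
    (by rw [key, hP.1, map_zero]) (by rw [key]; exact (hP.isUnit_derivative_f.map ξS).ne_zero)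
  have hgne : Fp g P.g (z0, r z0) ≠ 0 := by
    rw [hr0, key]; exact (hP.2.map ξS).ne_zero
  have hcont : ContDiffAt ℂ ⊤ (fun z => Fp g P.g (z, r z)) z0 :=
    ContDiffAt.comp (g := Fp g P.g) z0 (Fp_contDiffAt P.g (z0, r z0) hz0) (contDiffAt_id.prodMk hrd)
  have hgne' : ∀ᶠ z in 𝓝 z0, Fp g P.g (z, r z) ≠ 0 := hcont.continuousAt.eventually_ne hgne
  have hUe : ∀ᶠ z in 𝓝 z0, g.eval z ≠ 0 := (isOpen_U g).mem_nhds hz0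
  have hrd' : ∀ᶠ z in 𝓝 z0, DifferentiableAt ℂ r z := by
    have h1 : ContDiffAt ℂ 1 r z0 := hrd.of_le (by simp)
    filter_upwards [h1.eventually (by simp)] with z hz using hz.differentiableAt (by simp)
  have hev := (hgne'.and hUe).and (hr.and hrd')
  -- existence of homs
  have ex : ∀ z, (∃ hz : g.eval z ≠ 0, Fp g P.g (z, r z) ≠ 0 ∧ Fp g P.f (z, r z) = 0) →
      ∃ ξ : S →+* ℂ, ξ P.x = r z ∧ ∃ hz : g.eval z ≠ 0, ξ.comp (algebraMap Q S) = evQ g Q z hz := by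
    rintro z ⟨hz, h1, h2⟩
    let _ : Algebra Q ℂ := (evQ g Q z hz).toAlgebra
    have hm : P.HasMap (r z) := by
      refine ⟨?_, ?_⟩
      · rw [aeval_def, ← h2, Fp_eq _ _ _ hz]; rfl
      · rw [isUnit_iff_ne_zero, aeval_def]
        rw [Fp_eq _ _ _ hz] at h1
        exact h1
    refine ⟨((P.lift (r z) hm).comp P.equivRing.toAlgHom).toRingHom, by simp, hz, ?_⟩
    ext q
    simp
    rfl
  have : Nonempty (S →+* ℂ) := ⟨ξS⟩
  choose! ξ' hξ'x hξ'Q using ex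
  let ψ : ℂ → (D →+* ℂ) := fun z => if z = z0 then ξ0 else RingHom.comp (ξ' z) (algebraMap D S)
  -- formula
  have form : ∀ y : D, ∃ (p : Q[X]) (n : ℕ), ∀ z, (∃ hz : g.eval z ≠ 0,
      Fp g P.g (z, r z) ≠ 0 ∧ Fp g P.f (z, r z) = 0) →
      ψ z y = Fp g p (z, r z) / Fp g P.g (z, r z) ^ n := by
    intro y
    obtain ⟨p, n, hpn⟩ := P.exists_mul_aeval_x_g_pow_eq_aeval_x (algebraMap D S y)
    refine ⟨p, n, ?_⟩
    rintro z hz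
    rw [eq_div_iff (pow_ne_zero _ hz.2.1)]
    obtain ⟨hzz, h1⟩ := hξ'Q z hz
    have key2 : ∀ p : Q[X], Fp g p (z, r z) = ξ' z (aeval P.x p) := by
      intro p
      rw [Fp_eq _ _ _ hzz, ← h1, aeval_def, hom_eval₂, hξ'x z hz]
    by_cases hzz0 : z = z0
    · simp only [ψ, hzz0, if_true, hr0, key, ← hξS]
      rw [← map_pow, ← map_mul, hpn]
    · simp only [ψ, if_neg hzz0, key2, RingHom.comp_apply]
      rw [← map_pow, ← map_mul, hpn]
  refine ⟨ψ, by simp [ψ], ?_⟩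
  filter_upwards [hev.eventually_nhds] with z hz
  have hz' := hz.self_of_nhds
  refine ⟨?_, fun y => ?_⟩
  · by_cases hzz0 : z = z0
    · simp only [ψ, hzz0, if_true]; exact h0
    · simp only [ψ, if_neg hzz0]
      obtain ⟨hzz, h1⟩ := hξ'Q z ⟨hz'.1.2, hz'.1.1, hz'.2.1⟩
      refine IsPt.iff (Q := Q) hzz ?_
      rw [← h1]
      ext q
      simp [IsScalarTower.algebraMap_apply Q D S]
  · obtain ⟨p, n, hform⟩ := form y
    have e : (fun z => ψ z y) =ᶠ[𝓝 z] fun z => Fp g p (z, r z) / Fp g P.g (z, r z) ^ n := by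
      filter_upwards [hz] with w hw using hform w ⟨hw.1.2, hw.1.1, hw.2.1⟩
    refine DifferentiableAt.congr_of_eventuallyEq ?_ e
    have d1 : ∀ p : Q[X], DifferentiableAt ℂ (fun z => Fp g p (z, r z)) z := fun p =>
      DifferentiableAt.comp (g := Fp g p) z
        ((Fp_contDiffAt p (z, r z) hz'.1.2).differentiableAt (by simp))
        (differentiableAt_id.prodMk hz'.2.2)
    exact (d1 p).div ((d1 P.g).pow n) (pow_ne_zero _ hz'.1.1)

end Analytic

end CW

namespace CW

section Fiber

open Polynomial Topology TensorProduct

lemma piHom_eq_eval {K ι : Type*} [Field K] [Finite ι] (φ : (ι → K) →ₐ[K] K) :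
    ∃ i, ∀ f, φ f = f i := by
  classical
  have := Fintype.ofFinite ι
  have h1 : ∑ i, φ (Pi.single i 1) = 1 := by
    rw [← map_sum]
    convert map_one φ
    ext j
    simp [Pi.single_apply]
  have : ∃ i, φ (Pi.single i 1) ≠ 0 := by
    by_contra h
    push Not at h
    simp [h] at h1
  obtain ⟨i, hi⟩ := this
  refine ⟨i, fun f => ?_⟩
  have h2 : f * Pi.single i 1 = f i • Pi.single i (1 : K) := by
    ext j
    by_cases hj : j = i
    · subst hj; simp
    · simp [hj]
  have h3 := congrArg φ h2
  rw [map_mul, map_smul, smul_eq_mul] at h3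
  exact mul_right_cancel₀ hi h3

/-- The points of the fiber of a finite étale cover over `z`. -/
lemma fiber_points (g : ℂ[X]) (Q : Type) [CommRing Q] [Algebra ℂ[X] Q] [IsLocalization.Away g Q]
    {D : Type} [CommRing D] [Algebra ℂ[X] D] [Algebra Q D] [IsScalarTower ℂ[X] Q D]
    [Algebra.Etale Q D] {n : ℕ} (b : Module.Basis (Fin n) Q D) (z : ℂ) (hz : g.eval z ≠ 0) :
    ∃ ξ : Fin n → (D →+* ℂ), (∀ i, IsPt (ξ i) z) ∧ Function.Injective ξ ∧
      (∀ ξ' : D →+* ℂ, IsPt ξ' z → ∃ i, ξ' = ξ i) ∧ ∀ v : Fin n → ℂ, ∃ y, ∀ i, ξ i y = v i := by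
  classical
  let _ : Algebra Q ℂ := (evQ g Q z hz).toAlgebra
  let T := ℂ ⊗[Q] D
  let e : T ≃ₐ[ℂ] (PrimeSpectrum T → ℂ) := Algebra.FormallyEtale.equivPiOfIsSepClosed ℂ T
  have : Module.Finite ℂ T := Algebra.FormallyUnramified.finite_of_free ℂ T
  have : IsArtinianRing T := isArtinian_of_tower ℂ inferInstance
  have : Finite (PrimeSpectrum T) := inferInstance
  have := Fintype.ofFinite (PrimeSpectrum T)
  have hcard : Fintype.card (PrimeSpectrum T) = n := by
    have h1 := e.toLinearEquiv.finrank_eq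
    rw [Module.finrank_pi] at h1
    rw [← h1, Module.finrank_eq_card_basis (b.baseChange ℂ)]
    simp
  let ee : Fin n ≃ PrimeSpectrum T := (Fintype.equivFinOfCardEq hcard).symm
  let ξ : Fin n → (D →+* ℂ) := fun i =>
    ((Pi.evalRingHom (fun _ : PrimeSpectrum T => ℂ) (ee i)).comp (e : T →+* _)).comp
      (Algebra.TensorProduct.includeRight : D →ₐ[Q] T).toRingHom
  have hξ : ∀ i y, ξ i y = e (1 ⊗ₜ y) (ee i) := fun i y => rfl
  have hsurjT : ∀ t : T, ∃ y : D, t = 1 ⊗ₜ y := by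
    intro t
    induction t using TensorProduct.induction_on with
    | zero => exact ⟨0, by simp⟩
    | tmul c y =>
      refine ⟨algebraMap Q D (algebraMap ℂ[X] Q (C c)) * y, ?_⟩
      rw [← Algebra.smul_def, ← TensorProduct.smul_tmul]
      congr 1
      rw [Algebra.smul_def]
      change c = evQ g Q z hz _ * 1
      simp [evQ_algebraMap]
    | add x y hx hy =>
      obtain ⟨a, ha⟩ := hx
      obtain ⟨b, hb⟩ := hy
      exact ⟨a + b, by rw [TensorProduct.tmul_add, ← ha, ← hb]⟩
  have hval : ∀ v : Fin n → ℂ, ∃ y, ∀ i, ξ i y = v i := by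
    intro v
    obtain ⟨y, hy⟩ := hsurjT (e.symm (v ∘ ee.symm))
    refine ⟨y, fun i => ?_⟩
    rw [hξ, ← hy]
    simp
  refine ⟨ξ, fun i => ?_, fun i j hij => ?_, fun ξ' hξ' => ?_, hval⟩
  · refine IsPt.iff (Q := Q) hz ?_
    ext q
    rw [RingHom.comp_apply, hξ]
    have : (1 : ℂ) ⊗ₜ[Q] (algebraMap Q D q) = algebraMap ℂ T (evQ g Q z hz q) := by
      rw [Algebra.algebraMap_eq_smul_one, ← TensorProduct.smul_tmul, Algebra.smul_def]
      simp [Algebra.TensorProduct.algebraMap_apply]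
      rfl
    rw [this, AlgEquiv.commutes]
    rfl
  · obtain ⟨y, hy⟩ := hval (Pi.single i 1)
    by_contra hne
    have h1 := hy i
    have h2 := hy j
    rw [← hij, h1] at h2
    simp [Pi.single_apply, Ne.symm hne] at h2
  · have hc := hξ'.comp (Q := Q) hz
    let ξ'' : D →ₐ[Q] ℂ := { ξ' with commutes' := fun q => by
                                      have := RingHom.congr_fun hc q
                                      exact this }
    let φ : T →ₐ[ℂ] ℂ := Algebra.TensorProduct.lift (AlgHom.id ℂ ℂ) ξ'' (fun _ _ => mul_comm _ _)
    obtain ⟨i, hi⟩ := piHom_eq_eval (φ.comp e.symm.toAlgHom)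
    refine ⟨ee.symm i, ?_⟩
    ext y
    rw [hξ]
    have := hi (e (1 ⊗ₜ y))
    simp at this
    rw [Equiv.apply_symm_apply, ← this]
    have h2 : φ (1 ⊗ₜ y) = 1 * ξ'' y := Algebra.TensorProduct.lift_tmul _ _ _ _ _
    rw [h2, one_mul]
    rfl

end Fiber

end CW

namespace CW

section Covering

open Polynomial Topology

/-- A holomorphic family of points over `V`. -/
def IsSec {D : Type} [CommRing D] [Algebra ℂ[X] D] (V : Set ℂ) (Ψ : ℂ → (D →+* ℂ)) : Prop :=
  ∀ z ∈ V, IsPt (Ψ z) z ∧ ∀ y, DifferentiableAt ℂ (fun z => Ψ z y) z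

lemma IsSec.mono {D : Type} [CommRing D] [Algebra ℂ[X] D] {V V' : Set ℂ} {Ψ : ℂ → (D →+* ℂ)}
    (h : IsSec V Ψ) (hV : V' ⊆ V) : IsSec V' Ψ := fun z hz => h z (hV hz)

lemma triv (g : ℂ[X]) (Q : Type) [CommRing Q] [Algebra ℂ[X] Q] [IsLocalization.Away g Q]
    {D : Type} [CommRing D] [Algebra ℂ[X] D] [Algebra Q D] [IsScalarTower ℂ[X] Q D]
    [Algebra.Etale Q D] {n : ℕ} (b : Module.Basis (Fin n) Q D) (z0 : ℂ) (hz0 : g.eval z0 ≠ 0) :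
    ∃ (W : Set ℂ) (ψ : Fin n → ℂ → (D →+* ℂ)) (y : Fin n → D), IsOpen W ∧ z0 ∈ W ∧
      (∀ i, IsSec W (ψ i)) ∧ (∀ z ∈ W, ∀ ξ, IsPt ξ z → ∃ i, ξ = ψ i z) ∧
      ∀ z ∈ W, ∀ i j, ‖ψ j z (y i) - 1‖ < 1 / 2 ↔ j = i := by
  obtain ⟨ξ, hξ, -, -, hval⟩ := fiber_points g Q b z0 hz0
  choose ψ hψ0 hψ using fun i => local_section g Q (ξ i) z0 (hξ i)
  choose y hy using fun i : Fin n => hval (Pi.single i 1)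
  have hy' : ∀ i j, ψ j z0 (y i) = Pi.single (M := fun _ => ℂ) i 1 j := fun i j => by
    rw [hψ0]; exact hy i j
  have hcont : ∀ i j, ContinuousAt (fun z => ψ j z (y i)) z0 := fun i j =>
    ((hψ j).self_of_nhds.2 (y i)).continuousAt
  have hnear : ∀ i j, ∀ᶠ z in 𝓝 z0, (‖ψ j z (y i) - 1‖ < 1 / 2 ↔ j = i) := by
    intro i j
    have hc : ContinuousAt (fun z => ‖ψ j z (y i) - 1‖) z0 :=
      ((hcont i j).sub continuousAt_const).norm
    by_cases hij : j = i
    · subst hij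
      have : ‖ψ j z0 (y j) - 1‖ < 1 / 2 := by rw [hy']; simp
      filter_upwards [hc.eventually_lt continuousAt_const this] with z hz
      simpa using hz
    · have : 1 / 2 < ‖ψ j z0 (y i) - 1‖ := by rw [hy']; simp [hij]; norm_num
      filter_upwards [continuousAt_const.eventually_lt hc this] with z hz
      simp only [hij, iff_false, not_lt]
      exact hz.le
  have hall : ∀ᶠ z in 𝓝 z0, (∀ i j, (‖ψ j z (y i) - 1‖ < 1 / 2 ↔ j = i)) ∧
      ∀ i, IsPt (ψ i z) z ∧ ∀ y, DifferentiableAt ℂ (fun z => ψ i z y) z := by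
    rw [Filter.eventually_and]
    refine ⟨?_, ?_⟩
    · rw [Filter.eventually_all]; intro i
      rw [Filter.eventually_all]; intro j
      exact hnear i j
    · rw [Filter.eventually_all]; exact hψ
  obtain ⟨W, hW, hWo, hzW⟩ := eventually_nhds_iff.mp hall
  refine ⟨W, ψ, y, hWo, hzW, fun i z hz => (hW z hz).2 i, fun z hz ξ' hξ' => ?_,
    fun z hz => (hW z hz).1⟩
  obtain ⟨ζ, hζ, hζi, hζs, -⟩ := fiber_points g Q b z (hξ'.ne (Q := Q))
  choose σ hσ using fun i => hζs (ψ i z) ((hW z hz).2 i).1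
  have hinj : Function.Injective σ := by
    intro i j hij
    have h1 : ψ i z = ψ j z := by rw [hσ i, hσ j, hij]
    have h2 := ((hW z hz).1 i i).2 rfl
    rw [h1] at h2
    exact (((hW z hz).1 i j).1 h2).symm
  obtain ⟨i, hi⟩ := hζs ξ' hξ'
  obtain ⟨j, rfl⟩ := (Finite.injective_iff_surjective.1 hinj) i
  exact ⟨j, by rw [hi, hσ j]⟩

/-- The total space of points, with the topology of pointwise convergence. -/
def ESp (D : Type) [CommRing D] [Algebra ℂ[X] D] : Type := {ξ : D →+* ℂ // ∃ z, IsPt ξ z}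

instance (D : Type) [CommRing D] [Algebra ℂ[X] D] : TopologicalSpace (ESp D) :=
  TopologicalSpace.induced (fun ξ : ESp D => (fun y => ξ.1 y : D → ℂ)) inferInstance

/-- The projection to the base. -/
def ESp.pr {D : Type} [CommRing D] [Algebra ℂ[X] D] (ξ : ESp D) : ℂ := ξ.1 (algebraMap ℂ[X] D X)

lemma ESp.continuous_eval {D : Type} [CommRing D] [Algebra ℂ[X] D] (y : D) :
    Continuous (fun ξ : ESp D => ξ.1 y) :=
  (continuous_apply y).comp continuous_induced_dom

lemma ESp.isPt {D : Type} [CommRing D] [Algebra ℂ[X] D] (ξ : ESp D) : IsPt ξ.1 ξ.pr := by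
  obtain ⟨z, hz⟩ := ξ.2
  have : ξ.pr = z := (hz X).trans (by simp)
  rwa [this]

lemma ESp.pr_eq {D : Type} [CommRing D] [Algebra ℂ[X] D] {ξ : ESp D} {z : ℂ} (h : IsPt ξ.1 z) :
    ξ.pr = z :=
  (h X).trans (by simp)

lemma covering (g : ℂ[X]) (Q : Type) [CommRing Q] [Algebra ℂ[X] Q] [IsLocalization.Away g Q]
    {D : Type} [CommRing D] [Algebra ℂ[X] D] [Algebra Q D] [IsScalarTower ℂ[X] Q D]
    [Algebra.Etale Q D] {n : ℕ} [NeZero n] (b : Module.Basis (Fin n) Q D) :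
    IsCoveringMapOn (ESp.pr (D := D)) {z | g.eval z ≠ 0} := by
  classical
  intro z0 hz0
  obtain ⟨W, ψ, y, hWo, hzW, hsec, hall, hsep⟩ := triv g Q b z0 hz0
  refine IsEvenlyCovered.to_isEvenlyCovered_preimage (I := Fin n) ?_
  let e0 : ESp D := ⟨ψ 0 z0, z0, (hsec 0 z0 hzW).1⟩
  have : Nonempty (ℂ → ESp D) := ⟨fun _ => e0⟩
  have hprc : Continuous (ESp.pr (D := D)) := ESp.continuous_eval _
  let U : Fin n → Set (ESp D) := fun i => {ξ | ξ.pr ∈ W ∧ ‖ξ.1 (y i) - 1‖ < 1 / 2}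
  have hUo : ∀ i, IsOpen (U i) := fun i => by
    refine (hWo.preimage hprc).inter ?_
    exact isOpen_lt ((ESp.continuous_eval (y i)).sub continuous_const).norm continuous_const
  have hUψ : ∀ i (ξ : ESp D), ξ ∈ U i → ξ.1 = ψ i ξ.pr := by
    intro i ξ hξ
    obtain ⟨j, hj⟩ := hall _ hξ.1 ξ.1 ξ.isPt
    have h2 := hξ.2
    rw [hj] at h2
    rw [(hsep _ hξ.1 i j).1 h2] at hj
    exact hj
  let s : Fin n → ℂ → ESp D := fun i z => if hz : z ∈ W then ⟨ψ i z, z, (hsec i z hz).1⟩ else e0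
  have hs : ∀ i z, z ∈ W → (s i z).1 = ψ i z := fun i z hz => by simp [s, hz]
  have hspr : ∀ i z, z ∈ W → (s i z).pr = z := fun i z hz => by
    apply ESp.pr_eq; rw [hs i z hz]; exact (hsec i z hz).1
  have hsU : ∀ i z, z ∈ W → s i z ∈ U i := fun i z hz =>
    ⟨by rw [hspr i z hz]; exact hz, by rw [hs i z hz]; exact (hsep z hz i i).2 rfl⟩
  have hsc : ∀ i, ContinuousOn (s i) W := by
    intro i
    rw [continuousOn_iff_continuous_domRestrict, continuous_induced_rng, continuous_pi_iff]
    intro d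
    refine (continuousOn_iff_continuous_domRestrict (f := fun z => (s i z).1 d)).1 ?_
    refine ContinuousOn.congr (f := fun z => ψ i z d) ?_ (fun z hz => by simp only [hs i z hz])
    exact fun z hz => ((hsec i z hz).2 d).continuousAt.continuousWithinAt
  let t := IsOpen.trivializationDiscrete (f := ESp.pr (D := D)) U W hWo ?_ ?_ ?_ ?_ ?_
  · exact IsEvenlyCovered.of_trivialization (t := t) hzW
  · intro i W' hW'
    constructor
    · intro h
      exact (h.preimage hprc).inter (hUo i)
    · intro h
      have h1 := (hsc i).isOpen_inter_preimage hWo h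
      convert h1 using 1
      ext z
      constructor
      · intro hz
        exact ⟨hW' hz, by rw [Set.mem_preimage, Set.mem_inter_iff, Set.mem_preimage,
          hspr i z (hW' hz)]; exact ⟨hz, hsU i z (hW' hz)⟩⟩
      · rintro ⟨hz, h2, -⟩
        rwa [Set.mem_preimage, hspr i z hz] at h2
  · intro i ξ hξ ξ' hξ' heq
    apply Subtype.ext
    rw [hUψ i ξ hξ, hUψ i ξ' hξ', heq]
  · intro i z hz
    exact ⟨s i z, hsU i z hz, hspr i z hz⟩
  · intro i j hij
    rw [Function.onFun, Set.disjoint_left]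
    intro ξ hξ hξ'
    have h2 := hξ'.2
    rw [hUψ i ξ hξ] at h2
    exact hij ((hsep _ hξ.1 j i).1 h2)
  · intro ξ hξ
    rw [Set.mem_iUnion]
    obtain ⟨j, hj⟩ := hall _ hξ ξ.1 ξ.isPt
    refine ⟨j, hξ, ?_⟩
    rw [hj]
    exact (hsep _ hξ j j).2 rfl

/-- Over a convex open subset, every point extends to a holomorphic family. -/
lemma exists_sec (g : ℂ[X]) (Q : Type) [CommRing Q] [Algebra ℂ[X] Q] [IsLocalization.Away g Q]
    {D : Type} [CommRing D] [Algebra ℂ[X] D] [Algebra Q D] [IsScalarTower ℂ[X] Q D]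
    [Algebra.Etale Q D] {n : ℕ} [NeZero n] (b : Module.Basis (Fin n) Q D)
    (V : Set ℂ) (hVo : IsOpen V) (hVc : Convex ℝ V) (hV : ∀ z ∈ V, g.eval z ≠ 0)
    (z1 : ℂ) (hz1 : z1 ∈ V) (ξ1 : D →+* ℂ) (hξ1 : IsPt ξ1 z1) :
    ∃ Ψ : ℂ → (D →+* ℂ), Ψ z1 = ξ1 ∧ IsSec V Ψ := by
  classical
  have cov : IsCoveringMap (V.restrictPreimage (ESp.pr (D := D))) :=
    ((covering g Q b).mono hV).isCoveringMap_restrictPreimage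
  have : ContractibleSpace V := hVc.contractibleSpace ⟨z1, hz1⟩
  have : LocallyPathConnectedSpace V := hVo.locallyPathConnectedSpace
  let e1 : ESp D := ⟨ξ1, z1, hξ1⟩
  have he1 : e1.pr = z1 := ESp.pr_eq hξ1
  obtain ⟨F, ⟨hF1, hF2⟩, -⟩ := cov.existsUnique_continuousMap_lifts (ContinuousMap.id V)
    ⟨z1, hz1⟩ ⟨e1, by rw [Set.mem_preimage, he1]; exact hz1⟩ (by
      apply Subtype.ext; exact he1)
  let Ψ : ℂ → (D →+* ℂ) := fun z => if hz : z ∈ V then (F ⟨z, hz⟩).1.1 else ξ1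
  have hΨ : ∀ z (hz : z ∈ V), Ψ z = (F ⟨z, hz⟩).1.1 := fun z hz => by simp [Ψ, hz]
  have hPt : ∀ z ∈ V, IsPt (Ψ z) z := by
    intro z hz
    rw [hΨ z hz]
    have h1 := (F ⟨z, hz⟩).1.isPt
    have h2 : ((F ⟨z, hz⟩).1).pr = z := congrArg Subtype.val (congrFun hF2 ⟨z, hz⟩)
    rwa [h2] at h1
  have hc : ∀ y, ContinuousOn (fun z => Ψ z y) V := by
    intro y
    rw [continuousOn_iff_continuous_domRestrict]
    have : V.domRestrict (fun z => Ψ z y) = fun z => (F z).1.1 y := by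
      ext z
      simp [Set.domRestrict, Ψ]
    rw [this]
    exact (ESp.continuous_eval y).comp (continuous_subtype_val.comp F.continuous)
  refine ⟨Ψ, by rw [hΨ z1 hz1, hF1], fun z hz => ⟨hPt z hz, fun d => ?_⟩⟩
  obtain ⟨W, ψ, y, hWo, hzW, hsec, hall, hsep⟩ := triv g Q b z (hV z hz)
  obtain ⟨i, hi⟩ := hall z hzW (Ψ z) (hPt z hz)
  refine DifferentiableAt.congr_of_eventuallyEq ((hsec i z hzW).2 d) ?_
  have h1 : ‖Ψ z (y i) - 1‖ < 1 / 2 := by rw [hi]; exact (hsep z hzW i i).2 rfl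
  have h2 : ContinuousAt (fun z => ‖Ψ z (y i) - 1‖) z :=
    (((hc (y i)).continuousAt (hVo.mem_nhds hz)).sub continuousAt_const).norm
  filter_upwards [h2.eventually_lt continuousAt_const h1, hWo.mem_nhds hzW, hVo.mem_nhds hz]
    with w hw hwW hwV
  obtain ⟨j, hj⟩ := hall w hwW (Ψ w) (hPt w hwV)
  rw [hj] at hw
  rw [hj, (hsep w hwW i j).1 hw]

/-- Two holomorphic families agreeing at a point of a connected open set agree. -/
lemma IsSec.eqOn (g : ℂ[X]) (Q : Type) [CommRing Q] [Algebra ℂ[X] Q] [IsLocalization.Away g Q]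
    {D : Type} [CommRing D] [Algebra ℂ[X] D] [Algebra Q D] [IsScalarTower ℂ[X] Q D]
    [Algebra.Etale Q D] {n : ℕ} (b : Module.Basis (Fin n) Q D)
    {V : Set ℂ} (hVo : IsOpen V) (hVc : IsPreconnected V)
    {Ψ Φ : ℂ → (D →+* ℂ)} (hΨ : IsSec V Ψ) (hΦ : IsSec V Φ) {z1 : ℂ} (hz1 : z1 ∈ V)
    (h : Ψ z1 = Φ z1) : ∀ z ∈ V, Ψ z = Φ z := by
  intro z hz
  ext d
  have an : ∀ {Ψ : ℂ → (D →+* ℂ)}, IsSec V Ψ → AnalyticOnNhd ℂ (fun z => Ψ z d) V := by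
    intro Ψ hΨ
    refine DifferentiableOn.analyticOnNhd (fun z hz => ?_) hVo
    exact ((hΨ z hz).2 d).differentiableWithinAt
  refine (an hΨ).eqOn_of_preconnected_of_eventuallyEq (an hΦ) hVc hz1 ?_ hz
  obtain ⟨W, ψ, y, hWo, hzW, hsec, hall, hsep⟩ := triv g Q b z1 ((hΨ z1 hz1).1.ne (Q := Q))
  obtain ⟨i, hi⟩ := hall z1 hzW (Ψ z1) (hΨ z1 hz1).1
  have near : ∀ {Ψ : ℂ → (D →+* ℂ)}, IsSec V Ψ → Ψ z1 = ψ i z1 → ∀ᶠ z in 𝓝 z1, Ψ z = ψ i z := by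
    intro Ψ hΨ hi
    have h1 : ‖Ψ z1 (y i) - 1‖ < 1 / 2 := by rw [hi]; exact (hsep z1 hzW i i).2 rfl
    have h2 : ContinuousAt (fun z => ‖Ψ z (y i) - 1‖) z1 :=
      (((hΨ z1 hz1).2 (y i)).continuousAt.sub continuousAt_const).norm
    filter_upwards [h2.eventually_lt continuousAt_const h1, hWo.mem_nhds hzW, hVo.mem_nhds hz1]
      with w hw hwW hwV
    obtain ⟨j, hj⟩ := hall w hwW (Ψ w) (hΨ w hwV).1
    rw [hj] at hw
    rw [hj, (hsep w hwW i j).1 hw]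
  filter_upwards [near hΨ hi, near hΦ (h ▸ hi)] with w h1 h2
  rw [h1, h2]

end Covering

end CW

namespace CW

section Growth

open Polynomial Topology

/-- Moderate growth with respect to a weight. -/
def Mod {ι : Type*} (w : ι → ℝ) (h : ι → ℂ) : Prop :=
  ∃ (C : ℝ) (N : ℕ), 0 ≤ C ∧ ∀ i, ‖h i‖ ≤ C * w i ^ N

lemma Mod.const {ι : Type*} {w : ι → ℝ} (c : ℂ) : Mod w (fun _ => c) :=
  ⟨‖c‖, 0, norm_nonneg _, by simp⟩

lemma Mod.mul {ι : Type*} {w : ι → ℝ} {h h' : ι → ℂ} (a : Mod w h) (b : Mod w h') :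
    Mod w (fun i => h i * h' i) := by
  obtain ⟨C, N, hC, a⟩ := a
  obtain ⟨C', N', hC', b⟩ := b
  refine ⟨C * C', N + N', by positivity, fun i => ?_⟩
  rw [norm_mul]
  calc _ ≤ (C * w i ^ N) * (C' * w i ^ N') :=
        mul_le_mul (a i) (b i) (norm_nonneg _) ((norm_nonneg _).trans (a i))
    _ = _ := by ring

lemma Mod.add {ι : Type*} {w : ι → ℝ} (hw : ∀ i, 1 ≤ w i) {h h' : ι → ℂ} (a : Mod w h) (b : Mod w h') :
    Mod w (fun i => h i + h' i) := by
  obtain ⟨C, N, hC, a⟩ := a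
  obtain ⟨C', N', hC', b⟩ := b
  refine ⟨C + C', N + N', by positivity, fun i => ?_⟩
  have h1 : w i ^ N ≤ w i ^ (N + N') := pow_le_pow_right₀ (hw i) (by omega)
  have h2 : w i ^ N' ≤ w i ^ (N + N') := pow_le_pow_right₀ (hw i) (by omega)
  calc _ ≤ _ := norm_add_le _ _
    _ ≤ C * w i ^ N + C' * w i ^ N' := add_le_add (a i) (b i)
    _ ≤ C * w i ^ (N + N') + C' * w i ^ (N + N') := by gcongr
    _ = _ := by ring

lemma Mod.sum {ι κ : Type*} {w : ι → ℝ} (hw : ∀ i, 1 ≤ w i) (s : Finset κ) {h : κ → ι → ℂ}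
    (a : ∀ k ∈ s, Mod w (h k)) : Mod w (fun i => ∑ k ∈ s, h k i) := by
  classical
  induction s using Finset.induction_on with
  | empty => simpa using Mod.const (w := w) 0
  | insert k s hk ih =>
    simp only [Finset.sum_insert hk]
    exact Mod.add hw (a k (by simp)) (ih fun k' hk' => a k' (by simp [hk']))

lemma Mod.pow {ι : Type*} {w : ι → ℝ} {h : ι → ℂ} (a : Mod w h) (n : ℕ) :
    Mod w (fun i => h i ^ n) := by
  induction n with
  | zero => simpa using Mod.const (w := w) 1
  | succ n ih => simpa only [pow_succ] using ih.mul a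

lemma Mod.comp {ι κ : Type*} {w : ι → ℝ} {h : ι → ℂ} (a : Mod w h) (φ : κ → ι) :
    Mod (fun k => w (φ k)) (fun k => h (φ k)) := by
  obtain ⟨C, N, hC, a⟩ := a
  exact ⟨C, N, hC, fun k => a _⟩

lemma Mod.of_le {ι κ : Type*} [Finite κ] {w : ι → ℝ} (hw : ∀ i, 1 ≤ w i) {h : ι → ℂ} {h' : κ → ι → ℂ}
    (a : ∀ k, Mod w (h' k)) (hle : ∀ i, ‖h i‖ ≤ 1 + ∑ᶠ k, ‖h' k i‖) : Mod w h := by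
  classical
  cases nonempty_fintype κ
  have h2 : Mod w (fun i => (1 : ℂ) + ∑ k, ((‖h' k i‖ : ℝ) : ℂ)) := by
    refine Mod.add hw (Mod.const 1) (Mod.sum hw _ fun k _ => ?_)
    obtain ⟨C, N, hC, a⟩ := a k
    exact ⟨C, N, hC, fun i => by simpa using a i⟩
  obtain ⟨C, N, hC, b⟩ := h2
  refine ⟨C, N, hC, fun i => (hle i).trans (le_trans ?_ (b i))⟩
  rw [finsum_eq_sum_of_fintype]
  have : (1 : ℂ) + ∑ k, ((‖h' k i‖ : ℝ) : ℂ) = ((1 + ∑ k, ‖h' k i‖ : ℝ) : ℂ) := by push_cast; rfl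
  beta_reduce
  rw [this, Complex.norm_real]
  exact Real.le_norm_self _

/-- The weight. -/
def wt (g : ℂ[X]) (z : ℂ) : ℝ := (1 + ‖z‖) * (1 + ‖g.eval z‖⁻¹)

lemma one_le_wt (g : ℂ[X]) (z : ℂ) : 1 ≤ wt g z := by
  unfold wt
  have h1 : 0 ≤ ‖z‖ := norm_nonneg _
  have h2 : 0 ≤ ‖g.eval z‖⁻¹ := by positivity
  nlinarith [mul_nonneg h1 h2]

lemma entire_poly (f : ℂ → ℂ) (hf : Differentiable ℂ f) (C : ℝ) (N : ℕ)
    (h : ∀ z, ‖f z‖ ≤ C * (1 + ‖z‖) ^ N) : ∃ p : ℂ[X], ∀ z, f z = p.eval z := by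
  have hz : ∀ m, N < m → iteratedDeriv m f 0 = 0 := by
    intro m hm
    have hb : ∀ R : ℝ, 1 ≤ R → ‖iteratedDeriv m f 0‖ ≤ (m.factorial * C * 2 ^ N) * R⁻¹ := by
      intro R hR
      have hC : 0 ≤ C := by
        have := (norm_nonneg _).trans (h 0)
        simpa using this
      have := Complex.norm_iteratedDeriv_le_of_forall_mem_sphere_norm_le (c := 0) (R := R)
        (C := C * (1 + R) ^ N) m (by linarith) hf.diffContOnCl (fun z hz => by
          have := h z
          rwa [show ‖z‖ = R by simpa using hz] at this)
      refine this.trans ?_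
      rw [div_le_iff₀ (by positivity)]
      have h1 : (1 + R) ^ N ≤ 2 ^ N * R ^ N := by
        rw [← mul_pow]; exact pow_le_pow_left₀ (by linarith) (by linarith) _
      have h2 : R ^ N ≤ R⁻¹ * R ^ m := by
        obtain ⟨j, rfl⟩ := Nat.exists_eq_add_of_lt hm
        rw [show N + j + 1 = (N + j) + 1 from rfl, pow_succ, mul_comm, mul_assoc, mul_inv_cancel₀ (by linarith), mul_one]
        exact pow_le_pow_right₀ hR (by omega)
      calc _ ≤ m.factorial * (C * (2 ^ N * (R⁻¹ * R ^ m))) := by gcongr; exact h1.trans (by gcongr)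
        _ = _ := by ring
    have ht : Filter.Tendsto (fun R : ℝ => (m.factorial * C * 2 ^ N) * R⁻¹) Filter.atTop (𝓝 0) := by
      simpa using tendsto_inv_atTop_zero.const_mul (m.factorial * C * 2 ^ N : ℝ)
    have : ‖iteratedDeriv m f 0‖ ≤ 0 :=
      ge_of_tendsto ht (by filter_upwards [Filter.eventually_ge_atTop 1] with R hR using hb R hR)
    simpa using this
  refine ⟨∑ m ∈ Finset.range (N + 1), Polynomial.C ((m.factorial : ℂ)⁻¹ * iteratedDeriv m f 0) * X ^ m, fun z => ?_⟩
  have := Complex.taylorSeries_eq_of_entire' 0 z hf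
  rw [← this, tsum_eq_sum (s := Finset.range (N + 1))]
  · simp [Polynomial.eval_finsetSum]
  · intro m hm
    rw [hz m (by simpa [Nat.lt_succ_iff] using hm)]
    simp

lemma rational_of_moderate (g : ℂ[X]) (hg : g ≠ 0) (Q : Type) [CommRing Q] [Algebra ℂ[X] Q] [IsLocalization.Away g Q]
    (h : ℂ → ℂ) (hd : ∀ z, g.eval z ≠ 0 → DifferentiableAt ℂ h z)
    (hm : Mod (fun z : {z : ℂ // g.eval z ≠ 0} => wt g z) (fun z => h z)) :
    ∃ q : Q, ∀ z, g.eval z ≠ 0 → h z = qf g q z := by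
  obtain ⟨C, N, hC, hm⟩ := hm
  set f : ℂ → ℂ := fun z => h z * g.eval z ^ (N + 1) with hf
  have hb : ∀ z, ‖f z‖ ≤ C * (1 + ‖z‖) ^ N * (1 + ‖g.eval z‖) ^ N * ‖g.eval z‖ := by
    intro z
    by_cases hz : g.eval z = 0
    · simp [hf, hz]
    · have hp : 0 < ‖g.eval z‖ := norm_pos_iff.mpr hz
      have := hm ⟨z, hz⟩
      simp only [wt] at this
      simp only [hf, norm_mul, norm_pow]
      calc _ ≤ C * ((1 + ‖z‖) * (1 + ‖g.eval z‖⁻¹)) ^ N * ‖g.eval z‖ ^ (N + 1) := by gcongr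
        _ = C * (1 + ‖z‖) ^ N * (((1 + ‖g.eval z‖⁻¹) * ‖g.eval z‖) ^ N) * ‖g.eval z‖ := by
          rw [mul_pow, mul_pow, pow_succ]; ring
        _ = _ := by
          congr 3
          field_simp
          ring
  have hgc : Differentiable ℂ (fun z => g.eval z) := g.differentiable
  have hd1 : ∀ z, g.eval z ≠ 0 → DifferentiableAt ℂ f z := fun z hz => (hd z hz).mul ((hgc z).pow _)
  have hd2 : Differentiable ℂ f := by
    intro z
    by_cases hz : g.eval z = 0
    · refine (Complex.analyticAt_of_differentiable_on_punctured_nhds_of_continuousAt ?_ ?_).differentiableAt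
      · have : {x | x ∉ (g.rootSet ℂ \ {z})} ∈ 𝓝 z := by
          refine IsOpen.mem_nhds ?_ (by simp)
          exact (((g.rootSet_finite ℂ).subset Set.sdiff_subset).isClosed).isOpen_compl
        filter_upwards [mem_nhdsWithin_of_mem_nhds this, self_mem_nhdsWithin] with x hx hxz
        apply hd1
        intro h0
        apply hx
        simp only [Set.mem_sdiff, Set.mem_singleton_iff]
        exact ⟨by rw [mem_rootSet]; exact ⟨hg, by simpa using h0⟩, hxz⟩
      · have hfz : f z = 0 := by simp [hf, hz]
        have : Filter.Tendsto (fun x => C * (1 + ‖x‖) ^ N * (1 + ‖g.eval x‖) ^ N * ‖g.eval x‖) (𝓝 z) (𝓝 0) := by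
          have hc : Continuous (fun x => C * (1 + ‖x‖) ^ N * (1 + ‖g.eval x‖) ^ N * ‖g.eval x‖) := by
            have := hgc.continuous
            fun_prop
          have := hc.tendsto z
          simpa [hz] using this
        unfold ContinuousAt
        rw [hfz]
        exact squeeze_zero_norm hb this
    · exact hd1 z hz
  obtain ⟨C', N', hC', hgb⟩ : ∃ (C' : ℝ) (N' : ℕ), 0 ≤ C' ∧ ∀ z : ℂ, ‖g.eval z‖ ≤ C' * (1 + ‖z‖) ^ N' := by
    have : Mod (fun z : ℂ => 1 + ‖z‖) (fun z => g.eval z) := by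
      simp only [eval_eq_sum, Polynomial.sum]
      refine Mod.sum (fun i => by simp) _ fun k _ => (Mod.const _).mul (Mod.pow ⟨1, 1, by simp, fun i => by simp⟩ k)
    exact this
  obtain ⟨C2, N2, -, hfb⟩ : Mod (fun z : ℂ => 1 + ‖z‖) f := by
    refine ⟨C * (1 + C') ^ N * C', N + N' * N + N', by positivity, fun z => (hb z).trans ?_⟩
    have h1 : 1 + ‖g.eval z‖ ≤ (1 + C') * (1 + ‖z‖) ^ N' := by
      have : (1 : ℝ) ≤ (1 + ‖z‖) ^ N' := one_le_pow₀ (by simp)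
      nlinarith [hgb z]
    calc _ ≤ C * (1 + ‖z‖) ^ N * ((1 + C') * (1 + ‖z‖) ^ N') ^ N * (C' * (1 + ‖z‖) ^ N') := by
          gcongr; exact hgb z
      _ = _ := by rw [mul_pow, ← pow_mul, pow_add, pow_add]; ring
  obtain ⟨p, hp⟩ := entire_poly f hd2 C2 N2 hfb
  obtain ⟨u, hu⟩ := IsLocalization.Away.algebraMap_isUnit (S := Q) g
  refine ⟨algebraMap ℂ[X] Q p * (↑(u⁻¹ : Qˣ)) ^ (N + 1), fun z hz => ?_⟩
  rw [qf_eq _ z hz, map_mul, evQ_algebraMap, ← hp, map_pow, hf]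
  have : evQ g Q z hz (↑(u⁻¹ : Qˣ)) * g.eval z = 1 := by
    rw [← evQ_algebraMap (Q := Q) z hz, ← hu, ← map_mul]; simp
  calc h z = h z * (evQ g Q z hz (↑(u⁻¹ : Qˣ)) * g.eval z) ^ (N + 1) := by rw [this]; simp
    _ = _ := by ring

lemma Mod_qf (g : ℂ[X]) {Q : Type} [CommRing Q] [Algebra ℂ[X] Q] [IsLocalization.Away g Q] (q : Q) :
    Mod (fun z : {z : ℂ // g.eval z ≠ 0} => wt g z) (fun z => qf g q z) := by
  obtain ⟨p, n, -, h⟩ := exists_qf_eq g q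
  have : (fun z : {z : ℂ // g.eval z ≠ 0} => qf g q z) = fun z => p.eval z.1 * ((g.eval z.1)⁻¹) ^ n := by
    ext z; rw [h z z.2, inv_pow]; rfl
  rw [this]
  have hid : Mod (fun z : {z : ℂ // g.eval z ≠ 0} => wt g z) (fun z => z.1) := by
    refine ⟨1, 1, by simp, fun z => ?_⟩
    have h2 : 0 ≤ ‖g.eval z.1‖⁻¹ := by positivity
    simp only [wt, pow_one, one_mul]
    nlinarith [norm_nonneg z.1, mul_nonneg (norm_nonneg z.1) h2]
  have hinv : Mod (fun z : {z : ℂ // g.eval z ≠ 0} => wt g z) (fun z => (g.eval z.1)⁻¹) := by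
    refine ⟨1, 1, by simp, fun z => ?_⟩
    have h2 : 0 ≤ ‖g.eval z.1‖⁻¹ := by positivity
    simp only [wt, pow_one, one_mul, norm_inv]
    nlinarith [norm_nonneg z.1, mul_nonneg (norm_nonneg z.1) h2]
  refine Mod.mul ?_ (hinv.pow n)
  simp only [eval_eq_sum, Polynomial.sum]
  exact Mod.sum (fun i => one_le_wt g _) _ fun k _ => (Mod.const _).mul (hid.pow k)

/-- points -/
def PtT (D : Type) [CommRing D] [Algebra ℂ[X] D] : Type := {p : ℂ × (D →+* ℂ) // IsPt p.2 p.1}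

lemma root_bound {p : ℂ[X]} (hp : p.Monic) {t : ℂ} (ht : p.eval t = 0) :
    ‖t‖ ≤ 1 + ∑ i ∈ Finset.range p.natDegree, ‖p.coeff i‖ := by
  have hs : 0 ≤ ∑ i ∈ Finset.range p.natDegree, ‖p.coeff i‖ := Finset.sum_nonneg fun _ _ => norm_nonneg _
  by_cases h1 : ‖t‖ ≤ 1
  · linarith
  push Not at h1
  rw [eval_eq_sum_range, Finset.sum_range_succ, hp.coeff_natDegree, one_mul] at ht
  have hn : p.natDegree ≠ 0 := by
    intro h0; rw [h0] at ht; simp at ht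
  obtain ⟨n, hn⟩ := Nat.exists_eq_succ_of_ne_zero hn
  have h2 : ‖t‖ ^ p.natDegree ≤ (∑ i ∈ Finset.range p.natDegree, ‖p.coeff i‖) * ‖t‖ ^ n := by
    rw [← norm_pow, ← neg_eq_iff_add_eq_zero.mpr ht, norm_neg, Finset.sum_mul]
    refine (norm_sum_le _ _).trans (Finset.sum_le_sum fun i hi => ?_)
    rw [norm_mul, norm_pow]
    have : i ≤ n := by rw [hn] at hi; simpa [Nat.lt_succ_iff] using hi
    gcongr
    exact h1.le
  nth_rewrite 1 [hn] at h2
  rw [pow_succ, mul_comm] at h2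
  have := le_of_mul_le_mul_right h2 (by positivity)
  linarith

lemma Mod_pt (g : ℂ[X]) (Q : Type) [CommRing Q] [Algebra ℂ[X] Q] [IsLocalization.Away g Q]
    {D : Type} [CommRing D] [Algebra ℂ[X] D] [Algebra Q D] [IsScalarTower ℂ[X] Q D]
    [Module.Finite Q D] (y : D) : Mod (fun p : PtT D => wt g p.1.1) (fun p => p.1.2 y) := by
  obtain ⟨P, hP, hy⟩ := Algebra.IsIntegral.isIntegral (R := Q) y
  have hne : ∀ p : PtT D, g.eval p.1.1 ≠ 0 := fun p => p.2.ne (g := g) (Q := Q)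
  refine Mod.of_le (κ := Fin P.natDegree) (h' := fun i p => qf g (P.coeff i) p.1.1)
    (fun _ => one_le_wt g _) (fun i => ?_) fun p => ?_
  · exact (Mod_qf g (P.coeff i)).comp (fun p : PtT D => (⟨p.1.1, hne p⟩ : {z : ℂ // g.eval z ≠ 0}))
  · have := root_bound (p := P.map (evQ g Q p.1.1 (hne p))) (hP.map _) (t := p.1.2 y) (by
      rw [Polynomial.eval_map, ← p.2.comp (hne p), ← hom_eval₂, hy, map_zero])
    rw [hP.natDegree_map] at this
    rw [finsum_eq_sum_of_fintype]
    refine this.trans (le_of_eq ?_)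
    rw [Finset.sum_range]
    simp [qf_eq _ _ (hne p)]

end Growth

end CW

namespace CW

section HolMem

open Polynomial Topology

lemma exists_ne_root (g : ℂ[X]) (hg : g ≠ 0) (p : ℂ[X]) (hp : ∀ z, g.eval z ≠ 0 → p.eval z = 0) : p = 0 := by
  have : p * g = 0 := by
    refine Polynomial.funext fun z => ?_
    by_cases hz : g.eval z = 0
    · simp [hz]
    · simp [hp z hz]
  simpa [hg] using this

lemma qf_inj (g : ℂ[X]) (hg : g ≠ 0) {Q : Type} [CommRing Q] [Algebra ℂ[X] Q] [IsLocalization.Away g Q]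
    (q : Q) (h : ∀ z, g.eval z ≠ 0 → qf g q z = 0) : q = 0 := by
  obtain ⟨p, n, hq, hp⟩ := exists_qf_eq g q
  have : p = 0 := exists_ne_root g hg p fun z hz => by
    have := h z hz
    rw [hp z hz, div_eq_zero_iff] at this
    exact this.resolve_right (pow_ne_zero _ hz)
  rw [this, map_zero] at hq
  exact ((IsLocalization.Away.algebraMap_isUnit (S := Q) g).pow n).mul_left_eq_zero.mp hq

lemma unit_of_ne (g : ℂ[X]) (hg : g ≠ 0) {Q : Type} [CommRing Q] [Algebra ℂ[X] Q] [IsLocalization.Away g Q]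
    (q : Q) (h : ∀ z, g.eval z ≠ 0 → qf g q z ≠ 0) : IsUnit q := by
  obtain ⟨p, n, hq, hp⟩ := exists_qf_eq g q
  have hr : ∀ z, p.eval z = 0 → g.eval z = 0 := fun z hz => by
    by_contra h0
    apply h z h0
    rw [hp z h0, hz, zero_div]
  have hp0 : p ≠ 0 := by
    rintro rfl
    apply hg
    exact Polynomial.funext fun z => by simpa using hr z (by simp)
  have hu : IsUnit (algebraMap ℂ[X] Q p) := by
    have hs := (IsAlgClosed.splits p).eq_prod_roots
    rw [hs, map_mul, map_multiset_prod, Multiset.map_map]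
    refine IsUnit.mul ?_ ?_
    · exact ((Polynomial.isUnit_C).mpr (isUnit_iff_ne_zero.mpr (by simpa using hp0))).map _
    · refine Multiset.prod_induction IsUnit _ (fun _ _ => IsUnit.mul) isUnit_one ?_
      intro a ha
      obtain ⟨r, hr', rfl⟩ := Multiset.mem_map.mp ha
      have : X - Polynomial.C r ∣ g := dvd_iff_isRoot.mpr (hr r ((mem_roots hp0).mp hr'))
      exact isUnit_of_dvd_unit (map_dvd (algebraMap ℂ[X] Q) this) (IsLocalization.Away.algebraMap_isUnit (S := Q) g)
  rw [← hq] at hu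
  exact isUnit_of_mul_isUnit_left hu

variable (g : ℂ[X]) (hg : g ≠ 0) (Q : Type) [CommRing Q] [Algebra ℂ[X] Q] [IsLocalization.Away g Q]
    {D : Type} [CommRing D] [Algebra ℂ[X] D] [Algebra Q D] [IsScalarTower ℂ[X] Q D]
    [Algebra.Etale Q D] {n : ℕ} (b : Module.Basis (Fin n) Q D)

/-- Sum over the fiber. -/
def fsum {D : Type} [CommRing D] [Algebra ℂ[X] D] (u : (D →+* ℂ) → ℂ) (z : ℂ) : ℂ :=
  ∑ᶠ ξ ∈ {ξ : D →+* ℂ | IsPt ξ z}, u ξ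

lemma fsum_eq {D : Type} [CommRing D] [Algebra ℂ[X] D] (u : (D →+* ℂ) → ℂ) (z : ℂ) {n : ℕ} (ψ : Fin n → (D →+* ℂ))
    (h1 : ∀ i, IsPt (ψ i) z) (h2 : Function.Injective ψ) (h3 : ∀ ξ, IsPt ξ z → ∃ i, ξ = ψ i) :
    fsum u z = ∑ i, u (ψ i) := by
  have : {ξ : D →+* ℂ | IsPt ξ z} = Set.range ψ := by
    ext ξ
    constructor
    · intro h; obtain ⟨i, hi⟩ := h3 ξ h; exact ⟨i, hi.symm⟩
    · rintro ⟨i, rfl⟩; exact h1 i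
  rw [fsum, this, finsum_mem_range h2, finsum_eq_sum_of_fintype]

/-- Holomorphic functions on the space of points. -/
def HolPt {D : Type} [CommRing D] [Algebra ℂ[X] D] (u : (D →+* ℂ) → ℂ) : Prop :=
  ∀ (V : Set ℂ) (Ψ : ℂ → (D →+* ℂ)), IsOpen V → IsSec V Ψ → ∀ z ∈ V, DifferentiableAt ℂ (fun z => u (Ψ z)) z

include hg b in
lemma fsum_rational (u : (D →+* ℂ) → ℂ) (hu : HolPt u)
    (hm : Mod (fun p : PtT D => wt g p.1.1) (fun p => u p.1.2)) :
    ∃ q : Q, ∀ z, g.eval z ≠ 0 → fsum u z = qf g q z := by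
  refine rational_of_moderate g hg Q (fsum u) (fun z hz => ?_) ?_
  · obtain ⟨W, ψ, y, hW, hzW, hψ, hall, hy⟩ := triv g Q b z hz
    have : (fun z => ∑ i, u (ψ i z)) =ᶠ[𝓝 z] fsum u := by
      filter_upwards [hW.mem_nhds hzW] with x hx
      symm
      refine fsum_eq u x (fun i => ψ i x) (fun i => (hψ i x hx).1) (fun i j hij => ?_) (hall x hx)
      have h1 := (hy x hx i i).mpr rfl
      rw [show ψ i x = ψ j x from hij] at h1
      exact ((hy x hx i j).mp h1).symm
    refine DifferentiableAt.congr_of_eventuallyEq ?_ this.symm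
    exact DifferentiableAt.fun_sum fun i _ => hu W (ψ i) hW (hψ i) z hzW
  · choose ξ h1 h2 h3 h4 using fun z : {z : ℂ // g.eval z ≠ 0} => fiber_points g Q b z.1 z.2
    have : (fun z : {z : ℂ // g.eval z ≠ 0} => fsum u z.1) = fun z => ∑ i, u (ξ z i) := by
      ext z
      exact fsum_eq u z.1 (ξ z) (h1 z) (h2 z) (h3 z)
    rw [this]
    refine Mod.sum (fun z => one_le_wt g _) _ fun i _ => ?_
    exact hm.comp (fun z : {z : ℂ // g.eval z ≠ 0} => (⟨(z.1, ξ z i), h1 z i⟩ : PtT D))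

lemma HolPt_apply {D : Type} [CommRing D] [Algebra ℂ[X] D] (y : D) : HolPt (fun ξ : D →+* ℂ => ξ y) :=
  fun _ _ _ hΨ z hz => (hΨ z hz).2 y

lemma HolPt.mul {D : Type} [CommRing D] [Algebra ℂ[X] D] {u v : (D →+* ℂ) → ℂ} (hu : HolPt u) (hv : HolPt v) :
    HolPt (fun ξ => u ξ * v ξ) :=
  fun V Ψ hV hΨ z hz => (hu V Ψ hV hΨ z hz).mul (hv V Ψ hV hΨ z hz)

lemma IsPt.apply_basis {ξ : D →+* ℂ} {z : ℂ} (h : IsPt ξ z) (c : Fin n → Q) :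
    ξ (∑ i, c i • b i) = ∑ i, qf g (c i) z * ξ (b i) := by
  simp [Algebra.smul_def, h.apply (g := g)]

include g in
lemma fiber_det {z : ℂ} {ξ : Fin n → (D →+* ℂ)} (h1 : ∀ i, IsPt (ξ i) z)
    (h4 : ∀ v : Fin n → ℂ, ∃ y, ∀ i, ξ i y = v i) :
    (Matrix.of fun a i => ξ a (b i)).det ≠ 0 := by
  choose y hy using fun j : Fin n => h4 (Pi.single j 1)
  have : (Matrix.of fun a i => ξ a (b i)) * (Matrix.of fun i j => qf g (b.repr (y j) i) z) = 1 := by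
    ext a j
    rw [Matrix.mul_apply]
    have h := (h1 a).apply_basis g Q b (fun i => b.repr (y j) i)
    rw [b.sum_repr, hy] at h
    simp only [Matrix.of_apply]
    rw [Matrix.one_apply]
    simp only [mul_comm (ξ a (b _))]
    rw [← h, Pi.single_apply]
  exact (Matrix.isUnit_iff_isUnit_det _ |>.mp (IsUnit.of_mul_eq_one _ this)).ne_zero

include hg b in
lemma pts_inj (y : D) (hy : ∀ z ξ, IsPt ξ z → ξ y = 0) : y = 0 := by
  have key : ∀ z, g.eval z ≠ 0 → ∀ i, qf g (b.repr y i) z = 0 := by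
    intro z hz
    obtain ⟨ξ, h1, h2, h3, h4⟩ := fiber_points g Q b z hz
    have hd := fiber_det g Q b h1 h4
    have := Matrix.eq_zero_of_mulVec_eq_zero hd (v := fun i => qf g (b.repr y i) z) (by
      ext a
      have h := (h1 a).apply_basis g Q b (fun i => b.repr y i)
      rw [b.sum_repr, hy z _ (h1 a)] at h
      simp only [Matrix.mulVec, dotProduct, Matrix.of_apply, mul_comm (ξ a (b _))]
      rw [← h]; rfl)
    exact fun i => congrFun this i
  rw [← b.sum_repr y]
  exact Finset.sum_eq_zero fun i _ => by rw [qf_inj g hg _ fun z hz => key z hz i, zero_smul]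

include hg b in
lemma hol_mem (u : (D →+* ℂ) → ℂ) (hu : HolPt u)
    (hm : Mod (fun p : PtT D => wt g p.1.1) (fun p => u p.1.2)) :
    ∃ y : D, ∀ z ξ, IsPt ξ z → u ξ = ξ y := by
  have : Module.Finite Q D := Module.Finite.of_basis b
  choose M hM using fun i j => fsum_rational g hg Q b (fun ξ => ξ (b i) * ξ (b j))
    ((HolPt_apply _).mul (HolPt_apply _)) ((Mod_pt g Q _).mul (Mod_pt g Q _))
  choose t ht using fun j => fsum_rational g hg Q b (fun ξ => u ξ * ξ (b j))
    (hu.mul (HolPt_apply _)) (hm.mul (Mod_pt g Q _))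
  set MM : Matrix (Fin n) (Fin n) Q := Matrix.of M with hMM
  have hdet : IsUnit MM.det := by
    refine unit_of_ne g hg _ fun z hz => ?_
    obtain ⟨ξ, h1, h2, h3, h4⟩ := fiber_points g Q b z hz
    have hd := fiber_det g Q b h1 h4
    rw [qf_eq _ z hz, RingHom.map_det]
    have : (evQ g Q z hz).mapMatrix MM = (Matrix.of fun a i => ξ a (b i)).transpose * (Matrix.of fun a i => ξ a (b i)) := by
      ext i j
      rw [Matrix.mul_apply, RingHom.mapMatrix_apply, Matrix.map_apply, hMM, Matrix.of_apply, ← qf_eq _ z hz, ← hM i j z hz,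
        fsum_eq _ z ξ h1 h2 h3]
      rfl
    rw [this, Matrix.det_mul, Matrix.det_transpose]
    exact mul_ne_zero hd hd
  set c := (MM⁻¹).transpose.mulVec t with hc
  have hcM : ∀ j, ∑ i, c i * M i j = t j := by
    have : MM.transpose.mulVec c = t := by
      rw [hc, Matrix.mulVec_mulVec, ← Matrix.transpose_mul, Matrix.nonsing_inv_mul _ hdet, Matrix.transpose_one, Matrix.one_mulVec]
    intro j
    rw [← this]
    simp [Matrix.mulVec, dotProduct, hMM, mul_comm]
  refine ⟨∑ i, c i • b i, fun z ξ0 h0 => ?_⟩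
  have hz : g.eval z ≠ 0 := h0.ne (g := g) (Q := Q)
  obtain ⟨ξ, h1, h2, h3, h4⟩ := fiber_points g Q b z hz
  have hd := fiber_det g Q b h1 h4
  obtain ⟨a0, rfl⟩ := h3 ξ0 h0
  have := Matrix.eq_zero_of_vecMul_eq_zero hd (v := fun a => u (ξ a) - ξ a (∑ i, c i • b i)) (by
    ext j
    simp only [Matrix.vecMul, dotProduct, Matrix.of_apply, sub_mul, Finset.sum_sub_distrib, Pi.zero_apply]
    rw [sub_eq_zero]
    have e1 := ht j z hz
    rw [fsum_eq _ z ξ h1 h2 h3] at e1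
    rw [e1, ← hcM j, qf_eq _ z hz, map_sum]
    simp only [map_mul]
    simp only [← qf_eq _ z hz, ← hM _ j z hz, fsum_eq _ z ξ h1 h2 h3]
    simp only [(h1 _).apply_basis g Q b, Finset.mul_sum, Finset.sum_mul]
    rw [Finset.sum_comm]
    simp [mul_assoc])
  exact sub_eq_zero.mp (congrFun this a0)

include hg b in
lemma exists_gamma {D' : Type} [CommRing D'] [Algebra ℂ[X] D'] [Algebra Q D'] [IsScalarTower ℂ[X] Q D']
    [Module.Finite Q D'] (β : (D →+* ℂ) → (D' →+* ℂ)) (hβ : ∀ z ξ, IsPt ξ z → IsPt (β ξ) z)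
    (hβ' : ∀ x', HolPt (fun ξ => β ξ x')) :
    ∃ γ : D' →ₐ[Q] D, ∀ z ξ, IsPt ξ z → ∀ x', ξ (γ x') = β ξ x' := by
  choose γ hγ using fun x' : D' => hol_mem g hg Q b (fun ξ => β ξ x') (hβ' x')
    ((Mod_pt g Q x').comp (fun p : PtT D => (⟨(p.1.1, β p.1.2), hβ _ _ p.2⟩ : PtT D')))
  have ext : ∀ x y : D, (∀ z ξ, IsPt ξ z → ξ x = ξ y) → x = y := fun x y h =>
    sub_eq_zero.mp (pts_inj g hg Q b _ fun z ξ hξ => by rw [map_sub, h z ξ hξ, sub_self])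
  refine ⟨{ toFun := γ, map_one' := ?_, map_mul' := ?_, map_zero' := ?_, map_add' := ?_, commutes' := ?_ }, ?_⟩
  · exact ext _ _ fun z ξ h => by rw [← hγ _ z ξ h]; simp
  · exact fun x y => ext _ _ fun z ξ h => by rw [map_mul, ← hγ _ z ξ h, ← hγ _ z ξ h, ← hγ _ z ξ h, map_mul]
  · exact ext _ _ fun z ξ h => by rw [← hγ _ z ξ h]; simp
  · exact fun x y => ext _ _ fun z ξ h => by rw [map_add, ← hγ _ z ξ h, ← hγ _ z ξ h, ← hγ _ z ξ h, map_add]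
  · intro q
    refine ext _ _ fun z ξ h => ?_
    change ξ (γ _) = _
    rw [← hγ _ z ξ h, h.apply (g := g), (hβ z ξ h).apply (g := g)]
  · exact fun z ξ h x' => (hγ x' z ξ h).symm

end HolMem

end CW

namespace CW

section TypeLemma

open Polynomial Topology

/-- Four half planes. -/
def halfP (a : Fin 4) (s : ℂ) : Set ℂ :=
  match a with
  | 0 => {z | s.re < z.re}
  | 1 => {z | z.re < s.re}
  | 2 => {z | s.im < z.im}
  | 3 => {z | z.im < s.im}

lemma halfP_open (a : Fin 4) (s : ℂ) : IsOpen (halfP a s) := by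
  fin_cases a
  · exact isOpen_lt continuous_const Complex.continuous_re
  · exact isOpen_lt Complex.continuous_re continuous_const
  · exact isOpen_lt continuous_const Complex.continuous_im
  · exact isOpen_lt Complex.continuous_im continuous_const

lemma halfP_convex (a : Fin 4) (s : ℂ) : Convex ℝ (halfP a s) := by
  fin_cases a
  · exact convex_halfSpace_re_gt _
  · exact convex_halfSpace_re_lt _
  · exact convex_halfSpace_im_gt _
  · exact convex_halfSpace_im_lt _

lemma halfP_iff (z s : ℂ) : z ≠ s ↔ ∃ a, z ∈ halfP a s := by
  constructor
  · intro h
    by_cases h1 : z.re = s.re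
    · have h2 : z.im ≠ s.im := fun h2 => h (Complex.ext h1 h2)
      rcases lt_or_gt_of_ne h2 with h | h
      · exact ⟨3, h⟩
      · exact ⟨2, h⟩
    · rcases lt_or_gt_of_ne h1 with h | h
      · exact ⟨1, h⟩
      · exact ⟨0, h⟩
  · rintro ⟨a, ha⟩ rfl
    fin_cases a
    · exact lt_irrefl z.re ha
    · exact lt_irrefl z.re ha
    · exact lt_irrefl z.im ha
    · exact lt_irrefl z.im ha

lemma cover (g : ℂ[X]) (hg : g ≠ 0) : ∃ (J : Type) (_ : Finite J) (V : J → Set ℂ),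
    (∀ j, IsOpen (V j) ∧ Convex ℝ (V j)) ∧ (∀ z, g.eval z ≠ 0 ↔ ∃ j, z ∈ V j) := by
  refine ⟨g.rootSet ℂ → Fin 4, ?_, fun σ => ⋂ s : g.rootSet ℂ, halfP (σ s) s, fun σ => ⟨?_, ?_⟩, fun z => ?_⟩
  · have := (g.rootSet_finite ℂ).to_subtype
    infer_instance
  · have := (g.rootSet_finite ℂ).to_subtype
    exact isOpen_iInter_of_finite fun s => halfP_open _ _
  · exact convex_iInter fun s => halfP_convex _ _
  · have : g.eval z ≠ 0 ↔ ∀ s : g.rootSet ℂ, z ≠ s := by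
      constructor
      · rintro h ⟨s, hs⟩ rfl
        apply h
        simpa using (mem_rootSet.mp hs).2
      · intro h h0
        exact h ⟨z, mem_rootSet.mpr ⟨hg, by simpa using h0⟩⟩ rfl
    rw [this]
    simp only [halfP_iff, Set.mem_iInter]
    exact Classical.skolem

/-- Trivialization over `V` by `n` sections. -/
def IsTriv {D : Type} [CommRing D] [Algebra ℂ[X] D] {n : ℕ} (V : Set ℂ) (Ψ : Fin n → ℂ → (D →+* ℂ)) : Prop :=
  (∀ i, IsSec V (Ψ i)) ∧ ∀ z ∈ V, ∀ ξ, IsPt ξ z → ∃ i, ξ = Ψ i z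

lemma exists_triv (g : ℂ[X]) (Q : Type) [CommRing Q] [Algebra ℂ[X] Q] [IsLocalization.Away g Q]
    {D : Type} [CommRing D] [Algebra ℂ[X] D] [Algebra Q D] [IsScalarTower ℂ[X] Q D]
    [Algebra.Etale Q D] {n : ℕ} [NeZero n] (b : Module.Basis (Fin n) Q D) (ξ0 : D →+* ℂ)
    (V : Set ℂ) (hVo : IsOpen V) (hVc : Convex ℝ V) (hV : ∀ z ∈ V, g.eval z ≠ 0) :
    ∃ Ψ : Fin n → ℂ → (D →+* ℂ), IsTriv V Ψ := by
  rcases V.eq_empty_or_nonempty with rfl | ⟨c, hc⟩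
  · exact ⟨fun _ _ => ξ0, fun i z hz => hz.elim, fun z hz => hz.elim⟩
  obtain ⟨ξ, h1, h2, h3, -⟩ := fiber_points g Q b c (hV c hc)
  choose Ψ hΨ0 hΨ using fun i => exists_sec g Q b V hVo hVc hV c hc (ξ i) (h1 i)
  refine ⟨Ψ, hΨ, fun z hz ξ' hξ' => ?_⟩
  obtain ⟨η, k1, k2, k3, -⟩ := fiber_points g Q b z (hV z hz)
  choose e he using fun i => k3 (Ψ i z) (hΨ i z hz).1
  have hinj : Function.Injective e := by
    intro i j hij
    apply h2
    rw [← hΨ0, ← hΨ0]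
    exact IsSec.eqOn g Q b hVo hVc.isPreconnected (hΨ i) (hΨ j) hz (by rw [he, he, hij]) c hc
  obtain ⟨i', rfl⟩ := k3 ξ' hξ'
  obtain ⟨i, rfl⟩ := (Finite.injective_iff_surjective.mp hinj) i'
  exact ⟨i, (he i).symm⟩

/-- The combinatorial type of a pointed covering. -/
def HasType {J : Type} (V : J → Set ℂ) (j0 : J) (d : ℕ)
    (D : Type) [CommRing D] [Algebra ℂ[X] D] (ξ0 : D →+* ℂ)
    (τ : Σ n : Fin (d + 1), (J → J → Fin n → Fin n → Prop) × Fin n) : Prop :=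
  ∃ Ψ : J → Fin τ.1 → ℂ → (D →+* ℂ), (∀ j, IsTriv (V j) (Ψ j)) ∧
    (∀ j j' i i', τ.2.1 j j' i i' ↔ ∃ z ∈ V j ∩ V j', Ψ j i z = Ψ j' i' z) ∧ ξ0 = Ψ j0 τ.2.2 0

lemma IsPt.unique {D : Type} [CommRing D] [Algebra ℂ[X] D] {ξ : D →+* ℂ} {z z' : ℂ} (h : IsPt ξ z) (h' : IsPt ξ z') :
    z = z' := by
  have h1 := h X
  rw [h' X] at h1
  simpa using h1.symm

lemma same_type (g : ℂ[X]) (hg : g ≠ 0) (Q : Type) [CommRing Q] [Algebra ℂ[X] Q] [IsLocalization.Away g Q]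
    {J : Type} (V : J → Set ℂ) (hV1 : ∀ j, IsOpen (V j) ∧ Convex ℝ (V j))
    (hV2 : ∀ z, g.eval z ≠ 0 ↔ ∃ j, z ∈ V j) (j0 : J) (hj0 : 0 ∈ V j0) (d : ℕ)
    (D : Type) [CommRing D] [Algebra ℂ[X] D] [Algebra Q D] [IsScalarTower ℂ[X] Q D]
    [Algebra.Etale Q D] {n : ℕ} (b : Module.Basis (Fin n) Q D)
    (D' : Type) [CommRing D'] [Algebra ℂ[X] D'] [Algebra Q D'] [IsScalarTower ℂ[X] Q D']
    [Algebra.Etale Q D'] {n' : ℕ} (b' : Module.Basis (Fin n') Q D')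
    (ξ0 : D →+* ℂ) (ξ0' : D' →+* ℂ)
    (τ : Σ n : Fin (d + 1), (J → J → Fin n → Fin n → Prop) × Fin n)
    (h : HasType V j0 d D ξ0 τ) (h' : HasType V j0 d D' ξ0' τ) :
    ∃ γ : D' →ₐ[Q] D, ∀ x', ξ0 (γ x') = ξ0' x' := by
  classical
  obtain ⟨n, G, a0⟩ := τ
  obtain ⟨Ψ, h1, h2, h3⟩ := h
  obtain ⟨Ψ', h1', h2', h3'⟩ := h'
  simp only at h2 h3 h2' h3'
  have : Module.Finite Q D' := Module.Finite.of_basis b'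
  let R : (D →+* ℂ) → (D' →+* ℂ) → Prop := fun ξ ξ' => ∃ z j i, z ∈ V j ∧ ξ = Ψ j i z ∧ ξ' = Ψ' j i z
  have hex : ∀ z ξ, IsPt ξ z → ∃ ξ', R ξ ξ' := by
    intro z ξ hξ
    obtain ⟨j, hj⟩ := (hV2 z).mp (hξ.ne (g := g) (Q := Q))
    obtain ⟨i, hi⟩ := (h1 j).2 z hj ξ hξ
    exact ⟨_, z, j, i, hj, hi, rfl⟩
  have hun : ∀ ξ ξ1 ξ2, R ξ ξ1 → R ξ ξ2 → ξ1 = ξ2 := by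
    rintro ξ ξ1 ξ2 ⟨z, j, i, hz, hi, rfl⟩ ⟨z', j', i', hz', hi', rfl⟩
    have hp : IsPt ξ z := hi ▸ ((h1 j).1 i z hz).1
    have hp' : IsPt ξ z' := hi' ▸ ((h1 j').1 i' z' hz').1
    obtain rfl := hp.unique hp'
    have hG := (h2 j j' i i').mpr ⟨z, ⟨hz, hz'⟩, hi ▸ hi'⟩
    obtain ⟨w, hw, hww⟩ := (h2' j j' i i').mp hG
    exact IsSec.eqOn g Q b' ((hV1 j).1.inter (hV1 j').1) ((hV1 j).2.inter (hV1 j').2).isPreconnected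
      (((h1' j).1 i).mono Set.inter_subset_left) (((h1' j').1 i').mono Set.inter_subset_right) hw hww z ⟨hz, hz'⟩
  let β : (D →+* ℂ) → (D' →+* ℂ) := fun ξ => if h : ∃ ξ', R ξ ξ' then h.choose else ξ0'
  have hβ : ∀ ξ ξ', R ξ ξ' → β ξ = ξ' := fun ξ ξ' hR => by
    have hh : ∃ ξ', R ξ ξ' := ⟨ξ', hR⟩
    simp only [β, hh, dif_pos]
    exact hun _ _ _ hh.choose_spec hR
  obtain ⟨γ, hγ⟩ := exists_gamma g hg Q b β (fun z ξ hξ => by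
      obtain ⟨ξ', hR⟩ := hex z ξ hξ
      rw [hβ _ _ hR]
      obtain ⟨z', j, i, hz, rfl, rfl⟩ := hR
      obtain rfl := hξ.unique ((h1 j).1 i z' hz).1
      exact ((h1' j).1 i z hz).1) (by
    intro x' W Φ hW hΦ z hz
    have hpt := (hΦ z hz).1
    obtain ⟨j, hj⟩ := (hV2 z).mp (hpt.ne (g := g) (Q := Q))
    obtain ⟨i, hi⟩ := (h1 j).2 z hj _ hpt
    obtain ⟨r, hr, hball⟩ := Metric.isOpen_iff.mp (hW.inter (hV1 j).1) z ⟨hz, hj⟩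
    have heq : ∀ w ∈ Metric.ball z r, Φ w = Ψ j i w :=
      IsSec.eqOn g Q b Metric.isOpen_ball (convex_ball z r).isPreconnected
        (hΦ.mono fun w hw => (hball hw).1) (((h1 j).1 i).mono fun w hw => (hball hw).2)
        (Metric.mem_ball_self hr) hi
    refine (((h1' j).1 i z hj).2 x').congr_of_eventuallyEq ?_
    filter_upwards [Metric.ball_mem_nhds z hr] with w hw
    rw [hβ (Φ w) (Ψ' j i w) ⟨w, j, i, (hball hw).2, heq w hw, rfl⟩])
  refine ⟨γ, fun x' => ?_⟩
  rw [hγ 0 ξ0 (h3 ▸ ((h1 j0).1 a0 0 hj0).1) x', hβ ξ0 ξ0' ⟨0, j0, a0, hj0, h3, h3'⟩]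

lemma type_lemma (g : ℂ[X]) (hg0 : g.eval 0 ≠ 0) (Q : Type) [CommRing Q] [Algebra ℂ[X] Q] [IsLocalization.Away g Q]
    (d : ℕ) : ∃ (T : Type) (_ : Finite T)
      (HT : ∀ (D : Type) [CommRing D] [Algebra ℂ[X] D] (_ : D →+* ℂ), T → Prop),
      (∀ (D : Type) [CommRing D] [Algebra ℂ[X] D] [Algebra Q D] [IsScalarTower ℂ[X] Q D]
        [Algebra.Etale Q D] (ξ0 : D →+* ℂ) (n : ℕ) (_ : Module.Basis (Fin n) Q D),
        n ≤ d → IsPt ξ0 0 → ∃ τ, HT D ξ0 τ) ∧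
      (∀ (D : Type) [CommRing D] [Algebra ℂ[X] D] [Algebra Q D] [IsScalarTower ℂ[X] Q D]
        [Algebra.Etale Q D] (ξ0 : D →+* ℂ) (n : ℕ) (_ : Module.Basis (Fin n) Q D)
        (D' : Type) [CommRing D'] [Algebra ℂ[X] D'] [Algebra Q D'] [IsScalarTower ℂ[X] Q D']
        [Algebra.Etale Q D'] (ξ0' : D' →+* ℂ) (n' : ℕ) (_ : Module.Basis (Fin n') Q D') (τ : T),
        HT D ξ0 τ → HT D' ξ0' τ → ∃ γ : D' →ₐ[Q] D, ∀ x', ξ0 (γ x') = ξ0' x') := by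
  have hg : g ≠ 0 := by rintro rfl; simp at hg0
  obtain ⟨J, hJ, V, hV1, hV2⟩ := cover g hg
  obtain ⟨j0, hj0⟩ := (hV2 0).mp hg0
  refine ⟨Σ n : Fin (d + 1), (J → J → Fin n → Fin n → Prop) × Fin n, inferInstance,
    fun D _ _ ξ0 τ => HasType V j0 d D ξ0 τ, ?_, ?_⟩
  · intro D _ _ _ _ _ ξ0 n b hn hξ0
    have hn0 : NeZero n := ⟨by
      rintro rfl
      obtain ⟨ξ, -, -, h, -⟩ := fiber_points g Q b 0 hg0
      exact (h ξ0 hξ0).choose.elim0⟩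
    choose Ψ hΨ using fun j => exists_triv g Q b ξ0 (V j) (hV1 j).1 (hV1 j).2 (fun z hz => (hV2 z).mpr ⟨j, hz⟩)
    obtain ⟨a0, ha0⟩ := (hΨ j0).2 0 hj0 ξ0 hξ0
    exact ⟨⟨⟨n, by omega⟩, fun j j' i i' => ∃ z ∈ V j ∩ V j', Ψ j i z = Ψ j' i' z, a0⟩, Ψ, hΨ,
      fun _ _ _ _ => Iff.rfl, ha0⟩
  · intro D _ _ _ _ _ ξ0 n b D' _ _ _ _ _ ξ0' n' b' τ h h'
    exact same_type g hg Q V hV1 hV2 j0 hj0 d D b D' b' ξ0 ξ0' τ h h'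

end TypeLemma

end CW

namespace CW

section PowerSer

open PowerSeries

lemma psX_pow_mem {κ : Type} [Field κ] (n : ℕ) (f : κ⟦X⟧) :
    f ∈ (Ideal.span {(PowerSeries.X : κ⟦X⟧)}) ^ n ↔ ∀ m < n, coeff m f = 0 := by
  rw [Ideal.span_singleton_pow, Ideal.mem_span_singleton, X_pow_dvd_iff]

instance psAdic (κ : Type) [Field κ] : IsAdicComplete (Ideal.span {(PowerSeries.X : κ⟦X⟧)}) κ⟦X⟧ where
  haus' := by
    intro x hx
    ext n
    have := hx (n + 1)
    rw [SModEq.zero, smul_eq_mul, Ideal.mul_top, psX_pow_mem] at this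
    simpa using this n (by omega)
  prec' := by
    intro f hf
    refine ⟨PowerSeries.mk fun n => coeff n (f (n + 1)), fun n => ?_⟩
    rw [SModEq.sub_mem, smul_eq_mul, Ideal.mul_top, psX_pow_mem]
    intro m hm
    have := hf (m := m + 1) (n := n) (by omega)
    rw [SModEq.sub_mem, smul_eq_mul, Ideal.mul_top, psX_pow_mem] at this
    have := this m (by omega)
    rw [map_sub, sub_eq_zero] at this
    rw [map_sub, coeff_mk, this, sub_self]

lemma ps_unique {κ : Type} [Field κ] {A D : Type} [CommRing A] [CommRing D] [Algebra A D] [Algebra.Etale A D]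
    (φ φ' : D →+* κ⟦X⟧) (h : φ.comp (algebraMap A D) = φ'.comp (algebraMap A D))
    (h0 : ∀ x, constantCoeff (φ x) = constantCoeff (φ' x)) : φ = φ' := by
  algebraize [φ.comp (algebraMap A D)]
  let f1 : D →ₐ[A] κ⟦X⟧ := { φ with commutes' := fun r => rfl }
  let f2 : D →ₐ[A] κ⟦X⟧ := { φ' with commutes' := fun r => (RingHom.congr_fun h r).symm }
  have : f1 = f2 := by
    refine Algebra.FormallyUnramified.ext_of_iInf (I := Ideal.span {(PowerSeries.X : κ⟦X⟧)}) ?_ fun x => ?_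
    · rw [eq_bot_iff]
      intro x hx
      rw [Ideal.mem_iInf] at hx
      have : x = 0 := by
        ext n
        simpa using (psX_pow_mem (n + 1) x).mp (hx (n + 1)) n (by omega)
      simp [this]
    · rw [Ideal.Quotient.eq, Ideal.mem_span_singleton, X_dvd_iff, map_sub, sub_eq_zero]
      exact h0 x
  ext1 x
  exact DFunLike.congr_fun this x

lemma ps_exists {κ : Type} [Field κ] {A D : Type} [CommRing A] [CommRing D] [Algebra A D] [Algebra.Etale A D]
    (α : A →+* κ⟦X⟧) (ξ : D →+* κ) (h : ξ.comp (algebraMap A D) = constantCoeff.comp α) :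
    ∃ φ : D →+* κ⟦X⟧, φ.comp (algebraMap A D) = α ∧ ∀ x, constantCoeff (φ x) = ξ x := by
  algebraize [α]
  have hs : Function.Surjective (constantCoeff (R := κ)) := fun a => ⟨PowerSeries.C a, by simp⟩
  have hker : RingHom.ker (constantCoeff (R := κ)) = Ideal.span {(PowerSeries.X : κ⟦X⟧)} := by
    ext f
    rw [RingHom.mem_ker, Ideal.mem_span_singleton, X_dvd_iff]
  let e : κ⟦X⟧ ⧸ Ideal.span {(PowerSeries.X : κ⟦X⟧)} ≃+* κ :=
    (Ideal.quotEquivOfEq hker.symm).trans (RingHom.quotientKerEquivOfSurjective hs)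
  have he : ∀ f, e (Ideal.Quotient.mk _ f) = constantCoeff f := fun f => rfl
  let ξ' : D →ₐ[A] κ⟦X⟧ ⧸ Ideal.span {(PowerSeries.X : κ⟦X⟧)} :=
    { (e.symm : κ →+* _).comp ξ with
      commutes' := fun r => by
        change e.symm (ξ (algebraMap A D r)) = Ideal.Quotient.mk _ (α r)
        rw [RingEquiv.symm_apply_eq, he]
        exact RingHom.congr_fun h r }
  obtain ⟨φ, hφ⟩ := Algebra.FormallySmooth.exists_mkₐ_comp_eq_of_isAdicComplete ξ'
  refine ⟨φ, ?_, fun x => ?_⟩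
  · ext1 r
    exact φ.commutes r
  · rw [← he]
    have : Ideal.Quotient.mk _ (φ x) = e.symm (ξ x) := DFunLike.congr_fun hφ x
    change e (Ideal.Quotient.mk _ (φ x)) = _
    rw [this, RingEquiv.apply_symm_apply]

open Cardinal in
lemma exists_embed (κ : Type) [Field κ] [CharZero κ] [Countable κ] : Nonempty (κ →+* ℂ) := by
  let F := AlgebraicClosure (FractionRing (MvPolynomial ℝ κ))
  have : CharZero F := charZero_of_injective_algebraMap (algebraMap (FractionRing (MvPolynomial ℝ κ)) F).injective
  have h1 : #(FractionRing (MvPolynomial ℝ κ)) ≤ #ℝ := by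
    rw [Cardinal.mk_fractionRing]
    refine (MvPolynomial.cardinalMk_le_max).trans ?_
    simp [Cardinal.mk_le_aleph0, Cardinal.aleph0_le_continuum, (Cardinal.mk_le_aleph0 (α := κ)).trans Cardinal.aleph0_le_continuum]
  have h2 : #F ≤ #ℝ := by
    refine (Algebra.IsAlgebraic.cardinalMk_le_max (FractionRing (MvPolynomial ℝ κ)) F).trans ?_
    refine max_le h1 ?_
    simp [Cardinal.aleph0_le_continuum]
  have h3 : #ℝ ≤ #F := by
    refine Cardinal.mk_le_of_injective (f := fun r : ℝ => (algebraMap (FractionRing (MvPolynomial ℝ κ)) F)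
      (algebraMap (MvPolynomial ℝ κ) _ (MvPolynomial.X r))) ?_
    intro a b hab
    have := (IsFractionRing.injective (MvPolynomial ℝ κ) (FractionRing (MvPolynomial ℝ κ))) ((algebraMap (FractionRing (MvPolynomial ℝ κ)) F).injective hab)
    exact MvPolynomial.X_injective this
  have h4 : #F = #ℂ := by rw [le_antisymm h2 h3, Cardinal.mk_real, Cardinal.mk_complex]
  obtain ⟨e⟩ := IsAlgClosed.ringEquiv_of_equiv_of_charZero (K := F) (L := ℂ)
    (by rw [h4, Cardinal.mk_complex]; exact Cardinal.aleph0_lt_continuum) (Cardinal.eq.mp h4)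
  exact ⟨(e : F →+* ℂ).comp ((algebraMap (FractionRing (MvPolynomial ℝ κ)) F).comp
    ((algebraMap (MvPolynomial ℝ κ) _).comp MvPolynomial.C))⟩

/-- Coefficientwise retraction. -/
lemma exists_retr {κ : Type} [Field κ] (e : κ →+* ℂ) :
    ∃ Pr : ℂ⟦X⟧ →+ κ⟦X⟧, (∀ s t, Pr (s * PowerSeries.map e t) = Pr s * t) ∧ Pr 1 = 1 ∧
      ∀ q : Polynomial ℂ, ∃ p : Polynomial κ, Pr (q : ℂ⟦X⟧) = (p : κ⟦X⟧) := by
  algebraize [e]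
  obtain ⟨π, hπ⟩ := LinearMap.exists_leftInverse_of_injective (Algebra.linearMap κ ℂ) (LinearMap.ker_eq_bot.mpr e.injective)
  have h1 : π 1 = 1 := by
    have := LinearMap.congr_fun hπ 1
    simpa using this
  have hm : ∀ a b, π (a * e b) = π a * b := fun a b => by
    have : a * e b = b • a := by rw [Algebra.smul_def, mul_comm]; rfl
    rw [this, map_smul, smul_eq_mul, mul_comm]
  refine ⟨{ toFun := fun s => PowerSeries.mk fun n => π (coeff n s), map_zero' := ?_, map_add' := ?_ }, ?_, ?_, ?_⟩
  · ext; simp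
  · intros; ext; simp
  · intro s t
    ext n
    simp [coeff_mul, map_sum, hm]
  · ext n
    simp only [AddMonoidHom.coe_mk, ZeroHom.coe_mk, coeff_mk, coeff_one]
    split_ifs <;> simp [h1]
  · intro q
    refine ⟨∑ i ∈ q.support, Polynomial.monomial i (π (q.coeff i)), ?_⟩
    ext n
    simp only [AddMonoidHom.coe_mk, ZeroHom.coe_mk, coeff_mk, Polynomial.coeff_coe, Polynomial.finset_sum_coeff, Polynomial.coeff_monomial]
    simp
    intro h; simp [h]

end PowerSer

end CW

namespace CW

section CData

open Polynomial TensorProduct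

/-- Finite étale covers with fibre degrees between `1` and `d`. -/
structure EtCov (A D : Type) [CommRing A] [CommRing D] [Algebra A D] (d : ℕ) : Prop where
  fin : Module.Finite A D
  et : Algebra.Etale A D
  lo : ∀ p : PrimeSpectrum A, 1 ≤ Module.rankAtStalk (R := A) D p
  hi : ∀ p : PrimeSpectrum A, Module.rankAtStalk (R := A) D p ≤ d

lemma EtCov.baseChange {A D : Type} [CommRing A] [CommRing D] [Algebra A D] {d : ℕ} (h : EtCov A D d)
    (B : Type) [CommRing B] [Algebra A B] : EtCov B (B ⊗[A] D) d := by
  have := h.fin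
  have := h.et
  exact ⟨inferInstance, inferInstance, fun p => by rw [Module.rankAtStalk_baseChange]; exact h.lo _,
    fun p => by rw [Module.rankAtStalk_baseChange]; exact h.hi _⟩

lemma pid_of_away (g : ℂ[X]) (Q : Type) [CommRing Q] [Algebra ℂ[X] Q] [IsLocalization.Away g Q] :
    IsPrincipalIdealRing Q := by
  constructor
  intro I
  obtain ⟨p, hp⟩ := (IsPrincipalIdealRing.principal (I.comap (algebraMap ℂ[X] Q)))
  refine ⟨algebraMap ℂ[X] Q p, ?_⟩
  have hp' : I.under ℂ[X] = Ideal.span {p} := hp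
  rw [← IsLocalization.map_under (Submonoid.powers g) Q I, hp', Ideal.map_span, Set.image_singleton]

lemma isUnit_coe_ps {κ : Type} [Field κ] (g : κ[X]) (hg : g.eval 0 ≠ 0) : IsUnit (g : PowerSeries κ) := by
  rw [PowerSeries.isUnit_iff_constantCoeff]
  simpa [Polynomial.coeff_zero_eq_eval_zero] using hg

/-- Taylor expansion at the origin. -/
def tayl {κ : Type} [Field κ] (g : κ[X]) (hg : g.eval 0 ≠ 0) (Q : Type) [CommRing Q] [Algebra κ[X] Q] [IsLocalization.Away g Q] :
    Q →+* PowerSeries κ :=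
  IsLocalization.Away.lift (R := κ[X]) (S := Q) g (g := Polynomial.coeToPowerSeries.ringHom) (isUnit_coe_ps g hg)

lemma tayl_algebraMap {κ : Type} [Field κ] (g : κ[X]) (hg : g.eval 0 ≠ 0) (Q : Type) [CommRing Q] [Algebra κ[X] Q] [IsLocalization.Away g Q] (p : κ[X]) :
    tayl g hg Q (algebraMap κ[X] Q p) = (p : PowerSeries κ) :=
  IsLocalization.Away.lift_eq g (g := Polynomial.coeToPowerSeries.ringHom) (isUnit_coe_ps g hg) p

/-- Complex covering data. -/
structure CData (g : ℂ[X]) (hg : g.eval 0 ≠ 0) (Q : Type) [CommRing Q] [Algebra ℂ[X] Q] [IsLocalization.Away g Q] (d : ℕ) where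
  DC : Type
  i1 : CommRing DC
  i2 : Algebra ℂ[X] DC
  i3 : Algebra Q DC
  i4 : IsScalarTower ℂ[X] Q DC
  i5 : Algebra.Etale Q DC
  n : ℕ
  hn : n ≤ d
  b : Module.Basis (Fin n) Q DC
  Φ : DC →+* PowerSeries ℂ
  hΦ : Φ.comp (algebraMap Q DC) = tayl g hg Q

lemma type_lemma' (g : ℂ[X]) (hg : g.eval 0 ≠ 0) (Q : Type) [CommRing Q] [Algebra ℂ[X] Q] [IsLocalization.Away g Q]
    (d : ℕ) : ∃ (T : Type) (_ : Finite T) (HT : CData g hg Q d → T → Prop), (∀ c, ∃ τ, HT c τ) ∧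
      ∀ c c' τ, HT c τ → HT c' τ → ∀ y', ∃ y, c'.Φ y' = c.Φ y := by
  obtain ⟨T, hT, HT, h1, h2⟩ := type_lemma g hg Q d
  refine ⟨T, hT, fun c τ => letI := c.i1; letI := c.i2; HT c.DC ((PowerSeries.constantCoeff).comp c.Φ) τ, ?_, ?_⟩
  · rintro ⟨DC, i1, i2, i3, i4, i5, n, hn, b, Φ, hΦ⟩
    refine h1 DC _ n b hn ?_
    intro q
    have := RingHom.congr_fun hΦ (algebraMap ℂ[X] Q q)
    rw [RingHom.comp_apply, ← IsScalarTower.algebraMap_apply, tayl_algebraMap] at this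
    rw [RingHom.comp_apply, this]
    simp [Polynomial.coeff_zero_eq_eval_zero]
  · rintro ⟨DC, i1, i2, i3, i4, i5, n, hn, b, Φ, hΦ⟩ ⟨DC', i1', i2', i3', i4', i5', n', hn', b', Φ', hΦ'⟩ τ h h' y'
    obtain ⟨γ, hγ⟩ := h2 DC _ n b DC' _ n' b' τ h h'
    refine ⟨γ y', ?_⟩
    have : Φ' = Φ.comp (γ : DC' →+* DC) := by
      refine ps_unique (A := Q) _ _ ?_ fun x => ?_
      · rw [hΦ', RingHom.comp_assoc]
        ext1 q
        simp [← hΦ]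
      · exact (hγ x).symm
    exact RingHom.congr_fun this y'

lemma exists_cdata (g : ℂ[X]) (hg : g.eval 0 ≠ 0) (Q : Type) [CommRing Q] [Algebra ℂ[X] Q] [IsLocalization.Away g Q]
    (d : ℕ) {A D : Type} [CommRing A] [CommRing D] [Algebra A D] (hD : EtCov A D d) (η : A →+* Q)
    (φ : D →+* PowerSeries ℂ) (hφ : φ.comp (algebraMap A D) = (tayl g hg Q).comp η) :
    ∃ (c : CData g hg Q d), (∀ x, ∃ y, c.Φ y = φ x) ∧
      ∀ y, c.Φ y ∈ AddSubgroup.closure {s | ∃ q x, s = tayl g hg Q q * φ x} := by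
  algebraize [η, (tayl g hg Q).comp η, tayl g hg Q]
  have hg0 : g ≠ 0 := by rintro rfl; simp at hg
  have hB := hD.baseChange Q
  have := hB.fin
  have := hB.et
  have := pid_of_away g Q
  have : IsDomain Q := IsLocalization.isDomain_of_le_nonZeroDivisors Q (M := Submonoid.powers g)
    (by rw [Submonoid.powers_le]; exact mem_nonZeroDivisors_of_ne_zero hg0)
  have : Module.Flat Q (Q ⊗[A] D) := inferInstance
  have : Module.Free Q (Q ⊗[A] D) := inferInstance
  let i2 : Algebra ℂ[X] (Q ⊗[A] D) := ((algebraMap Q (Q ⊗[A] D)).comp (algebraMap ℂ[X] Q)).toAlgebra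
  let φ' : D →ₐ[A] PowerSeries ℂ := { φ with commutes' := fun r => RingHom.congr_fun hφ r }
  let i6 : IsScalarTower A Q (PowerSeries ℂ) := IsScalarTower.of_algebraMap_eq fun r => rfl
  let Φ : Q ⊗[A] D →ₐ[Q] PowerSeries ℂ := Algebra.TensorProduct.lift (Algebra.ofId Q _) φ' (fun _ _ => Commute.all _ _)
  have hmem : ∀ y : Q ⊗[A] D, Φ y ∈ AddSubgroup.closure {s | ∃ q x, s = tayl g hg Q q * φ x} := by
    intro y
    induction y with
    | zero => simp
    | add a b ha hb => rw [map_add]; exact add_mem ha hb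
    | tmul q x =>
      apply AddSubgroup.subset_closure
      refine ⟨q, x, ?_⟩
      simp [Φ, φ']
      left; rfl
  refine ⟨⟨Q ⊗[A] D, inferInstance, i2, inferInstance, IsScalarTower.of_algebraMap_eq' rfl, inferInstance,
    Module.finrank Q (Q ⊗[A] D), ?_, Module.finBasis _ _, Φ, ?_⟩, fun x => ⟨1 ⊗ₜ x, ?_⟩, fun y => ?_⟩
  · have := hB.hi ⟨⊥, Ideal.isPrime_bot⟩
    rwa [Module.rankAtStalk_eq_finrank_of_free] at this
  · ext1 q
    exact Φ.commutes q
  · simp [Φ, φ']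
  · exact hmem y

end CData

end CW

namespace CW

section Trans

open Polynomial TensorProduct

/-- Hermite-type conclusion. -/
def HermConc (A F : Type) [CommRing A] [Field F] (ι : A →+* F) (d : ℕ) : Prop :=
  ∃ (L : Type) (_ : Field L) (j : F →+* L), j.Finite ∧
    ∀ (D : Type) [CommRing D] [Algebra A D], EtCov A D d →
      ∃ φ : D →+* L, φ.comp (algebraMap A D) = j.comp ι

lemma countable_of_finite {K L : Type} [Field K] [Field L] [Countable K] (j : K →+* L) (hj : j.Finite) : Countable L := by
  algebraize [j]
  exact (Module.finBasis K L).equivFun.toEquiv.injective.countable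

/-- finite generation of the image -/
lemma fg_image {A D S : Type} [CommRing A] [CommRing D] [CommRing S] [Algebra A D] [Module.Finite A D] (α : A →+* S)
    (φ : D →+* S) (h : φ.comp (algebraMap A D) = α) :
    ∃ B : Set S, B.Finite ∧ (∀ s ∈ B, α.IsIntegralElem s) ∧
      ∀ x, φ x ∈ Subring.closure (B ∪ Set.range α) := by
  obtain ⟨B, hB⟩ := Module.Finite.fg_top (R := A) (M := D)
  refine ⟨φ '' B, B.finite_toSet.image _, ?_, ?_⟩
  · rintro _ ⟨x, -, rfl⟩
    have h1 : IsIntegral A x := Algebra.IsIntegral.isIntegral x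
    have h2 : (algebraMap A D).IsIntegralElem x := h1
    rw [← h]
    exact RingHom.IsIntegralElem.map h2 φ
  · intro x
    have hx : x ∈ Submodule.span A (B : Set D) := by rw [hB]; trivial
    induction hx using Submodule.span_induction with
    | mem x hx => exact Subring.subset_closure (Or.inl ⟨x, hx, rfl⟩)
    | zero => simp
    | add x y _ _ hx hy => rw [map_add]; exact add_mem hx hy
    | smul a x _ hx =>
      rw [Algebra.smul_def, map_mul]
      refine mul_mem (Subring.subset_closure (Or.inr ⟨a, ?_⟩)) hx
      rw [← h]; rfl

theorem trans_core {K : Type} [Field K] [CharZero K] [Countable K] (g : K[X]) (hg : g.eval 0 ≠ 0)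
    (P : Type) [CommRing P] [Algebra K[X] P] [IsLocalization.Away g P]
    (F : Type) [Field F] [Algebra K[X] F] [IsFractionRing K[X] F] (ρ : P →+* F)
    (hρ : ρ.comp (algebraMap K[X] P) = algebraMap K[X] F)
    {A : Type} [CommRing A] (ι : A →+* P) (d : ℕ)
    (H : HermConc A K ((PowerSeries.constantCoeff.comp (tayl g hg P)).comp ι) d) :
    HermConc A F (ρ.comp ι) d := by
  obtain ⟨K1, _, j, hj, hD⟩ := H
  have : CharZero K1 := charZero_of_injective_ringHom j.injective
  have := countable_of_finite j hj
  obtain ⟨e⟩ := exists_embed K1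
  obtain ⟨Pr, hPr, hPr1, hPrp⟩ := exists_retr e
  set g1 := g.map j with hg1d
  set gC := g1.map e with hgCd
  have hg1 : g1.eval 0 ≠ 0 := by
    rw [hg1d, Polynomial.eval_zero_map]; simpa using hg
  have hgC : gC.eval 0 ≠ 0 := by
    rw [hgCd, Polynomial.eval_zero_map]; simpa using hg1
  let Q := Localization.Away gC
  let α1 : P →+* PowerSeries K1 := (PowerSeries.map j).comp (tayl g hg P)
  have hα1 : ∀ p : K[X], α1 (algebraMap K[X] P p) = ((p.map j : K1[X]) : PowerSeries K1) := by
    intro p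
    simp only [α1, RingHom.comp_apply, tayl_algebraMap]
    simp
  let θ : P →+* Q := IsLocalization.Away.lift (R := K[X]) (S := P) g
    (g := (algebraMap ℂ[X] Q).comp (Polynomial.mapRingHom (e.comp j)))
    (by
      rw [RingHom.comp_apply, Polynomial.coe_mapRingHom, ← Polynomial.map_map]
      exact IsLocalization.Away.algebraMap_isUnit gC)
  have hθ : (tayl gC hgC Q).comp θ = (PowerSeries.map e).comp α1 := by
    refine IsLocalization.ringHom_ext (Submonoid.powers g) ?_
    refine RingHom.ext fun p => ?_
    · simp only [RingHom.comp_apply, θ, IsLocalization.Away.lift_eq, hα1, tayl_algebraMap]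
      ext n
      simp
  -- the big field
  let Ω := FractionRing (PowerSeries K1)
  let β : PowerSeries K1 →+* Ω := algebraMap _ _
  have hβ : Function.Injective β := IsFractionRing.injective _ _
  let κ0 : K[X] →+* Ω := β.comp ((Polynomial.coeToPowerSeries.ringHom (R := K1)).comp (Polynomial.mapRingHom j))
  have hκ0 : Function.Injective κ0 := by
    refine hβ.comp (Function.Injective.comp ?_ (Polynomial.map_injective j j.injective))
    exact Polynomial.coe_injective K1
  let κF : F →+* Ω := IsFractionRing.lift (A := K[X]) hκ0
  have hκF : ∀ p : K[X], κF (algebraMap K[X] F p) = β ((p.map j : K1[X]) : PowerSeries K1) := by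
    intro p
    exact IsFractionRing.lift_algebraMap hκ0 p
  have hκρ : κF.comp ρ = β.comp α1 := by
    refine IsLocalization.ringHom_ext (Submonoid.powers g) ?_
    rw [RingHom.comp_assoc, hρ]
    refine RingHom.ext fun p => ?_
    · simp only [RingHom.comp_apply, hα1, hκF]
  obtain ⟨T, hT, HT, hT1, hT2⟩ := type_lemma' gC hgC Q d
  let α := α1.comp ι
  let R : T → CData gC hgC Q d → Set (PowerSeries K1) → Set (PowerSeries K1) → Prop := fun τ c W S =>
    HT c τ ∧ (∀ y, c.Φ y ∈ AddSubgroup.closure {s | ∃ q, ∃ w ∈ W, s = tayl gC hgC Q q * PowerSeries.map e w}) ∧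
      S.Finite ∧ (∀ s ∈ S, α.IsIntegralElem s) ∧ W ⊆ Subring.closure (S ∪ Set.range α)
  have hS : ∀ τ, ∃ S : Set (PowerSeries K1), S.Finite ∧ (∀ s ∈ S, α.IsIntegralElem s) ∧
      ((∃ c W S, R τ c W S) → ∃ c W, R τ c W S) := by
    intro τ
    by_cases h : ∃ c W S, R τ c W S
    · obtain ⟨c, W, S, h⟩ := h
      exact ⟨S, h.2.2.1, h.2.2.2.1, fun _ => ⟨c, W, h⟩⟩
    · exact ⟨∅, Set.finite_empty, by simp, fun h' => absurd h' h⟩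
  choose S hSf hSi hSR using hS
  algebraize [κF, j]
  obtain ⟨B, hB⟩ := Module.Finite.fg_top (R := K) (M := K1)
  let cst : K1 →+* Ω := β.comp PowerSeries.C
  have hcst : ∀ a : K, cst (j a) = κF (algebraMap K[X] F (Polynomial.C a)) := by
    intro a
    rw [hκF]; simp [cst]
  let G : Set Ω := cst '' (B : Set K1) ∪ ⋃ τ, β '' (S τ)
  have hGf : G.Finite := (B.finite_toSet.image _).union (Set.finite_iUnion fun τ => (hSf τ).image _)
  have hGi : ∀ x ∈ G, IsIntegral F x := by
    rintro x (⟨b, -, rfl⟩ | hx)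
    · have h1 : (algebraMap K K1).IsIntegralElem b := Algebra.IsIntegral.isIntegral b
      have h2 := RingHom.IsIntegralElem.map h1 cst
      have h3 : cst.comp (algebraMap K K1) = κF.comp ((algebraMap K[X] F).comp Polynomial.C) := by
        ext a; exact hcst a
      rw [h3] at h2
      exact RingHom.IsIntegralElem.of_comp h2
    · obtain ⟨τ, s, hs, rfl⟩ := Set.mem_iUnion.mp hx
      have h2 := RingHom.IsIntegralElem.map (hSi τ s hs) β
      have h3 : β.comp α = κF.comp (ρ.comp ι) := by
        exact congrArg (fun z => z.comp ι) hκρ.symm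
      rw [h3] at h2
      exact RingHom.IsIntegralElem.of_comp h2
  let L := IntermediateField.adjoin F G
  have : Finite G := hGf
  have hLfin : FiniteDimensional F L := IntermediateField.finiteDimensional_adjoin hGi
  have hLF : ∀ a : F, κF a ∈ L := fun a => L.algebraMap_mem a
  have hLα : ∀ a, β (α a) ∈ L := by
    intro a
    have := RingHom.congr_fun hκρ (ι a)
    simp only [RingHom.comp_apply] at this
    simp only [α, RingHom.comp_apply]
    rw [← this]; exact hLF _
  have hLS : ∀ τ, ∀ s ∈ S τ, β s ∈ L := fun τ s hs =>
    IntermediateField.subset_adjoin _ _ (Or.inr (Set.mem_iUnion.mpr ⟨τ, s, hs, rfl⟩))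
  have hLK1 : ∀ a : K1, cst a ∈ L := by
    intro a
    have ha : a ∈ Submodule.span K (B : Set K1) := by rw [hB]; trivial
    induction ha using Submodule.span_induction with
    | mem x hx => exact IntermediateField.subset_adjoin _ _ (Or.inl ⟨x, hx, rfl⟩)
    | zero => rw [map_zero]; exact zero_mem _
    | add x y _ _ hx hy => rw [map_add]; exact add_mem hx hy
    | smul a x _ hx =>
      rw [Algebra.smul_def, map_mul]
      refine mul_mem ?_ hx
      have := hcst a
      change cst (j a) ∈ L
      rw [this]; exact hLF _
  have hLX : ∀ p : K1[X], β (p : PowerSeries K1) ∈ L := by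
    intro p
    induction p using Polynomial.induction_on' with
    | add p q hp hq => rw [Polynomial.coe_add, map_add]; exact add_mem hp hq
    | monomial n a =>
      have : β ((Polynomial.monomial n a : K1[X]) : PowerSeries K1) = cst a * κF (algebraMap K[X] F Polynomial.X) ^ n := by
        rw [hκF, ← Polynomial.C_mul_X_pow_eq_monomial]
        simp [cst]
      rw [this]
      exact mul_mem (hLK1 a) (pow_mem (hLF _) n)
  have hdiv : ∀ (s : PowerSeries K1) (N : ℕ), β (s * (g1 : PowerSeries K1) ^ N) ∈ L → β s ∈ L := by
    intro s N h
    have hne : β ((g1 : PowerSeries K1) ^ N) ≠ 0 := by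
      rw [map_ne_zero_iff _ hβ]
      exact pow_ne_zero _ (isUnit_coe_ps g1 hg1).ne_zero
    have : β s = β (s * (g1 : PowerSeries K1) ^ N) / β ((g1 : PowerSeries K1) ^ N) := by
      rw [map_mul, mul_div_cancel_right₀ _ hne]
    rw [this]
    refine div_mem h ?_
    rw [map_pow]
    exact pow_mem (hLX _) _
  have hPrq : ∀ q : Q, β (Pr (tayl gC hgC Q q)) ∈ L := by
    intro q
    obtain ⟨N, p, hp⟩ := IsLocalization.Away.surj gC q
    refine hdiv _ N ?_
    have h1 := congrArg (tayl gC hgC Q) hp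
    rw [map_mul, map_pow, tayl_algebraMap, tayl_algebraMap] at h1
    have h2 : ((gC : PowerSeries ℂ)) ^ N = PowerSeries.map e ((g1 : PowerSeries K1) ^ N) := by
      rw [map_pow, hgCd]; simp
    rw [h2] at h1
    rw [← hPr, h1]
    obtain ⟨p', hp'⟩ := hPrp p
    rw [hp']; exact hLX _
  refine ⟨L, inferInstance, algebraMap F L, ?_, ?_⟩
  · rw [RingHom.finite_algebraMap]; exact hLfin
  intro D _ _ hcov
  have := hcov.fin
  have := hcov.et
  obtain ⟨ξ, hξ⟩ := hD D hcov
  obtain ⟨φ, hφ, hφ0⟩ := ps_exists (A := A) α ξ (by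
    rw [hξ]
    ext a
    simp only [α, α1, RingHom.comp_apply]
    rw [← PowerSeries.coeff_zero_eq_constantCoeff_apply, ← PowerSeries.coeff_zero_eq_constantCoeff_apply,
      PowerSeries.coeff_map])
  obtain ⟨c, hc1, hc2⟩ := exists_cdata gC hgC Q d hcov (θ.comp ι) ((PowerSeries.map e).comp φ) (by
    rw [RingHom.comp_assoc, hφ]; exact congrArg (fun z => z.comp ι) hθ.symm)
  obtain ⟨τ, hτ⟩ := hT1 c
  obtain ⟨S0, hS0, hS0i, hS0m⟩ := fg_image α φ hφ
  obtain ⟨c', W', h1, h2, h3, h4, h5⟩ := hSR τ ⟨c, Set.range φ, S0, hτ, by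
    intro y
    refine AddSubgroup.closure_mono ?_ (hc2 y)
    rintro _ ⟨q, x, rfl⟩
    exact ⟨q, φ x, ⟨x, rfl⟩, rfl⟩, hS0, hS0i, by rintro _ ⟨x, rfl⟩; exact hS0m x⟩
  have hW : ∀ w ∈ W', β w ∈ L := by
    intro w hw
    have hle : Subring.closure (S τ ∪ Set.range α) ≤ L.toSubfield.toSubring.comap β := by
      rw [Subring.closure_le]
      rintro s (hs | ⟨a, rfl⟩)
      · exact hLS τ s hs
      · exact hLα a
    exact hle (h5 hw)
  have hcl : ∀ s ∈ AddSubgroup.closure {s | ∃ q, ∃ w ∈ W', s = tayl gC hgC Q q * PowerSeries.map e w}, β (Pr s) ∈ L := by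
    intro s hs
    induction hs using AddSubgroup.closure_induction with
    | mem s hs =>
      obtain ⟨q, w, hw, rfl⟩ := hs
      rw [hPr, map_mul]
      exact mul_mem (hPrq q) (hW w hw)
    | zero => rw [map_zero, map_zero]; exact zero_mem _
    | add x y _ _ hx hy => rw [map_add, map_add]; exact add_mem hx hy
    | neg x _ hx => rw [map_neg, map_neg]; exact neg_mem hx
  have hφL : ∀ x, β (φ x) ∈ L := by
    intro x
    obtain ⟨y, hy⟩ := hc1 x
    obtain ⟨y', hy'⟩ := hT2 c' c τ h1 hτ y
    have h6 := hcl _ (h2 y')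
    rw [← hy', hy, RingHom.comp_apply, ← one_mul (PowerSeries.map e (φ x)), hPr, hPr1, one_mul] at h6
    exact h6
  refine ⟨(β.comp φ).codRestrict L hφL, ?_⟩
  ext a
  have h7 := RingHom.congr_fun hκρ (ι a)
  have h8 := RingHom.congr_fun hφ a
  simp only [RingHom.comp_apply] at h7 h8
  change β (φ (algebraMap A D a)) = κF (ρ (ι a))
  rw [h7, h8]
  rfl

end Trans

end CW

namespace CW

section Trans2

open Polynomial TensorProduct

/-- Hermite property of a field. -/
def HermiteA (K : Type) [Field K] : Prop :=
  ∀ (A : Type) [CommRing A], Algebra.FiniteType ℤ A → ∀ (ι : A →+* K) (d : ℕ), HermConc A K ι d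

lemma trans0 {K : Type} [Field K] [CharZero K] [Countable K] (HK : HermiteA K) (g : K[X]) (hg : g.eval 0 ≠ 0)
    (F : Type) [Field F] [Algebra K[X] F] [IsFractionRing K[X] F]
    {A : Type} [CommRing A] (hA : Algebra.FiniteType ℤ A) (ι : A →+* F) (d : ℕ)
    (H : ∀ a, ∃ N p, ι a * algebraMap K[X] F g ^ N = algebraMap K[X] F p) :
    HermConc A F ι d := by
  let P := Localization.Away g
  have hg0 : g ≠ 0 := by rintro rfl; simp at hg
  have hu : IsUnit (algebraMap K[X] F g) := by
    rw [isUnit_iff_ne_zero]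
    simpa using hg0
  let ρ : P →+* F := IsLocalization.Away.lift (R := K[X]) (S := P) g (g := algebraMap K[X] F) hu
  have hρ : ∀ p, ρ (algebraMap K[X] P p) = algebraMap K[X] F p := fun p => IsLocalization.Away.lift_eq g hu p
  have hinj : Function.Injective ρ := by
    have : IsDomain P := IsLocalization.isDomain_of_le_nonZeroDivisors P (M := Submonoid.powers g)
      (by rw [Submonoid.powers_le]; exact mem_nonZeroDivisors_of_ne_zero hg0)
    rw [injective_iff_map_eq_zero]
    intro q hq
    obtain ⟨N, p, hp⟩ := IsLocalization.Away.surj g q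
    have h1 := congrArg ρ hp
    rw [map_mul, hq, zero_mul, hρ] at h1
    have h2 : p = 0 := by simpa using h1.symm
    rw [h2, map_zero] at hp
    refine (mul_eq_zero.mp hp).resolve_right ?_
    exact pow_ne_zero _ (IsLocalization.Away.algebraMap_isUnit (S := P) g).ne_zero
  have hr : ∀ a, ι a ∈ ρ.range := by
    intro a
    obtain ⟨N, p, hp⟩ := H a
    refine ⟨IsLocalization.mk' P p (⟨g ^ N, ⟨N, rfl⟩⟩ : Submonoid.powers g), ?_⟩
    have h1 := congrArg ρ (IsLocalization.mk'_spec P p (⟨g ^ N, ⟨N, rfl⟩⟩ : Submonoid.powers g))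
    rw [map_mul, hρ, hρ, ← hp, map_pow] at h1
    exact mul_right_cancel₀ (pow_ne_zero N hu.ne_zero) h1
  let e := RingEquiv.ofBijective ρ.rangeRestrict ⟨fun x y h => hinj (congrArg Subtype.val h), ρ.rangeRestrict_surjective⟩
  let ι' : A →+* P := (e.symm : ρ.range →+* P).comp (ι.codRestrict ρ.range hr)
  have hι' : ρ.comp ι' = ι := by
    ext a
    have := e.apply_symm_apply (ι.codRestrict ρ.range hr a)
    exact congrArg Subtype.val this
  rw [← hι']
  refine trans_core g hg P F ρ (RingHom.ext hρ) ι' d (HK A hA _ d)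

lemma shift_frac {K : Type} [Field K] (F : Type) [Field F] [i0 : Algebra K[X] F] [IsFractionRing K[X] F] (c : K) :
    ∃ (i1 : Algebra K[X] F) (_ : @IsFractionRing K[X] _ F _ i1),
      ∀ p, @algebraMap K[X] F _ _ i1 (p.comp (X + Polynomial.C c)) = @algebraMap K[X] F _ _ i0 p := by
  let σ : K[X] ≃+* K[X] := (Polynomial.algEquivAevalXAddC c).toRingEquiv
  have hσ : ∀ p, σ p = p.comp (X + Polynomial.C c) := fun p => by
    simp [σ, Polynomial.algEquivAevalXAddC, Polynomial.aeval_def, Polynomial.comp]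
  refine ⟨((algebraMap K[X] F).comp σ.symm.toRingHom).toAlgebra, ?_, ?_⟩
  · have := IsLocalization.isLocalization_of_base_ringEquiv (nonZeroDivisors K[X]) F σ
    have h2 : (nonZeroDivisors K[X]).map σ = nonZeroDivisors K[X] :=
      MulEquivClass.map_nonZeroDivisors σ
    rw [h2] at this
    exact this
  · intro p
    rw [← hσ]
    change @algebraMap K[X] F _ _ i0 (σ.symm (σ p)) = _
    rw [RingEquiv.symm_apply_apply]

theorem hermite_trans {K : Type} [Field K] [CharZero K] [Countable K] (HK : HermiteA K)
    (F : Type) [Field F] [Algebra K[X] F] [IsFractionRing K[X] F] : HermiteA F := by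
  intro A _ hA ι d
  classical
  obtain ⟨s, hs⟩ := hA.out
  obtain ⟨⟨g, hg⟩, hb⟩ := IsLocalization.exist_integer_multiples_of_finset (nonZeroDivisors K[X]) (s.image ι)
  have hg0 : g ≠ 0 := nonZeroDivisors.ne_zero hg
  obtain ⟨c, hc⟩ : ∃ c : K, g.eval c ≠ 0 := by
    by_contra! h
    exact hg0 (Polynomial.funext fun r => by simpa using h r)
  have H : ∀ a, ∃ N p, ι a * algebraMap K[X] F g ^ N = algebraMap K[X] F p := by
    intro a
    have ha : a ∈ Algebra.adjoin ℤ (s : Set A) := by rw [hs]; trivial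
    induction ha using Algebra.adjoin_induction with
    | mem x hx =>
      obtain ⟨p, hp⟩ := hb (ι x) (Finset.mem_image_of_mem _ hx)
      refine ⟨1, p, ?_⟩
      rw [hp, pow_one, mul_comm, Algebra.smul_def]
    | algebraMap r => exact ⟨0, r, by simp⟩
    | add x y _ _ hx hy =>
      obtain ⟨N, p, hp⟩ := hx
      obtain ⟨M, q, hq⟩ := hy
      refine ⟨N + M, p * g ^ M + q * g ^ N, ?_⟩
      rw [map_add, map_add, map_mul, map_mul, ← hp, ← hq, map_pow, map_pow]; ring
    | mul x y _ _ hx hy =>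
      obtain ⟨N, p, hp⟩ := hx
      obtain ⟨M, q, hq⟩ := hy
      refine ⟨N + M, p * q, ?_⟩
      rw [map_mul, map_mul, ← hp, ← hq]; ring
  obtain ⟨i1, hfr, hi1⟩ := shift_frac F c
  refine @trans0 K _ _ _ HK (g.comp (X + Polynomial.C c)) ?_ F _ i1 hfr A _ hA ι d ?_
  · simpa [Polynomial.eval_comp] using hc
  · intro a
    obtain ⟨N, p, hp⟩ := H a
    refine ⟨N, p.comp (X + Polynomial.C c), ?_⟩
    rw [hi1, hi1]
    exact hp

/-- Invariance under isomorphism. -/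
lemma HermiteA.of_equiv {K K' : Type} [Field K] [Field K'] (h : HermiteA K) (e : K ≃+* K') : HermiteA K' := by
  intro A _ hA ι d
  obtain ⟨L, _, j, hj, H⟩ := h A hA ((e.symm : K' →+* K).comp ι) d
  refine ⟨L, inferInstance, j.comp (e.symm : K' →+* K), hj.comp (RingHom.Finite.of_surjective _ e.symm.surjective), ?_⟩
  intro D _ _ hD
  exact H D hD

end Trans2

end CW

namespace CW

section Alg

open Polynomial TensorProduct

lemma factor_inj {A P F : Type} [CommRing A] [CommRing P] [CommRing F] (ρ : P →+* F) (hinj : Function.Injective ρ)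
    (ι : A →+* F) (hr : ∀ a, ι a ∈ ρ.range) : ∃ ι' : A →+* P, ρ.comp ι' = ι := by
  let e := RingEquiv.ofBijective ρ.rangeRestrict ⟨fun x y h => hinj (congrArg Subtype.val h), ρ.rangeRestrict_surjective⟩
  refine ⟨(e.symm : ρ.range →+* P).comp (ι.codRestrict ρ.range hr), ?_⟩
  ext a
  have := e.apply_symm_apply (ι.codRestrict ρ.range hr a)
  exact congrArg Subtype.val this

lemma etale_adjoinRoot {R : Type} [CommRing R] (f : R[X]) (hf : f.Monic) (p q : R[X])
    (h : derivative f * p + f * q = 1) : Algebra.Etale R (AdjoinRoot f) := by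
  let P : StandardEtalePair R := ⟨f, hf, 1, p, q, 0, by simpa using h⟩
  have h1 : IsUnit (AdjoinRoot.mk f 1) := by rw [map_one]; exact isUnit_one
  let e := P.equivAwayAdjoinRoot
  let e2 : AdjoinRoot f ≃ₐ[AdjoinRoot f] Localization.Away (AdjoinRoot.mk f 1) :=
    IsLocalization.atUnit _ _ _ h1
  exact Algebra.Etale.of_equiv (e.trans (e2.restrictScalars R).symm)

/-- compositum of a finite family -/
lemma herm_of_family {A F : Type} [CommRing A] [Field F] (ι : A →+* F) (d : ℕ) {I : Type} [Finite I]
    (L : I → Type) [∀ i, Field (L i)] (j : ∀ i, F →+* L i) (hj : ∀ i, (j i).Finite)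
    (H : ∀ (D : Type) [CommRing D] [Algebra A D], EtCov A D d →
      ∃ (i : I) (φ : D →+* L i), φ.comp (algebraMap A D) = (j i).comp ι) : HermConc A F ι d := by
  let Ω := AlgebraicClosure F
  let _ : ∀ i, Algebra F (L i) := fun i => (j i).toAlgebra
  have hfd : ∀ i, FiniteDimensional F (L i) := fun i => hj i
  let ψ : ∀ i, L i →ₐ[F] Ω := fun i => IsAlgClosed.lift
  let M : I → IntermediateField F Ω := fun i => (ψ i).fieldRange
  have : ∀ i, FiniteDimensional F (M i) := fun i => (AlgEquiv.ofInjectiveField (ψ i)).toLinearEquiv.finiteDimensional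
  let N : IntermediateField F Ω := ⨆ i, M i
  have hN : FiniteDimensional F N := IntermediateField.finiteDimensional_iSup_of_finite
  refine ⟨N, inferInstance, algebraMap F N, ?_, ?_⟩
  · rw [RingHom.finite_algebraMap]; exact hN
  · intro D _ _ hD
    obtain ⟨i, φ, hφ⟩ := H D hD
    have hm : ∀ x, (ψ i).toRingHom x ∈ N := fun x => (le_iSup M i) ⟨x, rfl⟩
    refine ⟨((ψ i).toRingHom.codRestrict N hm).comp φ, ?_⟩
    ext a
    have h1 := RingHom.congr_fun hφ a
    change ψ i (φ (algebraMap A D a)) = algebraMap F Ω (ι a)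
    simp only [RingHom.comp_apply] at h1
    rw [h1]
    exact (ψ i).commutes _

lemma EtCov.tower {A0 A1 D K K' : Type} [CommRing A0] [IsDomain A0] [CommRing A1] [CommRing D] [Field K] [Field K']
    [Algebra A0 A1] [Algebra A1 D] [Algebra A0 D] [IsScalarTower A0 A1 D] [Algebra A0 K] [Algebra A1 K'] [Algebra K K']
    [Algebra A0 K'] [IsScalarTower A0 K K'] [IsScalarTower A0 A1 K'] (hinj : Function.Injective (algebraMap A0 K))
    (hp : Algebra.IsPushout A0 K A1 K') [Module.Finite K K'] [Module.Finite A0 A1] [Algebra.Etale A0 A1]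
    (hinj1 : Function.Injective (algebraMap A0 A1))
    {d : ℕ} (h : EtCov A1 D d) : EtCov A0 D (Module.finrank K K' * d) := by
  have := h.fin
  have := h.et
  have i1 : Module.Finite A0 D := Module.Finite.trans A1 D
  have i2 : Algebra.Etale A0 D := Algebra.Etale.comp A0 A1 D
  refine ⟨i1, i2, ?_, ?_⟩
  · have h1 : Function.Surjective (PrimeSpectrum.comap (algebraMap A1 D)) :=
      PrimeSpectrum.rankAtStalk_pos_iff_comap_surjective.mp h.lo
    have h2 : Function.Surjective (PrimeSpectrum.comap (algebraMap A0 A1)) :=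
      PrimeSpectrum.comap_surjective_iff_injective_of_finite.mpr hinj1
    refine PrimeSpectrum.rankAtStalk_pos_iff_comap_surjective.mpr ?_
    rw [IsScalarTower.algebraMap_eq A0 A1 D, PrimeSpectrum.comap_comp]
    exact h2.comp h1
  · intro p
    let pK : PrimeSpectrum K := ⟨⊥, Ideal.isPrime_bot⟩
    let pK' : PrimeSpectrum K' := ⟨⊥, Ideal.isPrime_bot⟩
    have hle : PrimeSpectrum.comap (algebraMap A0 K) pK ≤ p := by
      intro x hx
      have : algebraMap A0 K x = 0 := hx
      rw [map_eq_zero_iff _ hinj] at this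
      rw [this]; exact zero_mem _
    rw [← Module.rankAtStalk_eq_of_le_of_finite_of_flat D hle, ← Module.rankAtStalk_baseChange,
      Module.rankAtStalk_eq_finrank_of_free]
    have e : K' ⊗[A1] D ≃ₗ[K] K ⊗[A0] D := Algebra.IsPushout.cancelBaseChange A0 K A1 K' D
    have h3 := h.hi (PrimeSpectrum.comap (algebraMap A1 K') pK')
    rw [← Module.rankAtStalk_baseChange, Module.rankAtStalk_eq_finrank_of_free] at h3
    simp only [Pi.natCast_apply, Nat.cast_id] at h3 ⊢
    rw [← e.finrank_eq, ← Module.finrank_mul_finrank K K']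
    exact Nat.mul_le_mul_left _ h3

lemma isPushout_of_basis {A0 A1 K K' ι : Type} [CommRing A0] [CommRing A1] [Field K] [Field K']
    [Algebra A0 A1] [Algebra A0 K] [Algebra A1 K'] [Algebra K K']
    [Algebra A0 K'] [IsScalarTower A0 K K'] [IsScalarTower A0 A1 K'] (b : Module.Basis ι A0 A1) (b' : Module.Basis ι K K')
    (h : ∀ i, algebraMap A1 K' (b i) = b' i) : Algebra.IsPushout A0 K A1 K' := by
  constructor
  refine IsBaseChange.of_equiv ((b.baseChange K).equiv b' (Equiv.refl ι)) ?_
  intro x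
  have : ((((b.baseChange K).equiv b' (Equiv.refl ι)).toLinearMap.restrictScalars A0).comp
      (TensorProduct.mk A0 K A1 1)) = (IsScalarTower.toAlgHom A0 A1 K').toLinearMap := by
    refine b.ext fun i => ?_
    have h1 := (b.baseChange K).equiv_apply i b' (Equiv.refl ι)
    rw [Module.Basis.baseChange_apply] at h1
    simpa [h] using h1
  exact LinearMap.congr_fun this x

end Alg

end CW

namespace CW

section Alg2

open Polynomial TensorProduct

lemma inj_of_basis {A0 A1 K K' ι : Type} [CommRing A0] [CommRing A1] [Field K] [Field K']
    [Algebra A0 A1] [Algebra A0 K] [Algebra K K']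
    [Algebra A0 K'] [IsScalarTower A0 K K'] (b : Module.Basis ι A0 A1) (b' : Module.Basis ι K K')
    (hinj : Function.Injective (algebraMap A0 K)) (ρ : A1 →ₐ[A0] K')
    (h : ∀ i, ρ (b i) = b' i) : Function.Injective ρ := by
  have key : ∀ y i, b'.repr (ρ y) i = algebraMap A0 K (b.repr y i) := by
    intro y i
    have : ((b'.coord i).restrictScalars A0).comp ρ.toLinearMap = (Algebra.linearMap A0 K).comp (b.coord i) := by
      refine b.ext fun k => ?_
      simp only [LinearMap.comp_apply, AlgHom.toLinearMap_apply, LinearMap.restrictScalars_apply, h,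
        Module.Basis.coord_apply, Module.Basis.repr_self, Algebra.linearMap_apply, Finsupp.single_apply]
      by_cases hk : k = i
      · subst hk; simp
      · simp [Finsupp.single_apply, hk]
    exact LinearMap.congr_fun this y
  intro y z hyz
  refine b.ext_elem fun i => hinj ?_
  rw [← key, ← key, hyz]

lemma exists_lift_poly {K : Type} [Field K] (A0 : Subalgebra ℤ K) (p : K[X]) (hp : ∀ n, p.coeff n ∈ A0) :
    ∃ q : (↥A0)[X], q.map (algebraMap A0 K) = p := by
  have : p ∈ Polynomial.lifts (algebraMap A0 K) := by
    rw [Polynomial.lifts_iff_coeff_lifts]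
    intro n
    exact ⟨⟨p.coeff n, hp n⟩, rfl⟩
  exact (Polynomial.mem_lifts p).mp this

theorem hermite_alg {K K' : Type} [Field K] [CharZero K] [Field K'] [Algebra K K'] [FiniteDimensional K K']
    (HK : HermiteA K) : HermiteA K' := by
  classical
  intro A _ hA ι d
  obtain ⟨s, hs⟩ := hA.out
  let pb : PowerBasis K K' := Field.powerBasisOfFiniteOfSeparable K K'
  set f := minpoly K pb.gen with hfdef
  have hfm : f.Monic := minpoly.monic pb.isIntegral_gen
  have hsep : f.Separable := (minpoly.irreducible pb.isIntegral_gen).separable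
  obtain ⟨u, v, huv⟩ := hsep
  let S : Finset K := f.coeffs ∪ u.coeffs ∪ v.coeffs ∪
    s.biUnion fun a => Finset.univ.image fun i => pb.basis.repr (ι a) i
  let A0 := Algebra.adjoin ℤ (S : Set K)
  have hA0 : Algebra.FiniteType ℤ A0 := (Subalgebra.fg_iff_finiteType _).mp (Subalgebra.fg_adjoin_finset S)
  have hcoef : ∀ p : K[X], p.coeffs ⊆ S → ∀ n, p.coeff n ∈ A0 := by
    intro p hp n
    by_cases h0 : p.coeff n = 0
    · rw [h0]; exact zero_mem _
    · exact Algebra.subset_adjoin (hp (Polynomial.coeff_mem_coeffs h0))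
  obtain ⟨f0', hf0'⟩ := exists_lift_poly A0 f (hcoef f (fun x hx => by simp [S, hx]))
  obtain ⟨u0, hu0⟩ := exists_lift_poly A0 u (hcoef u (fun x hx => by simp [S, hx]))
  obtain ⟨v0, hv0⟩ := exists_lift_poly A0 v (hcoef v (fun x hx => by simp [S, hx]))
  have hinj : Function.Injective (algebraMap A0 K) := Subtype.val_injective
  have hminj := Polynomial.map_injective (algebraMap A0 K) hinj
  let f0 := f0'
  have hf0 : f0.map (algebraMap A0 K) = f := hf0'
  have hf0m : f0.Monic := Polynomial.monic_of_injective hinj (by rw [hf0]; exact hfm)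
  have hrel : derivative f0 * v0 + f0 * u0 = 1 := by
    apply hminj
    rw [Polynomial.map_add, Polynomial.map_mul, Polynomial.map_mul, ← Polynomial.derivative_map, hf0, hu0, hv0,
      Polynomial.map_one, ← huv]
    ring
  have het := etale_adjoinRoot f0 hf0m v0 u0 hrel
  have hfin := hf0m.finite_adjoinRoot
  have hroot : Polynomial.eval₂ (Algebra.ofId A0 K' : A0 →+* K') pb.gen f0 = 0 := by
    have h1 : (Algebra.ofId A0 K' : A0 →+* K') = (algebraMap K K').comp (algebraMap A0 K) := rfl
    rw [h1, ← Polynomial.eval₂_map, hf0]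
    exact minpoly.aeval K pb.gen
  let ρ : AdjoinRoot f0 →ₐ[A0] K' := AdjoinRoot.liftAlgHom f0 (Algebra.ofId A0 K') pb.gen hroot
  have hρr : ρ (AdjoinRoot.root f0) = pb.gen := AdjoinRoot.lift_root hroot
  have hdim : pb.dim = f0.natDegree := by
    rw [← pb.natDegree_minpoly, ← hfdef, ← hf0, hf0m.natDegree_map]
  let b : Module.Basis (Fin pb.dim) A0 (AdjoinRoot f0) :=
    (AdjoinRoot.powerBasis' hf0m).basis.reindex (finCongr hdim.symm)
  have hb : ∀ i, ρ (b i) = pb.basis i := by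
    intro i
    simp only [b, Module.Basis.reindex_apply, PowerBasis.coe_basis, AdjoinRoot.powerBasis'_gen, map_pow, hρr]
    rfl
  have hρinj : Function.Injective ρ := inj_of_basis b pb.basis hinj ρ hb
  have hmem : ∀ a, ι a ∈ ρ.toRingHom.range := by
    have hle : Algebra.adjoin ℤ (s : Set A) ≤ subalgebraOfSubring (ρ.toRingHom.range.comap ι) := by
      rw [Algebra.adjoin_le_iff]
      intro a ha
      change ι a ∈ ρ.toRingHom.range
      rw [← pb.basis.sum_repr (ι a)]
      refine sum_mem fun i _ => ?_
      have hm : pb.basis.repr (ι a) i ∈ A0 := Algebra.subset_adjoin (by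
        simp only [S, Finset.coe_union, Set.mem_union]
        right
        simp only [Finset.coe_biUnion, Set.mem_iUnion]
        exact ⟨a, ha, by simp⟩)
      refine ⟨algebraMap A0 _ ⟨_, hm⟩ * b i, ?_⟩
      change ρ _ = _
      rw [map_mul, hb, ρ.commutes, Algebra.smul_def]
      rfl
    intro a
    have : a ∈ Algebra.adjoin ℤ (s : Set A) := by rw [hs]; trivial
    exact hle this
  obtain ⟨ι', hι'⟩ := factor_inj ρ.toRingHom hρinj ι hmem
  obtain ⟨L0, _, j0, hj0, H0⟩ := HK A0 hA0 (algebraMap A0 K) (Module.finrank K K' * d)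
  algebraize [ι', ρ.toRingHom, j0]
  have : IsScalarTower A0 (AdjoinRoot f0) K' := IsScalarTower.of_algebraMap_eq fun r => (ρ.commutes r).symm
  have hpo : Algebra.IsPushout A0 K (AdjoinRoot f0) K' := isPushout_of_basis b pb.basis hb
  refine herm_of_family ι d (I := K' →ₐ[K] L0) (fun _ => L0) (fun i => i.toRingHom) ?_ ?_
  · intro i
    refine RingHom.Finite.of_comp_finite (f := algebraMap K K') ?_
    have : (i.toRingHom).comp (algebraMap K K') = j0 := RingHom.ext fun r => i.commutes r
    rw [this]; exact hj0
  · intro D _ _ hD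
    have hD1 := hD.baseChange (AdjoinRoot f0)
    have : Nontrivial (AdjoinRoot f0) := ρ.toRingHom.domain_nontrivial
    have hD0 : EtCov A0 (AdjoinRoot f0 ⊗[A] D) (Module.finrank K K' * d) :=
      EtCov.tower (K := K) (K' := K') (A1 := AdjoinRoot f0) hinj hpo b.algebraMap_injective hD1
    obtain ⟨φ1, hφ1⟩ := H0 _ hD0
    let ψ : AdjoinRoot f0 →+* L0 := φ1.comp (algebraMap (AdjoinRoot f0) (AdjoinRoot f0 ⊗[A] D))
    have hψ : ψ.comp (algebraMap A0 (AdjoinRoot f0)) = j0.comp (algebraMap A0 K) := by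
      rw [← hφ1, IsScalarTower.algebraMap_eq A0 (AdjoinRoot f0) (AdjoinRoot f0 ⊗[A] D)]
      rfl
    have hy : Polynomial.aeval (ψ (AdjoinRoot.root f0)) (minpoly K pb.gen) = 0 := by
      rw [← hfdef, ← hf0, Polynomial.aeval_def, Polynomial.eval₂_map]
      have h1 : (algebraMap K L0).comp (algebraMap A0 K) = ψ.comp (algebraMap A0 (AdjoinRoot f0)) := hψ.symm
      rw [h1, ← Polynomial.hom_eval₂]
      have h2 : Polynomial.eval₂ (algebraMap A0 (AdjoinRoot f0)) (AdjoinRoot.root f0) f0 = 0 := AdjoinRoot.eval₂_root f0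
      rw [h2, map_zero]
    refine ⟨pb.lift _ hy, φ1.comp (Algebra.TensorProduct.includeRight (R := A) (A := AdjoinRoot f0) (B := D)).toRingHom, ?_⟩
    have hcomp : (pb.lift _ hy).toRingHom.comp ρ.toRingHom = ψ := by
      refine AdjoinRoot.ringHom_ext ?_ ?_
      · refine RingHom.ext fun a => ?_
        change pb.lift _ hy (ρ (algebraMap A0 _ a)) = ψ (algebraMap A0 _ a)
        rw [ρ.commutes]
        refine Eq.trans ?_ (RingHom.congr_fun hψ a).symm
        exact (pb.lift _ hy).commutes (algebraMap A0 K a)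
      · change pb.lift _ hy (ρ (AdjoinRoot.root f0)) = _
        rw [hρr, PowerBasis.lift_gen]
    rw [← hι', ← RingHom.comp_assoc, hcomp]
    ext a
    simp only [RingHom.comp_apply, ψ]
    congr 1
    exact ((Algebra.TensorProduct.includeRight (R := A) (A := AdjoinRoot f0) (B := D)).commutes a)

end Alg2

end CW

namespace CW

section Base

open Polynomial TensorProduct NumberField

lemma newton_dvd {R σ : Type} [CommRing R] [IsDomain R] [CharZero R] [Fintype σ] (x : σ → R) (p c : ℕ)
    (hp : p.Prime) (hc : Fintype.card σ < p ^ c)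
    (h : ∀ k, 1 ≤ k → (p : R) ^ c ∣ ∑ i, x i ^ k) (i : σ) : (p : R) ∣ x i ^ Fintype.card σ := by
  classical
  set e : ℕ → R := fun k => (Finset.univ.val.map x).esymm k with he
  have hp0 : (p : R) ≠ 0 := by exact_mod_cast hp.ne_zero
  have key : ∀ k, 1 ≤ k → k ≤ Fintype.card σ → (p : R) ∣ e k := by
    intro k hk hkn
    have h1 := congrArg (MvPolynomial.aeval (R := ℤ) x) (MvPolynomial.mul_esymm_eq_sum σ ℤ k)
    have h2 : (p : R) ^ c ∣ k * e k := by
      have h3 : MvPolynomial.aeval (R := ℤ) x (k * MvPolynomial.esymm σ ℤ k) = k * e k := by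
        rw [map_mul, map_natCast, MvPolynomial.aeval_esymm_eq_multiset_esymm]
      rw [← h3, h1, map_mul, map_sum]
      refine Dvd.dvd.mul_left (Finset.dvd_sum fun a ha => ?_) _
      rw [map_mul]
      refine Dvd.dvd.mul_left ?_ _
      have h4 : MvPolynomial.aeval (R := ℤ) x (MvPolynomial.psum σ ℤ a.2) = ∑ i, x i ^ a.2 := by
        simp [MvPolynomial.psum]
      rw [h4]
      apply h
      rw [Finset.mem_filter, Finset.HasAntidiagonal.mem_antidiagonal] at ha
      have h5 : a.1 + a.2 = k := ha.1
      have h6 := ha.2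
      omega
    obtain ⟨a, u, hu, hku⟩ := Nat.exists_eq_pow_mul_and_not_dvd (n := k) (by omega) p hp.ne_one
    have hac : a < c := by
      by_contra hcon
      push Not at hcon
      have : p ^ c ≤ k := by
        refine Nat.le_of_dvd (by omega) ?_
        rw [hku]
        exact Dvd.dvd.mul_right (pow_dvd_pow p hcon) u
      omega
    have h5 : (p : R) ∣ u * e k := by
      obtain ⟨t, ht⟩ := h2
      have : (p : R) ^ a * (u * e k) = (p : R) ^ a * ((p : R) ^ (c - a) * t) := by
        rw [← mul_assoc, ← mul_assoc, ← pow_add, Nat.add_sub_cancel' hac.le, ← ht, hku]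
        push_cast; ring
      have h6 := mul_left_cancel₀ (pow_ne_zero a hp0) this
      rw [h6]
      exact Dvd.dvd.mul_right (dvd_pow_self _ (by omega)) _
    have hcop : IsCoprime (p : ℤ) (u : ℤ) := by
      rw [Nat.isCoprime_iff_coprime]
      exact (Nat.Prime.coprime_iff_not_dvd hp).mpr hu
    have hcop' : IsCoprime (p : R) (u : R) := by simpa using hcop.map (Int.castRingHom R)
    exact hcop'.dvd_of_dvd_mul_left h5
  have hr := congrArg (Polynomial.eval (x i)) (Multiset.prod_X_sub_X_eq_sum_esymm (Finset.univ.val.map x))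
  rw [Polynomial.eval_multiset_prod, Polynomial.eval_finsetSum] at hr
  rw [Multiset.prod_eq_zero (by
    simp only [Multiset.map_map, Multiset.mem_map]
    exact ⟨i, by simp, by simp⟩)] at hr
  simp only [Multiset.card_map, Finset.card_val, Finset.card_univ] at hr
  rw [Finset.sum_range_succ'] at hr
  have h7 : x i ^ Fintype.card σ = - ∑ k ∈ Finset.range (Fintype.card σ),
      Polynomial.eval (x i) ((-1) ^ (k+1) * (Polynomial.C (e (k+1)) * Polynomial.X ^ (Fintype.card σ - (k+1)))) := by
    have h8 : Polynomial.eval (x i) ((-1) ^ 0 * (Polynomial.C ((Finset.univ.val.map x).esymm 0) * Polynomial.X ^ (Fintype.card σ - 0))) = x i ^ Fintype.card σ := by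
      simp [Multiset.esymm]
    rw [h8] at hr
    rw [eq_neg_iff_add_eq_zero, add_comm]
    exact hr.symm
  rw [h7, dvd_neg]
  refine Finset.dvd_sum fun k hk => ?_
  rw [Finset.mem_range] at hk
  simp only [Polynomial.eval_mul, Polynomial.eval_C]
  exact Dvd.dvd.mul_left (Dvd.dvd.mul_right (key (k+1) (by omega) (by omega)) _) _

/-- power sums of traces divisible by a high power of `p` -/
lemma trace_nilp {F : Type} [Field F] [NumberField F] (E : 𝓞 F) (p c : ℕ) (hp : p.Prime)
    (hc : Module.finrank ℚ F < p ^ c)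
    (h : ∀ k, 1 ≤ k → (p : ℤ) ^ c ∣ Algebra.trace ℤ (𝓞 F) (E ^ k)) : ∃ n, (p : 𝓞 F) ∣ E ^ n := by
  let Ω := AlgebraicClosure ℚ
  let R := integralClosure ℤ Ω
  let x : (F →ₐ[ℚ] Ω) → R := fun σ => ⟨σ (E : F), E.2.map (σ.restrictScalars ℤ)⟩
  have hcard : Fintype.card (F →ₐ[ℚ] Ω) = Module.finrank ℚ F := AlgHom.card ℚ F Ω
  have hx : ∀ k, 1 ≤ k → (p : R) ^ c ∣ ∑ i, x i ^ k := by
    intro k hk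
    obtain ⟨t, ht⟩ := h k hk
    refine ⟨(t : R), Subtype.val_injective ?_⟩
    have h1 : algebraMap ℚ Ω (Algebra.trace ℚ F ((E : F) ^ k)) = ∑ σ : F →ₐ[ℚ] Ω, σ ((E : F) ^ k) :=
      trace_eq_sum_embeddings Ω
    have h2 : Algebra.trace ℚ F ((E : F) ^ k) = ((p : ℤ) ^ c * t : ℤ) := by
      rw [← ht]
      have := Algebra.trace_localization ℤ (Rₘ := ℚ) (Sₘ := F) (nonZeroDivisors ℤ) (E ^ k)
      rw [eq_intCast] at this
      rw [← this]
      simp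
    rw [h2] at h1
    simp only [map_pow] at h1
    have h3 : ((∑ i, x i ^ k : R) : Ω) = ∑ σ : F →ₐ[ℚ] Ω, (σ (E : F)) ^ k := by
      simp [x]
    rw [h3, ← h1]
    simp
  have : CharZero R := inferInstance
  obtain ⟨i⟩ : Nonempty (F →ₐ[ℚ] Ω) := ⟨IsAlgClosed.lift⟩
  obtain ⟨w, hw⟩ := newton_dvd x p c hp (by rw [hcard]; exact hc) hx i
  refine ⟨Fintype.card (F →ₐ[ℚ] Ω), ?_⟩
  have hp0 : (p : F) ≠ 0 := by exact_mod_cast hp.ne_zero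
  have hp0' : (p : Ω) ≠ 0 := by exact_mod_cast hp.ne_zero
  set n := Fintype.card (F →ₐ[ℚ] Ω)
  have hint : IsIntegral ℤ ((E : F) ^ n / p) := by
    rw [← isIntegral_algHom_iff (i.restrictScalars ℤ) i.injective]
    have : (i.restrictScalars ℤ) ((E : F) ^ n / p) = (w : Ω) := by
      have h4 := congrArg Subtype.val hw
      change (i E) ^ n = _ at h4
      simp only [AlgHom.restrictScalars_apply, map_div₀, map_pow, map_natCast]
      rw [h4, div_eq_iff hp0']
      simp [mul_comm]
    rw [this]
    exact w.2
  refine ⟨⟨_, hint⟩, ?_⟩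
  refine RingOfIntegers.ext ?_
  change (E : F) ^ n = p * ((E : F) ^ n / p)
  field_simp

lemma not_pow_dvd_different {F : Type} [Field F] [NumberField F] (P : Ideal (𝓞 F)) [hP : P.IsPrime] (p c m : ℕ) (hp : p.Prime)
    (hpP : (p : 𝓞 F) ∈ P)
    (hc : Module.finrank ℚ F < p ^ c) (J : Ideal (𝓞 F)) (hJ : P ^ m * J = Ideal.span {(p : 𝓞 F) ^ c}) (hJP : ¬ J ≤ P) :
    ¬ P ^ m ∣ differentIdeal ℤ (𝓞 F) := by
  intro hdvd
  have hp0 : (p : 𝓞 F) ≠ 0 := by exact_mod_cast hp.ne_zero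
  have hp0F : (p : F) ≠ 0 := by exact_mod_cast hp.ne_zero
  have hP0 : P ^ m ≠ ⊥ := by
    intro h0
    rw [h0, Ideal.bot_mul, eq_comm, Ideal.span_singleton_eq_bot] at hJ
    exact pow_ne_zero _ hp0 hJ
  obtain ⟨E, hEJ, hEP⟩ := Set.not_subset.mp hJP
  rw [Ideal.dvd_iff_le, differentialIdeal_le_iff (K := ℚ) (L := F) hP0] at hdvd
  have htr : ∀ k, 1 ≤ k → (p : ℤ) ^ c ∣ Algebra.trace ℤ (𝓞 F) (E ^ k) := by
    intro k hk
    have hmem : (algebraMap (𝓞 F) F E) ^ k / (p : F) ^ c ∈ (((P ^ m : Ideal (𝓞 F)) : FractionalIdeal (nonZeroDivisors (𝓞 F)) F)⁻¹) := by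
      rw [FractionalIdeal.mem_inv_iff (by simpa using hP0)]
      intro y hy
      obtain ⟨y, hy', rfl⟩ := (FractionalIdeal.mem_coeIdeal _).mp hy
      have h1 : y * E ^ k ∈ Ideal.span {(p : 𝓞 F) ^ c} := by
        rw [← hJ]
        exact Ideal.mul_mem_mul hy' (Ideal.pow_mem_of_mem J hEJ k hk)
      obtain ⟨z, hz⟩ := Ideal.mem_span_singleton'.mp h1
      rw [FractionalIdeal.mem_one_iff]
      refine ⟨z, ?_⟩
      rw [div_mul_eq_mul_div, eq_div_iff (pow_ne_zero _ hp0F), ← map_pow, mul_comm (algebraMap (𝓞 F) F (E ^ k)), ← map_mul, ← hz]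
      simp
    have h2 := hdvd (Submodule.mem_map_of_mem (f := (Algebra.trace ℚ F).restrictScalars ℤ) hmem)
    obtain ⟨t, ht⟩ := Submodule.mem_one.mp h2
    refine ⟨t, ?_⟩
    have h3 := Algebra.trace_localization ℤ (Rₘ := ℚ) (Sₘ := F) (nonZeroDivisors ℤ) (E ^ k)
    have h4 : Algebra.trace ℚ F ((algebraMap (𝓞 F) F E) ^ k) = (p : ℚ) ^ c * t := by
      have h5 : (algebraMap (𝓞 F) F E) ^ k = ((p : ℚ) ^ c) • ((algebraMap (𝓞 F) F E) ^ k / (p : F) ^ c) := by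
        rw [Algebra.smul_def]; simp; field_simp
      rw [h5, map_smul, smul_eq_mul]
      congr 1
      exact ht.symm
    rw [map_pow, h4] at h3
    have : ((Algebra.trace ℤ (𝓞 F) (E ^ k) : ℤ) : ℚ) = ((p ^ c * t : ℤ) : ℚ) := by
      push_cast
      exact h3.symm
    exact_mod_cast this
  obtain ⟨n, hn⟩ := trace_nilp E p c hp hc htr
  exact hEP (hP.mem_of_pow_mem n (P.mem_of_dvd hn hpP))

lemma different_dvd {F : Type} [Field F] [NumberField F] (N d : ℕ) (hN : N ≠ 0) (hd : Module.finrank ℚ F ≤ d)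
    (hur : ∀ P : Ideal (𝓞 F), P.IsPrime → (N : 𝓞 F) ∉ P → ¬ P ∣ differentIdeal ℤ (𝓞 F)) :
    differentIdeal ℤ (𝓞 F) ∣ Ideal.span {(N : 𝓞 F) ^ d} := by
  rw [UniqueFactorizationMonoid.dvd_iff_emultiplicity_le differentIdeal_ne_bot]
  intro P hP
  have hPp : P.IsPrime := Ideal.isPrime_of_prime hP
  refine ENat.forall_natCast_le_iff_le.mp fun m hm => ?_
  rw [← pow_dvd_iff_le_emultiplicity] at hm ⊢
  by_cases hNP : (N : 𝓞 F) ∈ P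
  · -- wild bound
    obtain ⟨p, hp, hpN, hpP⟩ : ∃ p : ℕ, p.Prime ∧ p ∣ N ∧ (p : 𝓞 F) ∈ P := by
      have h1 : (N : 𝓞 F) = ((N.primeFactorsList.map (fun q : ℕ => (q : 𝓞 F))).prod) := by
        rw [← Nat.cast_list_prod, Nat.prod_primeFactorsList hN]
      rw [h1, ← Multiset.prod_coe, hPp.multiset_prod_mem_iff_exists_mem] at hNP
      obtain ⟨q, hq, hqP⟩ := hNP
      obtain ⟨q, hq', rfl⟩ := List.mem_map.mp (Multiset.mem_coe.mp hq)
      exact ⟨q, Nat.prime_of_mem_primeFactorsList hq', Nat.dvd_of_mem_primeFactorsList hq', hqP⟩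
    have hp0 : (p : 𝓞 F) ≠ 0 := by exact_mod_cast hp.ne_zero
    have hfin : FiniteMultiplicity P (Ideal.span {(p : 𝓞 F) ^ d}) :=
      FiniteMultiplicity.of_prime_left hP (by
        rw [Ne, Ideal.zero_eq_bot, Ideal.span_singleton_eq_bot]; exact pow_ne_zero _ hp0)
    obtain ⟨J, hJ, hJP⟩ := hfin.exists_eq_pow_mul_and_not_dvd
    have hbig : Module.finrank ℚ F < p ^ d := lt_of_le_of_lt hd (Nat.lt_pow_self hp.one_lt)
    have hnot := not_pow_dvd_different P p d _ hp hpP hbig J hJ.symm (by rwa [Ideal.dvd_iff_le] at hJP)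
    have hlt : m ≤ multiplicity P (Ideal.span {(p : 𝓞 F) ^ d}) := by
      by_contra hcon
      push Not at hcon
      exact hnot ((pow_dvd_pow P hcon.le).trans hm)
    refine (pow_dvd_pow P hlt).trans ?_
    refine (Dvd.intro J hJ.symm).trans ?_
    rw [Ideal.dvd_span_singleton, Ideal.mem_span_singleton]
    exact pow_dvd_pow_of_dvd (Nat.cast_dvd_cast hpN) d
  · have := hur P hPp hNP
    have hm0 : m = 0 := by
      by_contra hcon
      exact this ((dvd_pow_self P hcon).trans hm)
    rw [hm0, pow_zero]
    exact one_dvd _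

lemma discr_bound {F : Type} [Field F] [NumberField F] (N d : ℕ) (hN : N ≠ 0) (hd : Module.finrank ℚ F ≤ d)
    (hur : ∀ P : Ideal (𝓞 F), P.IsPrime → (N : 𝓞 F) ∉ P → ¬ P ∣ differentIdeal ℤ (𝓞 F)) :
    |NumberField.discr F| ≤ ((N ^ d) ^ d : ℕ) := by
  have h1 := different_dvd N d hN hd hur
  have h2 := Ideal.absNorm_dvd_absNorm_of_le (Ideal.dvd_iff_le.mp h1)
  rw [NumberField.absNorm_differentIdeal (K := F)] at h2
  have h3 : Ideal.absNorm (Ideal.span {(N : 𝓞 F) ^ d}) = (N ^ d) ^ Module.finrank ℚ F := by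
    have : (N : 𝓞 F) ^ d = algebraMap ℤ (𝓞 F) ((N : ℤ) ^ d) := by simp
    rw [Ideal.absNorm_span_singleton, this, Algebra.norm_algebraMap, NumberField.RingOfIntegers.rank]
    simp [Int.natAbs_pow]
  rw [h3] at h2
  have h4 := Nat.le_of_dvd (by positivity) h2
  have h5 : (N ^ d) ^ Module.finrank ℚ F ≤ (N ^ d) ^ d := Nat.pow_le_pow_right (by positivity) hd
  rw [Int.abs_eq_natAbs]
  exact_mod_cast h4.trans h5

end Base

end CW

namespace CW

section Base2

open Polynomial TensorProduct NumberField

lemma der_zero {R D M : Type} [CommRing R] [CommRing D] [Algebra R D] [Algebra.FormallyUnramified R D]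
    [AddCommGroup M] [Module R M] [Module D M] [IsScalarTower R D M] (δ : Derivation R D M) (y : D) : δ y = 0 := by
  have h1 : KaehlerDifferential.D R D y = 0 := Subsingleton.elim _ _
  have h2 := δ.liftKaehlerDifferential_comp
  have h3 : δ.liftKaehlerDifferential (KaehlerDifferential.D R D y) = δ y := δ.liftKaehlerDifferential_comp_D y
  rw [← h3, h1, map_zero]

lemma unram_gen {R0 D O T : Type} [CommRing R0] [CommRing D] [CommRing O] [CommRing T] [Algebra R0 D] [Algebra R0 T]
    [Algebra O T] (M : Submonoid O) [IsLocalization M T] [Algebra.FormallyUnramified R0 D] (θ : D →ₐ[R0] T)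
    (h : ∀ x : O, ∃ y, algebraMap O T x = θ y) : Algebra.FormallyUnramified R0 T := by
  have hD0 : ∀ y : D, KaehlerDifferential.D R0 T (θ y) = 0 := fun y =>
    letI : Algebra D T := θ.toRingHom.toAlgebra
    haveI : IsScalarTower R0 D T := IsScalarTower.of_algebraMap_eq fun r => (θ.commutes r).symm
    der_zero ((KaehlerDifferential.D R0 T).compAlgebraMap D) y
  have hO : ∀ x : O, KaehlerDifferential.D R0 T (algebraMap O T x) = 0 := by
    intro x
    obtain ⟨y, hy⟩ := h x
    rw [hy, hD0]
  have hT : ∀ t : T, KaehlerDifferential.D R0 T t = 0 := by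
    intro t
    obtain ⟨x, s, rfl⟩ := IsLocalization.exists_mk'_eq M t
    have h1 := congrArg (KaehlerDifferential.D R0 T) (IsLocalization.mk'_spec T x s)
    rw [Derivation.leibniz, hO, hO, smul_zero, zero_add] at h1
    exact (IsLocalization.map_units T s).smul_eq_zero.mp h1
  constructor
  rw [← Submodule.subsingleton_iff T, ← subsingleton_iff_bot_eq_top, ← KaehlerDifferential.span_range_derivation R0 T, eq_comm, Submodule.span_eq_bot]
  rintro _ ⟨t, rfl⟩
  exact hT t

lemma unram_of_surj {B D F : Type} [CommRing B] [CommRing D] [Algebra B D] [Module.Finite B D] [Algebra.FormallyUnramified B D]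
    (N : ℕ) [IsLocalization.Away (N : ℤ) B] [Field F] [NumberField F] (π : D →+* F)
    (hs : ∀ x : F, IsIntegral ℤ x → ∃ y, π y = x) (P : Ideal (𝓞 F)) [P.IsPrime] (hN : (N : 𝓞 F) ∉ P) :
    Algebra.IsUnramifiedAt ℤ P := by
  let T := Localization.AtPrime P
  have : Algebra.FormallyUnramified ℤ B := Algebra.FormallyUnramified.of_isLocalization (Submonoid.powers (N : ℤ))
  have : Algebra.FormallyUnramified ℤ D := Algebra.FormallyUnramified.comp ℤ B D
  have hunit : ∀ y : P.primeCompl, IsUnit (algebraMap (𝓞 F) F y) := by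
    intro y
    refine IsUnit.mk0 _ ?_
    intro h0
    have : (y : 𝓞 F) = 0 := by
      apply FaithfulSMul.algebraMap_injective (𝓞 F) F
      rw [h0, map_zero]
    exact y.2 (by rw [this]; exact zero_mem _)
  let ρ : T →+* F := IsLocalization.lift (M := P.primeCompl) hunit
  have hρ : ∀ x, ρ (algebraMap (𝓞 F) T x) = algebraMap (𝓞 F) F x := fun x => IsLocalization.lift_eq hunit x
  have hρinj : Function.Injective ρ := by
    refine (injective_iff_map_eq_zero ρ).mpr fun t ht => ?_
    obtain ⟨x, s, rfl⟩ := IsLocalization.exists_mk'_eq P.primeCompl t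
    have h1 : ρ (IsLocalization.mk' T x s * algebraMap (𝓞 F) T s) = 0 := by rw [map_mul, ht, zero_mul]
    rw [IsLocalization.mk'_spec, hρ] at h1
    have : x = 0 := by
      apply FaithfulSMul.algebraMap_injective (𝓞 F) F
      rw [h1, map_zero]
    rw [this, IsLocalization.mk'_zero]
  have hr : ∀ y, π y ∈ ρ.range := by
    intro y
    obtain ⟨m, hm⟩ := IsIntegral.exists_multiple_integral_of_isLocalization (R := ℤ) (Submonoid.powers (N : ℤ)) (Rₘ := B) y
      (Algebra.IsIntegral.isIntegral y)
    obtain ⟨k, hk⟩ := m.2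
    have hk' : (m : ℤ) = (N : ℤ) ^ k := hk.symm
    have h2 : IsIntegral ℤ ((N : F) ^ k * π y) := by
      have h3 := hm.map (π.toIntAlgHom)
      have h4 : π.toIntAlgHom (m • y) = (N : F) ^ k * π y := by
        change π ((m : ℤ) • y) = _
        rw [hk', zsmul_eq_mul, map_mul]
        simp
      rwa [h4] at h3
    have hs1 : (N : 𝓞 F) ^ k ∈ P.primeCompl := P.primeCompl.pow_mem hN k
    have hN0 : (N : F) ^ k ≠ 0 := by
      have := (hunit ⟨_, hs1⟩).ne_zero
      simpa using this
    let z : 𝓞 F := ⟨_, h2⟩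
    refine ⟨IsLocalization.mk' T z ⟨_, hs1⟩, ?_⟩
    refine mul_right_cancel₀ hN0 ?_
    have h5 : (N : F) ^ k = ρ (algebraMap (𝓞 F) T ((N : 𝓞 F) ^ k)) := by rw [hρ]; simp
    conv_lhs => rw [h5]
    rw [← map_mul]
    have h6 := IsLocalization.mk'_spec T z (⟨_, hs1⟩ : P.primeCompl)
    rw [h6, hρ]
    exact mul_comm _ _
  obtain ⟨θ, hθ⟩ := factor_inj ρ hρinj π hr
  refine unram_gen (R0 := ℤ) P.primeCompl { θ with commutes' := fun r => by simp } (fun x => ?_)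
  obtain ⟨y, hy⟩ := hs (x : F) x.2
  refine ⟨y, ?_⟩
  apply hρinj
  rw [hρ]
  change _ = (ρ.comp θ) y
  rw [hθ, hy]

lemma surj_of_etale {B D : Type} [CommRing B] [IsIntegrallyClosed B] [CommRing D] [Algebra B D] [Algebra B ℚ] [IsFractionRing B ℚ]
    [Module.Finite B D] [Algebra.Etale B D]
    {I : Type} [Finite I] (Ai : I → Type) [∀ i, Field (Ai i)] [∀ i, Algebra ℚ (Ai i)] (e : (ℚ ⊗[B] D) ≃ₐ[ℚ] Π i, Ai i) (i : I)
    (x : Ai i) (hx : IsIntegral ℤ x) : ∃ y : D, e (1 ⊗ₜ y) i = x := by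
  classical
  have h1 : IsIntegral ℤ (Pi.single i x : Π i, Ai i) := by
    obtain ⟨f, hf, hfx⟩ := hx
    refine ⟨Polynomial.X * f, Polynomial.monic_X.mul hf, ?_⟩
    funext l
    have h2 : ∀ q : ℤ[X], Polynomial.eval₂ (algebraMap ℤ (Π i, Ai i)) (Pi.single i x) q l =
        Polynomial.eval₂ (algebraMap ℤ (Ai l)) ((Pi.single i x : Π i, Ai i) l) q := by
      intro q
      have := Polynomial.hom_eval₂ q (algebraMap ℤ (Π i, Ai i)) (Pi.evalRingHom Ai l) (Pi.single i x)
      exact this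
    rw [h2, Polynomial.eval₂_mul, Polynomial.eval₂_X]
    by_cases hl : l = i
    · subst hl
      rw [Pi.single_eq_same, hfx, mul_zero]; rfl
    · rw [Pi.single_eq_of_ne hl, zero_mul]; rfl
  have h3 : IsIntegral D (Algebra.TensorProduct.comm B ℚ D (e.symm (Pi.single i x))) :=
    h1.map_of_comp_eq (algebraMap ℤ D) ((Algebra.TensorProduct.comm B ℚ D).toRingEquiv.toRingHom.comp e.symm.toRingEquiv.toRingHom)
      (RingHom.ext_int _ _)
  obtain ⟨w, hw⟩ := (TensorProduct.toIntegralClosure_bijective_of_smooth (R := B) (S := D) (B := ℚ)).2 ⟨_, h3⟩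
  have h4 : ∀ w : D ⊗[B] integralClosure B ℚ, ∃ y : D, (TensorProduct.toIntegralClosure B D ℚ w : D ⊗[B] ℚ) = y ⊗ₜ 1 := by
    intro w
    induction w with
    | zero => exact ⟨0, by simp⟩
    | add a b ha hb =>
      obtain ⟨y, hy⟩ := ha
      obtain ⟨z, hz⟩ := hb
      exact ⟨y + z, by rw [map_add, Subalgebra.coe_add, hy, hz, TensorProduct.add_tmul]⟩
    | tmul a c =>
      obtain ⟨b, hb⟩ := IsIntegrallyClosed.isIntegral_iff.mp c.2
      refine ⟨b • a, ?_⟩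
      rw [TensorProduct.smul_tmul, Algebra.smul_def, mul_one, hb]
      simp [TensorProduct.toIntegralClosure]
  obtain ⟨y, hy⟩ := h4 w
  refine ⟨y, ?_⟩
  rw [hw] at hy
  have h5 : e.symm (Pi.single i x) = 1 ⊗ₜ y := by
    apply (Algebra.TensorProduct.comm B ℚ D).injective
    refine Eq.trans hy ?_
    simp
  rw [← h5, e.apply_symm_apply, Pi.single_eq_same]

end Base2

end CW

namespace CW

section Base3

open Polynomial TensorProduct NumberField

lemma exists_denom {A : Type} [CommRing A] (hA : Algebra.FiniteType ℤ A) (ι : A →+* ℚ) :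
    ∃ N : ℕ, N ≠ 0 ∧ ∀ a, ∃ (k : ℕ) (z : ℤ), (N : ℚ) ^ k * ι a = z := by
  classical
  obtain ⟨s, hs⟩ := hA.out
  let N := ∏ a ∈ s, (ι a).den
  have hN : N ≠ 0 := Finset.prod_ne_zero_iff.mpr fun a _ => (ι a).den_ne_zero
  refine ⟨N, hN, fun a => ?_⟩
  have ha : a ∈ Algebra.adjoin ℤ (s : Set A) := by rw [hs]; trivial
  induction ha using Algebra.adjoin_induction with
  | mem x hx =>
    obtain ⟨t, ht⟩ : (ι x).den ∣ N := Finset.dvd_prod_of_mem (fun a => (ι a).den) hx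
    refine ⟨1, t * (ι x).num, ?_⟩
    rw [ht]
    push_cast
    rw [pow_one, mul_right_comm, mul_comm ((ι x).den : ℚ), Rat.mul_den_eq_num, mul_comm]
  | algebraMap r => exact ⟨0, r, by simp⟩
  | add x y _ _ hx hy =>
    obtain ⟨k, z, h⟩ := hx
    obtain ⟨l, w, h'⟩ := hy
    refine ⟨k + l, N ^ l * z + N ^ k * w, ?_⟩
    push_cast
    rw [← h, ← h', map_add]
    ring
  | mul x y _ _ hx hy =>
    obtain ⟨k, z, h⟩ := hx
    obtain ⟨l, w, h'⟩ := hy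
    refine ⟨k + l, z * w, ?_⟩
    push_cast
    rw [← h, ← h', map_mul]
    ring

theorem hermite_base_core {B : Type} [CommRing B] [IsDomain B] [IsIntegrallyClosed B] [Algebra B ℚ] [IsFractionRing B ℚ]
    (N d : ℕ) (hN : N ≠ 0) [IsLocalization.Away (N : ℤ) B] (D : Type) [CommRing D] [Algebra B D] (hD : EtCov B D d) :
    ∃ (F : Type) (_ : Field F) (_ : NumberField F) (φ : D →+* F), φ.comp (algebraMap B D) = (algebraMap ℚ F).comp (algebraMap B ℚ) ∧
      |NumberField.discr F| ≤ ((N ^ d) ^ d : ℕ) := by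
  have := hD.fin
  have := hD.et
  have hE : Algebra.Etale ℚ (ℚ ⊗[B] D) := inferInstance
  obtain ⟨I, _, Ai, _, _, e, hAi⟩ := (Algebra.Etale.iff_exists_algEquiv_prod ℚ _).mp hE
  let pK : PrimeSpectrum ℚ := ⟨⊥, Ideal.isPrime_bot⟩
  have hlo := (hD.baseChange ℚ).lo pK
  have hhi := (hD.baseChange ℚ).hi pK
  rw [Module.rankAtStalk_eq_finrank_of_free] at hlo hhi
  simp only [Pi.natCast_apply, Nat.cast_id] at hlo hhi
  rw [e.toLinearEquiv.finrank_eq] at hlo hhi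
  have hne : Nonempty I := by
    by_contra hcon
    rw [not_nonempty_iff] at hcon
    have : Subsingleton (Π i, Ai i) := inferInstance
    rw [Module.finrank_zero_of_subsingleton] at hlo
    omega
  obtain ⟨i⟩ := hne
  have hfin : FiniteDimensional ℚ (Ai i) := (hAi i).1
  have hchar : CharZero (Ai i) := algebraRat.charZero (Ai i)
  have hnf : NumberField (Ai i) := by
    refine @NumberField.mk _ _ hchar ?_
    convert hfin
    exact Subsingleton.elim _ _
  have hallfin : ∀ i, FiniteDimensional ℚ (Ai i) := fun i => (hAi i).1
  have hdeg : Module.finrank ℚ (Ai i) ≤ d := by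
    refine le_trans ?_ hhi
    exact LinearMap.finrank_le_finrank_of_surjective (f := LinearMap.proj (R := ℚ) (φ := Ai) i) (Function.surjective_eval i)
  let π : D →+* Ai i := (Pi.evalRingHom Ai i).comp (e.toRingEquiv.toRingHom.comp
    (Algebra.TensorProduct.includeRight (R := B) (A := ℚ) (B := D)).toRingHom)
  have hπ : π.comp (algebraMap B D) = (algebraMap ℚ (Ai i)).comp (algebraMap B ℚ) := by
    ext b
    change e (1 ⊗ₜ algebraMap B D b) i = algebraMap ℚ (Ai i) (algebraMap B ℚ b)
    have h1 : (1 : ℚ) ⊗ₜ[B] algebraMap B D b = algebraMap ℚ _ (algebraMap B ℚ b) := by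
      rw [Algebra.algebraMap_eq_smul_one (R := B) (A := D), ← TensorProduct.smul_tmul, Algebra.smul_def, mul_one]
      rfl
    rw [h1, e.commutes]
    rfl
  refine ⟨Ai i, inferInstance, hnf, π, ?_, ?_⟩
  · rw [hπ]
    congr 1
    exact Subsingleton.elim _ _
  · refine discr_bound N d hN ?_ ?_
    · convert hdeg
      exact Subsingleton.elim _ _
    · intro P hP hNP
      rw [not_dvd_differentIdeal_iff]
      exact unram_of_surj (B := B) N π (fun x hx => surj_of_etale Ai e i x hx) P hNP

theorem hermite_base : HermiteA ℚ := by
  intro A _ hA ι d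
  obtain ⟨N, hN, hden⟩ := exists_denom hA ι
  obtain ⟨B, _, _⟩ : ∃ (B : Type) (_ : CommRing B), IsLocalization.Away (N : ℤ) B := by
    refine ⟨Localization.Away (N : ℤ), inferInstance, ?_⟩
    have h := (inferInstance : IsLocalization.Away (N : ℤ) (Localization.Away (N : ℤ)))
    convert h
    · rfl
    · exact Subsingleton.elim _ _
  have hpow : Submonoid.powers (N : ℤ) ≤ nonZeroDivisors ℤ :=
    powers_le_nonZeroDivisors_of_noZeroDivisors (by exact_mod_cast hN)
  have : IsDomain B := IsLocalization.isDomain_of_le_nonZeroDivisors (M := Submonoid.powers (N : ℤ)) _ hpow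
  have : IsIntegrallyClosed B := isIntegrallyClosed_of_isLocalization B _ hpow
  have hu : IsUnit (algebraMap ℤ ℚ (N : ℤ)) := IsUnit.mk0 _ (by simpa using hN)
  let β : B →+* ℚ := IsLocalization.Away.lift (N : ℤ) hu
  let _ : Algebra B ℚ := β.toAlgebra
  have : IsScalarTower ℤ B ℚ := IsScalarTower.of_algebraMap_eq' (RingHom.ext_int _ _)
  have : IsFractionRing B ℚ := IsFractionRing.isFractionRing_of_isDomain_of_isLocalization (Submonoid.powers (N : ℤ)) B ℚ
  have hinj : Function.Injective β := IsFractionRing.injective B ℚ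
  have hr : ∀ a, ι a ∈ β.range := by
    intro a
    obtain ⟨k, z, h⟩ := hden a
    have hNB : IsUnit (algebraMap ℤ B (N : ℤ)) := IsLocalization.Away.algebraMap_isUnit (N : ℤ)
    obtain ⟨u, hu'⟩ := hNB
    refine ⟨algebraMap ℤ B z * (↑u⁻¹ : B) ^ k, ?_⟩
    have hN0 : (N : ℚ) ^ k ≠ 0 := pow_ne_zero _ (by exact_mod_cast hN)
    refine mul_left_cancel₀ hN0 ?_
    rw [h]
    have h2 : (N : ℚ) = β (u : B) := by rw [hu']; simp
    rw [h2, ← map_pow, ← map_mul, mul_left_comm, ← mul_pow]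
    simp
  obtain ⟨ι', hι'⟩ := factor_inj β hinj ι hr
  let Ω := AlgebraicClosure ℚ
  let S := {K : { F : IntermediateField ℚ Ω // FiniteDimensional ℚ F} |
      haveI :  NumberField K := @NumberField.mk _ _ inferInstance K.prop
      |discr K| ≤ ((N ^ d) ^ d : ℕ) }
  have hS : Finite S := (NumberField.finite_of_discr_bdd Ω _).to_subtype
  refine herm_of_family ι d (I := S) (fun K => K.1.1) (fun K => algebraMap ℚ K.1.1) ?_ ?_
  · intro K
    rw [RingHom.finite_algebraMap]
    exact K.1.2
  · intro D _ _ hD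
    algebraize [ι']
    obtain ⟨F, _, _, φ, hφ, hdisc⟩ := hermite_base_core (B := B) N d hN (B ⊗[A] D) (hD.baseChange B)
    let σ : F →ₐ[ℚ] Ω := IsAlgClosed.lift
    let e := AlgEquiv.ofInjectiveField σ
    have hfd : FiniteDimensional ℚ σ.fieldRange := e.toLinearEquiv.finiteDimensional
    have : NumberField σ.fieldRange := ⟨⟩
    refine ⟨⟨⟨σ.fieldRange, hfd⟩, ?_⟩, e.toRingEquiv.toRingHom.comp (φ.comp (Algebra.TensorProduct.includeRight (R := A) (A := B) (B := D)).toRingHom), ?_⟩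
    · change |discr σ.fieldRange| ≤ _
      rw [← NumberField.discr_eq_discr_of_algEquiv F e]
      exact hdisc
    · ext a
      change σ (φ (1 ⊗ₜ algebraMap A D a)) = algebraMap ℚ Ω (ι a)
      have h1 : (1 : B) ⊗ₜ[A] algebraMap A D a = algebraMap B _ (ι' a) := by
        rw [Algebra.algebraMap_eq_smul_one (R := A) (A := D), ← TensorProduct.smul_tmul, Algebra.smul_def, mul_one]
        rfl
      have h2 : φ (algebraMap B _ (ι' a)) = algebraMap ℚ F (β (ι' a)) := RingHom.congr_fun hφ (ι' a)
      have h3 : β (ι' a) = ι a := RingHom.congr_fun hι' a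
      rw [h1, h2, h3]
      exact σ.commutes _

end Base3

end CW

namespace CW

section FG1

open Polynomial TensorProduct IntermediateField

lemma countable_ratFunc (K : Type) [Field K] [Countable K] : Countable (RatFunc K) := by
  have h1 : Cardinal.mk (K[X]) ≤ Cardinal.aleph0 := by
    refine Polynomial.cardinalMk_le_max.trans ?_
    exact max_le (Cardinal.mk_le_aleph0) le_rfl
  have h2 : Cardinal.mk (RatFunc K) ≤ Cardinal.aleph0 := by
    rw [IsFractionRing.cardinalMk (R := K[X]) (RatFunc K)]; exact h1
  exact Cardinal.mk_le_aleph0_iff.mp h2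

lemma hermite_simple {k : Type} [Field k] [CharZero k] (K : IntermediateField ℚ k) (hK : HermiteA K) [Countable K] (x : k) :
    HermiteA (K⟮x⟯) ∧ Countable (K⟮x⟯) := by
  by_cases hx : IsAlgebraic K x
  · have := IntermediateField.adjoin.finiteDimensional hx.isIntegral
    refine ⟨hermite_alg (K := K) hK, ?_⟩
    refine countable_of_finite (algebraMap K K⟮x⟯) ?_
    exact RingHom.finite_algebraMap.mpr inferInstance
  · have h1 : HermiteA (RatFunc K) := hermite_trans hK (RatFunc K)
    have e := RatFunc.algEquivOfTranscendental (K := K) x hx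
    have := countable_ratFunc K
    exact ⟨h1.of_equiv e.toRingEquiv, e.toEquiv.symm.injective.countable⟩

lemma hermite_adjoin {k : Type} [Field k] [CharZero k] (s : Finset k) :
    HermiteA (adjoin ℚ (s : Set k)) ∧ Countable (adjoin ℚ (s : Set k)) := by
  classical
  induction s using Finset.induction with
  | empty =>
    have e : (adjoin ℚ ((∅ : Finset k) : Set k)) ≃ₐ[ℚ] ℚ :=
      (IntermediateField.equivOfEq (by simp)).trans (IntermediateField.botEquiv ℚ k)
    exact ⟨hermite_base.of_equiv e.symm.toRingEquiv, e.injective.countable⟩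
  | insert x s hx ih =>
    obtain ⟨h1, h2⟩ := ih
    obtain ⟨h3, h4⟩ := hermite_simple (adjoin ℚ (s : Set k)) h1 x
    have e0 := IntermediateField.adjoin_adjoin_left (F := ℚ) (s : Set k) {x}
    have e : (IntermediateField.restrictScalars ℚ (adjoin (adjoin ℚ (s : Set k)) {x})) = adjoin ℚ ((insert x s : Finset k) : Set k) := by
      refine e0.trans ?_
      congr 1; simp
    rw [← e]
    exact ⟨h3, h4⟩

/-- Finiteness of integral closure. -/
lemma exists_fg_closed_aux1 {R Rr L : Type} [CommRing R] [IsDomain R] [IsIntegrallyClosed R] [IsNoetherianRing R]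
    [Field L] [CharZero L] [Algebra R L] [Algebra.EssFiniteType R L] [Algebra.IsAlgebraic R L] 
    (r : R) (hr0 : r ≠ 0) [CommRing Rr] [IsDomain Rr] [Algebra R Rr] [IsLocalization.Away r Rr] [Algebra Rr L] [IsScalarTower R Rr L]
    [FaithfulSMul Rr L] : Module.Finite Rr (integralClosure Rr L) := by
  have hrpow : Submonoid.powers r ≤ nonZeroDivisors R := powers_le_nonZeroDivisors_of_noZeroDivisors hr0
  have : IsIntegrallyClosed Rr := isIntegrallyClosed_of_isLocalization Rr _ hrpow
  have : IsNoetherianRing Rr := IsLocalization.isNoetherianRing (Submonoid.powers r) Rr inferInstance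
  let F := FractionRing Rr
  letI : Algebra F L := FractionRing.liftAlgebra Rr L
  have : IsScalarTower Rr F L := FractionRing.isScalarTower_liftAlgebra Rr L
  have : Algebra.IsAlgebraic Rr L := Algebra.IsAlgebraic.extendScalars (R := R) (IsLocalization.injective Rr hrpow)
  have : Algebra.IsAlgebraic F L := Algebra.IsAlgebraic.extendScalars (R := Rr) (IsFractionRing.injective Rr F)
  have : Algebra.EssFiniteType Rr L := Algebra.EssFiniteType.of_comp R Rr L
  have : Algebra.EssFiniteType F L := Algebra.EssFiniteType.of_comp Rr F L
  have : FiniteDimensional F L := by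
    obtain ⟨u, hu⟩ := IntermediateField.fg_top F L
    have h1 := IntermediateField.finiteDimensional_adjoin (K := F) (S := (u : Set L)) (fun x _ => (Algebra.IsAlgebraic.isAlgebraic x).isIntegral)
    rw [hu] at h1
    exact Module.Finite.equiv (IntermediateField.topEquiv (F := F) (E := L)).toLinearEquiv
  have : CharZero F := (algebraMap F L).charZero
  exact IsIntegralClosure.finite Rr F L (integralClosure Rr L)

lemma exists_fg_closed_aux2 {R L : Type} [CommRing R] [IsDomain R] [IsIntegrallyClosed R] [IsNoetherianRing R]
    [Field L] [CharZero L] [Algebra R L] [FaithfulSMul R L] [Algebra.EssFiniteType R L] [Algebra.IsAlgebraic R L] 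
    (s : Finset L) : ∃ C : Subalgebra R L, Algebra.FiniteType R C ∧ (s : Set L) ⊆ C ∧ ∀ x : L, IsIntegral C x → x ∈ C := by
  obtain ⟨r, hr0, hr⟩ := Algebra.IsAlgebraic.exists_integral_multiples R s
  let Rr := Localization.Away r
  have hrpow : Submonoid.powers r ≤ nonZeroDivisors R := powers_le_nonZeroDivisors_of_noZeroDivisors hr0
  have : IsDomain Rr := IsLocalization.isDomain_localization hrpow
  have hru : IsUnit (algebraMap R L r) := by
    rw [isUnit_iff_ne_zero]; simpa using hr0
  let g1 : Rr →+* L := IsLocalization.Away.lift r hru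
  algebraize [g1]
  have : IsScalarTower R Rr L := IsScalarTower.of_algebraMap_eq fun x => (IsLocalization.Away.lift_eq r hru x).symm
  have hg1i : Function.Injective (algebraMap Rr L) := by
    change Function.Injective g1
    rw [injective_iff_map_eq_zero]
    intro a ha
    obtain ⟨x, y, rfl⟩ := IsLocalization.exists_mk'_eq (Submonoid.powers r) a
    have h1 : g1 (algebraMap R Rr x) = 0 := by
      rw [← IsLocalization.mk'_spec Rr x y, map_mul, ha, zero_mul]
    have h2 : algebraMap R L x = 0 := by
      rw [← h1]; exact (IsLocalization.Away.lift_eq r hru x).symm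
    have h3 : x = 0 := by simpa using h2
    simp [h3]
  have : FaithfulSMul Rr L := (faithfulSMul_iff_algebraMap_injective Rr L).mpr hg1i
  have hfin := exists_fg_closed_aux1 (L := L) (Rr := Rr) r hr0
  refine ⟨(integralClosure Rr L).restrictScalars R, ?_, ?_, ?_⟩
  · have : Algebra.FiniteType Rr (integralClosure Rr L) := inferInstance
    have h2 : Algebra.FiniteType R Rr := IsLocalization.finiteType_of_monoid_fg (Submonoid.powers r) Rr
    have h5 : Algebra.FiniteType R (integralClosure Rr L) := h2.trans this
    exact h5
  · intro x hx
    change IsIntegral Rr x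
    have h1 : IsIntegral Rr (r • x) := (hr x hx).tower_top
    have h2 : x = (IsLocalization.Away.invSelf r : Rr) • (r • x) := by
      rw [← algebraMap_smul Rr r x, smul_smul, mul_comm, IsLocalization.Away.mul_invSelf, one_smul]
    rw [h2]
    exact h1.smul _
  · intro x hx
    change IsIntegral Rr x
    exact isIntegral_trans (A := integralClosure Rr L) x hx

lemma exists_fg_closed {L : Type} [Field L] [CharZero L] [Algebra.EssFiniteType ℤ L] (s : Finset L) :
    ∃ C : Subring L, Algebra.FiniteType ℤ C ∧ (s : Set L) ⊆ C ∧ ∀ x : L, IsIntegral C x → x ∈ C := by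
  classical
  obtain ⟨S0, M, hS0, hM⟩ := (Algebra.essFiniteType_iff_exists_subalgebra (R := ℤ) (S := L)).mp inferInstance
  obtain ⟨g, hg⟩ := (S0.fg_iff_finiteType).mpr hS0
  have halg : Algebra.IsAlgebraic (Algebra.adjoin ℤ (g : Set L)) L := by
    rw [hg]; exact hM.isAlgebraic
  obtain ⟨t, htg, htb⟩ := exists_isTranscendenceBasis_subset (R := ℤ) (A := L) (g : Set L)
  have htf : Finite t := (g.finite_toSet.subset htg)
  have hta := htb.isAlgebraic
  have e := htb.1.aevalEquiv
  set R := Algebra.adjoin ℤ (Set.range ((↑) : t → L)) with hR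
  have : IsIntegrallyClosed R := IsIntegrallyClosed.of_equiv e.toRingEquiv
  have hRft : Algebra.FiniteType ℤ R := Algebra.FiniteType.equiv inferInstance e
  have : IsNoetherianRing R := Algebra.FiniteType.isNoetherianRing ℤ R
  have : Algebra.EssFiniteType R L := Algebra.EssFiniteType.of_comp ℤ R L
  obtain ⟨C, h1, h2, h3⟩ := exists_fg_closed_aux2 (R := R) s
  have h5 : Algebra.FiniteType ℤ C := hRft.trans h1
  exact ⟨C.toSubring, h5, h2, h3⟩

lemma exists_lift {K L k : Type} [Field K] [Field L] [Field k] [IsAlgClosed k] (j : K →+* L) (hj : j.Finite) (i : K →+* k) :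
    ∃ σ : L →+* k, ∀ x, σ (j x) = i x := by
  algebraize [j, i]
  have : Module.Finite K L := hj
  exact ⟨(IsAlgClosed.lift : L →ₐ[K] k).toRingHom, fun x => AlgHom.commutes _ x⟩

theorem hermite_final {k : Type} [Field k] [IsAlgClosed k] [CharZero k] (A : Subring k) (hA : Algebra.FiniteType ℤ A) (d : ℕ) :
    ∃ C : Subring k, Algebra.FiniteType ℤ C ∧ A ≤ C ∧ ∀ (D : Type) [CommRing D] [Algebra A D], EtCov A D d →
      ∃ φ : D →+* k, φ.comp (algebraMap A D) = A.subtype ∧ ∀ x, φ x ∈ C := by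
  classical
  obtain ⟨s, hs⟩ := hA.out
  let s' : Finset k := s.image A.subtype
  let K := adjoin ℚ (s' : Set k)
  have hAK : ∀ a : A, (a : k) ∈ K := by
    intro a
    have ha : a ∈ Algebra.adjoin ℤ (s : Set A) := by rw [hs]; trivial
    induction ha using Algebra.adjoin_induction with
    | mem x hx => exact subset_adjoin _ _ (Finset.mem_coe.mpr (Finset.mem_image_of_mem A.subtype hx))
    | algebraMap r => simp
    | add x y _ _ hx hy => exact add_mem hx hy
    | mul x y _ _ hx hy => exact mul_mem hx hy
  obtain ⟨hK, -⟩ := hermite_adjoin s'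
  let ι : A →+* K := A.subtype.codRestrict K.toSubring hAK
  obtain ⟨L, _, j, hj, H⟩ := hK A hA ι d
  algebraize [j]
  have : Module.Finite K L := hj
  have : CharZero L := charZero_of_injective_ringHom j.injective
  have : Algebra.EssFiniteType ℤ ℚ := Algebra.EssFiniteType.of_isLocalization _ (nonZeroDivisors ℤ)
  have : Algebra.EssFiniteType ℚ K := IntermediateField.essFiniteType_iff.mpr (fg_adjoin_finset s')
  have : Algebra.EssFiniteType ℤ K := Algebra.EssFiniteType.comp ℤ ℚ K
  have : Algebra.EssFiniteType ℤ L := Algebra.EssFiniteType.comp ℤ K L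
  obtain ⟨C, hC1, hC2, hC3⟩ := exists_fg_closed (L := L) ((s.image (j.comp ι)))
  have hAC : ∀ a : A, j (ι a) ∈ C := by
    intro a
    have ha : a ∈ Algebra.adjoin ℤ (s : Set A) := by rw [hs]; trivial
    induction ha using Algebra.adjoin_induction with
    | mem x hx => exact hC2 (Finset.mem_coe.mpr (Finset.mem_image_of_mem (j.comp ι) hx))
    | algebraMap r => simp
    | add x y _ _ hx hy => rw [map_add, map_add]; exact add_mem hx hy
    | mul x y _ _ hx hy => rw [map_mul, map_mul]; exact mul_mem hx hy
  obtain ⟨σ, hσ⟩ := exists_lift j hj K.val.toRingHom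
  refine ⟨C.map σ, ?_, ?_, ?_⟩
  · let e : C →+* C.map σ := σ.restrict C (C.map σ) (fun x hx => ⟨x, hx, rfl⟩)
    refine Algebra.FiniteType.of_surjective e.toIntAlgHom ?_
    rintro ⟨_, x, hx, rfl⟩
    exact ⟨⟨x, hx⟩, rfl⟩
  · intro a ha
    exact ⟨j (ι ⟨a, ha⟩), hAC _, hσ (ι ⟨a, ha⟩)⟩
  · intro D _ _ hD
    obtain ⟨φ, hφ⟩ := H D hD
    refine ⟨σ.comp φ, ?_, ?_⟩
    · rw [RingHom.comp_assoc, hφ]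
      ext a
      exact hσ (ι a)
    · intro x
      refine ⟨φ x, hC3 _ ?_, rfl⟩
      have := hD.fin
      have hx : IsIntegral A x := Algebra.IsIntegral.isIntegral x
      let ι' : A →+* C := (j.comp ι).codRestrict C hAC
      exact hx.map_of_comp_eq ι' φ (by rw [hφ]; rfl)

end FG1

end CW

namespace CW

section Lim

variable (A k : Type) [CommRing A] [CommRing k] [Algebra A k]

/-- Finitely generated subalgebras. -/
abbrev FGS := {B : Subalgebra A k // B.FG}

instance : IsDirectedOrder (FGS A k) := ⟨fun a b => ⟨⟨a.1 ⊔ b.1, a.2.sup b.2⟩, le_sup_left (a := a.1), le_sup_right (a := a.1)⟩⟩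

instance : Nonempty (FGS A k) := ⟨⟨⊥, Subalgebra.fg_bot⟩⟩

/-- the diagram of finitely generated subalgebras -/
def fgsFunctor : FGS A k ⥤ CommRingCat.{0} where
  obj B := CommRingCat.of B.1
  map {B C} h := CommRingCat.ofHom (Subalgebra.inclusion (leOfHom h)).toRingHom
  map_id B := by ext x; rfl
  map_comp f g := by ext x; rfl

/-- the cocone -/
def fgsCocone : Cocone (fgsFunctor A k) where
  pt := CommRingCat.of k
  ι := { app := fun B => CommRingCat.ofHom B.1.val.toRingHom
         naturality := fun B C h => by ext x; rfl }

lemma fgs_mem (x : k) : ∃ B : FGS A k, x ∈ B.1 :=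
  ⟨⟨Algebra.adjoin A {x}, Subalgebra.fg_adjoin_finset {x} |> fun h => by simpa using h⟩, Algebra.subset_adjoin rfl⟩

lemma fgs_compat (s : Cocone (fgsFunctor A k)) (B C : FGS A k) (x : k) (hB : x ∈ B.1) (hC : x ∈ C.1) :
    (s.ι.app B).hom ⟨x, hB⟩ = (s.ι.app C).hom ⟨x, hC⟩ := by
  obtain ⟨E, h1, h2⟩ := exists_ge_ge B C
  have e1 := s.w (homOfLE h1)
  have e2 := s.w (homOfLE h2)
  rw [← e1, ← e2]
  rfl

/-- colimit property -/
def fgsIsColimit : IsColimit (fgsCocone A k) where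
  desc s := CommRingCat.ofHom
    { toFun := fun x => (s.ι.app (fgs_mem A k x).choose).hom ⟨x, (fgs_mem A k x).choose_spec⟩
      map_one' := by
        rw [fgs_compat A k s _ (fgs_mem A k 1).choose 1 _ (one_mem _)]
        exact map_one _
      map_zero' := by
        rw [fgs_compat A k s _ (fgs_mem A k 1).choose 0 _ (zero_mem _)]
        exact map_zero _
      map_mul' := by
        intro x y
        obtain ⟨E, h1, h2⟩ := exists_ge_ge (fgs_mem A k x).choose (fgs_mem A k y).choose
        have hx := h1 (fgs_mem A k x).choose_spec
        have hy := h2 (fgs_mem A k y).choose_spec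
        rw [fgs_compat A k s _ E x _ hx, fgs_compat A k s _ E y _ hy, fgs_compat A k s _ E (x * y) _ (mul_mem hx hy)]
        exact map_mul (s.ι.app E).hom ⟨x, hx⟩ ⟨y, hy⟩
      map_add' := by
        intro x y
        obtain ⟨E, h1, h2⟩ := exists_ge_ge (fgs_mem A k x).choose (fgs_mem A k y).choose
        have hx := h1 (fgs_mem A k x).choose_spec
        have hy := h2 (fgs_mem A k y).choose_spec
        rw [fgs_compat A k s _ E x _ hx, fgs_compat A k s _ E y _ hy, fgs_compat A k s _ E (x + y) _ (add_mem hx hy)]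
        exact map_add (s.ι.app E).hom ⟨x, hx⟩ ⟨y, hy⟩ }
  fac s B := by
    ext x
    exact fgs_compat A k s _ B x.1 _ x.2
  uniq s m hm := by
    ext x
    change _ = (s.ι.app (fgs_mem A k x).choose).hom ⟨x, (fgs_mem A k x).choose_spec⟩
    rw [← hm]
    rfl

/-- `Spec` of the inclusion. -/
abbrev sB (B : FGS A k) : Spec (CommRingCat.of B.1) ⟶ Spec (CommRingCat.of A) :=
  Spec.map (CommRingCat.ofHom (algebraMap A B.1))

/-- `Spec` of the structure map. -/
abbrev sK : Spec (CommRingCat.of k) ⟶ Spec (CommRingCat.of A) :=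
  Spec.map (CommRingCat.ofHom (algebraMap A k))

/-- `Spec` of the inclusion into `k`. -/
abbrev tB (B : FGS A k) : Spec (CommRingCat.of k) ⟶ Spec (CommRingCat.of B.1) :=
  Spec.map (CommRingCat.ofHom B.1.val.toRingHom)

lemma tB_sB (B : FGS A k) : tB A k B ≫ sB A k B = sK A k := by
  rw [← Spec.map_comp]; rfl

/-- transition -/
abbrev tr {B C : FGS A k} (h : B ≤ C) : Spec (CommRingCat.of C.1) ⟶ Spec (CommRingCat.of B.1) :=
  Spec.map (CommRingCat.ofHom (Subalgebra.inclusion h).toRingHom)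

lemma tr_sB {B C : FGS A k} (h : B ≤ C) : tr A k h ≫ sB A k B = sB A k C := by
  rw [← Spec.map_comp]; rfl


lemma tr_refl (B : FGS A k) (h : B ≤ B) : tr A k h = 𝟙 _ := by
  rw [← Spec.map_id]; rfl

lemma tr_trans {B C D : FGS A k} (h : B ≤ C) (h' : C ≤ D) (h'' : B ≤ D) : tr A k h' ≫ tr A k h = tr A k h'' := by
  rw [← Spec.map_comp]; rfl

lemma tB_tr {B C : FGS A k} (h : B ≤ C) : tB A k C ≫ tr A k h = tB A k B := by
  rw [← Spec.map_comp]; rfl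

variable {A k}

variable {V T : Scheme.{0}} (v : V ⟶ Spec (CommRingCat.of A))

/-- base change to a finitely generated subalgebra -/
abbrev bc (B : FGS A k) : Scheme.{0} := pullback v (sB A k B)

/-- transition map of base changes -/
def bcTr {B C : FGS A k} (h : B ≤ C) : bc v C ⟶ bc v B :=
  pullback.lift (pullback.fst _ _) (pullback.snd _ _ ≫ tr A k h)
    (by rw [Category.assoc, tr_sB, pullback.condition])

lemma bcTr_fst {B C : FGS A k} (h : B ≤ C) : bcTr v h ≫ pullback.fst v (sB A k B) = pullback.fst v (sB A k C) :=
  pullback.lift_fst _ _ _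

lemma bcTr_fst_assoc {B C : FGS A k} (h : B ≤ C) {Q : Scheme.{0}} (r : V ⟶ Q) : bcTr v h ≫ pullback.fst v (sB A k B) ≫ r = pullback.fst v (sB A k C) ≫ r := by
  rw [← Category.assoc, bcTr_fst]

lemma bcTr_snd {B C : FGS A k} (h : B ≤ C) : bcTr v h ≫ pullback.snd v (sB A k B) = pullback.snd v (sB A k C) ≫ tr A k h :=
  pullback.lift_snd _ _ _

lemma bcTr_snd_assoc {B C : FGS A k} (h : B ≤ C) {Q : Scheme.{0}} (r : Spec (CommRingCat.of B.1) ⟶ Q) : bcTr v h ≫ pullback.snd v (sB A k B) ≫ r = pullback.snd v (sB A k C) ≫ tr A k h ≫ r := by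
  rw [← Category.assoc, bcTr_snd, Category.assoc]

lemma bcTr_refl (B : FGS A k) (h : B ≤ B) : bcTr v h = 𝟙 _ := by
  apply pullback.hom_ext
  · rw [bcTr_fst, Category.id_comp]
  · rw [bcTr_snd, Category.id_comp, tr_refl, Category.comp_id]

lemma bcTr_trans {B C D : FGS A k} (h : B ≤ C) (h' : C ≤ D) (h'' : B ≤ D) : bcTr v h' ≫ bcTr v h = bcTr v h'' := by
  apply pullback.hom_ext
  · rw [Category.assoc, bcTr_fst, bcTr_fst, bcTr_fst]
  · rw [Category.assoc, bcTr_snd, bcTr_snd_assoc, bcTr_snd, tr_trans]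

lemma bcTr_isPullback {B C : FGS A k} (h : B ≤ C) :
    IsPullback (bcTr v h) (pullback.snd v (sB A k C)) (pullback.snd v (sB A k B)) (tr A k h) := by
  refine IsPullback.of_right (t := IsPullback.of_hasPullback v (sB A k B)) ?_ (bcTr_snd v h) |>.flip.flip
  rw [bcTr_fst, tr_sB]
  exact IsPullback.of_hasPullback v (sB A k C)

instance {B C : FGS A k} (h : B ≤ C) : IsAffineHom (bcTr v h) :=
  MorphismProperty.of_isPullback (P := @IsAffineHom) (bcTr_isPullback v h).flip inferInstance

/-- the diagram of base changes -/
def bcFunctor : (FGS A k)ᵒᵖ ⥤ Scheme.{0} where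
  obj B := bc v B.unop
  map {B C} h := bcTr v (leOfHom h.unop)
  map_id B := bcTr_refl v _ _
  map_comp f g := (bcTr_trans v _ _ _).symm

/-- the comparison map -/
def bcMap {a : T ⟶ V} {b : T ⟶ Spec (CommRingCat.of k)} (h : a ≫ v = b ≫ sK A k) (B : FGS A k) :
    T ⟶ bc v B :=
  pullback.lift a (b ≫ tB A k B) (by rw [Category.assoc, tB_sB, h])

section

variable {a : T ⟶ V} {b : T ⟶ Spec (CommRingCat.of k)}

lemma bcMap_fst (h : a ≫ v = b ≫ sK A k) (B : FGS A k) : bcMap v h B ≫ pullback.fst v (sB A k B) = a :=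
  pullback.lift_fst _ _ _

lemma bcMap_fst_assoc (h : a ≫ v = b ≫ sK A k) (B : FGS A k) {Q : Scheme.{0}} (r : V ⟶ Q) : bcMap v h B ≫ pullback.fst v (sB A k B) ≫ r = a ≫ r := by
  rw [← Category.assoc, bcMap_fst]

lemma bcMap_snd (h : a ≫ v = b ≫ sK A k) (B : FGS A k) : bcMap v h B ≫ pullback.snd v (sB A k B) = b ≫ tB A k B :=
  pullback.lift_snd _ _ _

lemma bcMap_snd_assoc (h : a ≫ v = b ≫ sK A k) (B : FGS A k) {Q : Scheme.{0}} (r : Spec (CommRingCat.of B.1) ⟶ Q) : bcMap v h B ≫ pullback.snd v (sB A k B) ≫ r = b ≫ tB A k B ≫ r := by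
  rw [← Category.assoc, bcMap_snd, Category.assoc]

lemma bcMap_bcTr (h : a ≫ v = b ≫ sK A k) {B C : FGS A k} (hBC : B ≤ C) : bcMap v h C ≫ bcTr v hBC = bcMap v h B := by
  apply pullback.hom_ext
  · rw [Category.assoc, bcTr_fst, bcMap_fst, bcMap_fst]
  · rw [Category.assoc, bcTr_snd, bcMap_snd_assoc, bcMap_snd, tB_tr]

lemma bcMap_bcTr_assoc (h : a ≫ v = b ≫ sK A k) {B C : FGS A k} (hBC : B ≤ C) {Q : Scheme.{0}} (r : bc v B ⟶ Q) : bcMap v h C ≫ bcTr v hBC ≫ r = bcMap v h B ≫ r := by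
  rw [← Category.assoc, bcMap_bcTr]

lemma bcMap_isPullback (h : IsPullback a b v (sK A k)) (B : FGS A k) :
    IsPullback (bcMap v h.w B) b (pullback.snd v (sB A k B)) (tB A k B) := by
  refine IsPullback.of_right (t := IsPullback.of_hasPullback v (sB A k B)) ?_ (bcMap_snd v h.w B)
  rw [bcMap_fst, tB_sB]
  exact h

/-- cone -/
def bcCone (h : a ≫ v = b ≫ sK A k) : Cone (bcFunctor (k := k) v) where
  pt := T
  π := { app := fun B => bcMap v h B.unop
         naturality := fun B C f => (Category.id_comp _).trans (bcMap_bcTr v h (leOfHom f.unop)).symm }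

/-- limit property -/
def bcIsLimit (h : IsPullback a b v (sK A k)) : IsLimit (bcCone v h.w) := by
  let hl : IsLimit (Scheme.Spec.mapCone (fgsCocone A k).op) := isLimitOfPreserves Scheme.Spec (fgsIsColimit A k).op
  let i0 : FGS A k := ⟨⊥, Subalgebra.fg_bot⟩
  have hi0 : ∀ B, i0 ≤ B := fun B => (bot_le : (⊥ : Subalgebra A k) ≤ B.1)
  let p (s : Cone (bcFunctor (k := k) v)) (B : FGS A k) : s.pt ⟶ bc v B := s.π.app (Opposite.op B)
  have hp : ∀ s {B C : FGS A k} (h : B ≤ C), p s C ≫ bcTr v h = p s B := fun s B C h => s.w (homOfLE h).op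
  let cn (s : Cone (bcFunctor (k := k) v)) : Cone ((fgsFunctor A k).op ⋙ Scheme.Spec) :=
    { pt := s.pt
      π := { app := fun B => p s B.unop ≫ pullback.snd v (sB A k B.unop)
             naturality := fun B C f => by
              have h1 : p s C.unop ≫ pullback.snd v (sB A k C.unop) = (p s B.unop ≫ pullback.snd v (sB A k B.unop)) ≫ tr A k (leOfHom f.unop) := by
                rw [← hp s (leOfHom f.unop), Category.assoc, bcTr_snd, Category.assoc]
              exact (Category.id_comp _).trans h1 } }
  have hfst : ∀ (s : Cone (bcFunctor (k := k) v)) (B : FGS A k), p s B ≫ pullback.fst v (sB A k B) =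
      p s i0 ≫ pullback.fst v (sB A k i0) := by
    intro s B
    rw [← hp s (hi0 B), Category.assoc, bcTr_fst]
  let L (s : Cone (bcFunctor (k := k) v)) : s.pt ⟶ Spec (CommRingCat.of k) := hl.lift (cn s)
  have hsnd : ∀ (s : Cone (bcFunctor (k := k) v)) (B : FGS A k), L s ≫ tB A k B = p s B ≫ pullback.snd v (sB A k B) := 
    fun s B => hl.fac (cn s) (Opposite.op B)
  have hcond : ∀ (s : Cone (bcFunctor (k := k) v)), (p s i0 ≫ pullback.fst v (sB A k i0)) ≫ v = L s ≫ sK A k := by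
    intro s
    rw [← tB_sB A k i0, ← Category.assoc (L s), hsnd, Category.assoc, pullback.condition, Category.assoc]
  refine ⟨fun s => h.lift _ _ (hcond s), ?_, ?_⟩
  · intro s B
    change h.lift _ _ (hcond s) ≫ bcMap v h.w B.unop = p s B.unop
    apply pullback.hom_ext
    · rw [Category.assoc, bcMap_fst, h.lift_fst]
      exact (hfst s B.unop).symm
    · rw [Category.assoc, bcMap_snd, h.lift_snd_assoc]
      exact hsnd s B.unop
  · intro s m hm
    obtain ⟨m', rfl⟩ : ∃ m' : s.pt ⟶ T, m' = m := ⟨m, rfl⟩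
    replace hm : ∀ B : FGS A k, m' ≫ bcMap v h.w B = p s B := fun B => hm (Opposite.op B)
    apply h.hom_ext
    · rw [h.lift_fst, ← hm, Category.assoc, bcMap_fst]
    · rw [h.lift_snd]
      refine hl.hom_ext fun B => ?_
      change (m' ≫ b) ≫ tB A k B.unop = L s ≫ tB A k B.unop
      rw [hsnd, ← hm, Category.assoc, Category.assoc, bcMap_snd]

/-- descent of morphisms -/
theorem hom_descent [CompactSpace V] [QuasiSeparatedSpace V] (h : IsPullback a b v (sK A k))
    {W S : Scheme.{0}} (f : W ⟶ S) [LocallyOfFinitePresentation f] (s : V ⟶ S) (t : T ⟶ W)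
    (ht : t ≫ f = a ≫ s) :
    ∃ (B : FGS A k) (w : bc v B ⟶ W), bcMap v h.w B ≫ w = t ∧ w ≫ f = pullback.fst v (sB A k B) ≫ s := by
  haveI : IsCofiltered (FGS A k)ᵒᵖ := inferInstance
  haveI : ∀ {i j} (f : i ⟶ j), IsAffineHom ((bcFunctor (k := k) v).map f) := fun f => by
    change IsAffineHom (bcTr v _); infer_instance
  have hcs : ∀ i : FGS A k, CompactSpace (bc v i) := fun i => QuasiCompact.compactSpace_of_compactSpace (pullback.fst v (sB A k i))
  have hqq : ∀ i : FGS A k, QuasiSeparatedSpace (bc v i) := fun i => quasiSeparatedSpace_of_quasiSeparated (pullback.fst v (sB A k i))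
  haveI : ∀ i, CompactSpace ((bcFunctor (k := k) v).obj i) := fun i =>
    hcs i.unop
  haveI : ∀ i, QuasiSeparatedSpace ((bcFunctor (k := k) v).obj i) := fun i =>
    hqq i.unop
  let τ : bcFunctor (k := k) v ⟶ (Functor.const _).obj S :=
    { app := fun B => pullback.fst v (sB A k B.unop) ≫ s
      naturality := fun B C g => by
        change bcTr v _ ≫ pullback.fst v (sB A k C.unop) ≫ s = (pullback.fst v (sB A k B.unop) ≫ s) ≫ 𝟙 _
        rw [bcTr_fst_assoc, Category.comp_id] }
  obtain ⟨i, g, h1, h2⟩ := Scheme.exists_π_app_comp_eq_of_locallyOfFinitePresentation (bcFunctor v) τ f (bcCone v h.w) (bcIsLimit v h) t (by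
    ext1; ext1 B
    change bcMap v h.w B.unop ≫ pullback.fst v (sB A k B.unop) ≫ s = t ≫ f
    rw [bcMap_fst_assoc, ht])
  exact ⟨i.unop, g, h1, h2⟩

theorem hom_descent_unique [CompactSpace V] (h : IsPullback a b v (sK A k))
    {W S : Scheme.{0}} (f : W ⟶ S) [LocallyOfFiniteType f] (s : V ⟶ S) {B : FGS A k} (w w' : bc v B ⟶ W)
    (e : w ≫ f = pullback.fst v (sB A k B) ≫ s) (e' : w' ≫ f = pullback.fst v (sB A k B) ≫ s)
    (hh : bcMap v h.w B ≫ w = bcMap v h.w B ≫ w') :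
    ∃ (C : FGS A k) (hBC : B ≤ C), bcTr v hBC ≫ w = bcTr v hBC ≫ w' := by
  haveI : IsCofiltered (FGS A k)ᵒᵖ := inferInstance
  haveI : ∀ {i j} (f : i ⟶ j), IsAffineHom ((bcFunctor (k := k) v).map f) := fun f => by
    change IsAffineHom (bcTr v _); infer_instance
  have hcs : ∀ i : FGS A k, CompactSpace (bc v i) := fun i => QuasiCompact.compactSpace_of_compactSpace (pullback.fst v (sB A k i))
  haveI : ∀ i, CompactSpace ((bcFunctor (k := k) v).obj i) := fun i =>
    hcs i.unop
  let τ : bcFunctor (k := k) v ⟶ (Functor.const _).obj S :=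
    { app := fun B => pullback.fst v (sB A k B.unop) ≫ s
      naturality := fun B C g => by
        change bcTr v _ ≫ pullback.fst v (sB A k C.unop) ≫ s = (pullback.fst v (sB A k B.unop) ≫ s) ≫ 𝟙 _
        rw [bcTr_fst_assoc, Category.comp_id] }
  obtain ⟨i, g, h1⟩ := Scheme.exists_hom_comp_eq_comp_of_locallyOfFiniteType (bcFunctor v) τ f (bcCone v h.w) (bcIsLimit v h)
    (i := Opposite.op B) w w' e.symm e'.symm hh
  exact ⟨i.unop, leOfHom g.unop, h1⟩

end

end Lim

end CW

namespace CW

section Glue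

variable {V V1 V2 V12 : Scheme.{0}} {j1 : V1 ⟶ V} {j2 : V2 ⟶ V} 
  {p1 : V12 ⟶ V1} {p2 : V12 ⟶ V2}

/-- the cocone leg -/
def spanLeg (hw : p1 ≫ j1 = p2 ≫ j2) : ∀ i : WalkingSpan, (span p1 p2).obj i ⟶ V
  | none => p1 ≫ j1
  | some WalkingPair.left => j1
  | some WalkingPair.right => j2

lemma spanLeg_w (hw : p1 ≫ j1 = p2 ≫ j2) {i j : WalkingSpan} (f : i ⟶ j) :
    (span p1 p2).map f ≫ spanLeg hw j = spanLeg hw i := by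
  rcases f with _ | (_ | _)
  · exact (congrArg (· ≫ _) ((span p1 p2).map_id _)).trans (Category.id_comp _)
  · rfl
  · exact hw.symm

lemma spanLeg_open [IsOpenImmersion j1] [IsOpenImmersion j2] (h : IsPullback p1 p2 j1 j2) (i : WalkingSpan) :
    IsOpenImmersion (spanLeg h.w i) := by
  haveI : IsOpenImmersion p1 := MorphismProperty.of_isPullback (P := @IsOpenImmersion) h.flip ‹_›
  rcases i with _ | (_ | _)
  · change IsOpenImmersion (p1 ≫ j1); infer_instance
  · change IsOpenImmersion j1; infer_instance
  · change IsOpenImmersion j2; infer_instance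

/-- two-element cover together with the intersection -/
def spanCover [IsOpenImmersion j1] [IsOpenImmersion j2] (h : IsPullback p1 p2 j1 j2)
    (hc : ∀ x : V, x ∈ Set.range j1 ∨ x ∈ Set.range j2) : V.OpenCover where
  I₀ := WalkingSpan
  X := (span p1 p2).obj
  f := spanLeg h.w
  mem₀ := by
    rw [Scheme.presieve₀_mem_precoverage_iff]
    refine ⟨fun x => ?_, spanLeg_open h⟩
    rcases hc x with h | h
    · exact ⟨WalkingSpan.left, h⟩
    · exact ⟨WalkingSpan.right, h⟩

section

variable [IsOpenImmersion j1] [IsOpenImmersion j2] (h : IsPullback p1 p2 j1 j2)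
    (hc : ∀ x : V, x ∈ Set.range j1 ∨ x ∈ Set.range j2)

instance : Category (spanCover h hc).I₀ := inferInstanceAs (Category WalkingSpan)

instance : Quiver.IsThin (spanCover h hc).I₀ := inferInstanceAs (Quiver.IsThin WalkingSpan)

instance : Small.{0} (spanCover h hc).I₀ := inferInstanceAs (Small.{0} WalkingSpan)

lemma surj_aux {P Q S : Scheme.{0}} (f : P ⟶ S) (g : Q ⟶ S) [Mono g] (t : P ⟶ Q) (w : t ≫ g = f)
    (x : (pullback f g : Scheme.{0})) : ∃ y, pullback.lift (𝟙 P) t (by rw [w, Category.id_comp]) y = x := by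
  refine ⟨pullback.fst f g x, ?_⟩
  rw [← Scheme.Hom.comp_apply]
  have : pullback.fst f g ≫ pullback.lift (𝟙 P) t (by rw [w, Category.id_comp]) = 𝟙 _ := by
    rw [← cancel_mono (pullback.fst f g), Category.assoc, pullback.lift_fst, Category.comp_id, Category.id_comp]
  rw [this]; rfl

lemma surj_aux' {P Q S : Scheme.{0}} (f : P ⟶ S) (g : Q ⟶ S) [Mono f] (t : Q ⟶ P) (w : t ≫ f = g)
    (x : (pullback f g : Scheme.{0})) : ∃ y, pullback.lift t (𝟙 Q) (by rw [w, Category.id_comp]) y = x := by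
  refine ⟨pullback.snd f g x, ?_⟩
  rw [← Scheme.Hom.comp_apply]
  have : pullback.snd f g ≫ pullback.lift t (𝟙 Q) (by rw [w, Category.id_comp]) = 𝟙 _ := by
    rw [← cancel_mono (pullback.snd f g), Category.assoc, pullback.lift_snd, Category.comp_id, Category.id_comp]
  rw [this]; rfl

lemma surj_pb {P Q S R : Scheme.{0}} {a : R ⟶ P} {b : R ⟶ Q} {f : P ⟶ S} {g : Q ⟶ S} (h : IsPullback a b f g)
    (x : (pullback f g : Scheme.{0})) : ∃ y, pullback.lift a b h.w y = x := by
  refine ⟨h.isoPullback.inv x, ?_⟩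
  have : pullback.lift a b h.w = h.isoPullback.hom := by
    apply pullback.hom_ext
    · rw [pullback.lift_fst, h.isoPullback_hom_fst]
    · rw [pullback.lift_snd, h.isoPullback_hom_snd]
  rw [this, ← Scheme.Hom.comp_apply, Iso.inv_hom_id]
  rfl

lemma span_dir (i j : WalkingSpan) (x : (pullback (spanLeg h.w i) (spanLeg h.w j) : Scheme.{0})) :
    ∃ (k : WalkingSpan) (hki : k ⟶ i) (hkj : k ⟶ j) (y : ((span p1 p2).obj k : Scheme.{0})),
      pullback.lift ((span p1 p2).map hki) ((span p1 p2).map hkj) (by rw [spanLeg_w, spanLeg_w]) y = x := by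
  have hm : ∀ i, Mono (spanLeg h.w i) := fun i => by
    have := spanLeg_open h i
    infer_instance
  have key1 : ∀ {i j : WalkingSpan} (f : i ⟶ j) (x : (pullback (spanLeg h.w i) (spanLeg h.w j) : Scheme.{0})),
    ∃ (k : WalkingSpan) (hki : k ⟶ i) (hkj : k ⟶ j) (y : ((span p1 p2).obj k : Scheme.{0})),
      pullback.lift ((span p1 p2).map hki) ((span p1 p2).map hkj) (by rw [spanLeg_w, spanLeg_w]) y = x := by
    intro i j f x
    obtain ⟨y, hy⟩ := surj_aux _ _ ((span p1 p2).map f) (spanLeg_w h.w f) x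
    refine ⟨i, 𝟙 _, f, y, ?_⟩
    simp only [Functor.map_id]
    exact hy
  have key2 : ∀ {i j : WalkingSpan} (f : j ⟶ i) (x : (pullback (spanLeg h.w i) (spanLeg h.w j) : Scheme.{0})),
    ∃ (k : WalkingSpan) (hki : k ⟶ i) (hkj : k ⟶ j) (y : ((span p1 p2).obj k : Scheme.{0})),
      pullback.lift ((span p1 p2).map hki) ((span p1 p2).map hkj) (by rw [spanLeg_w, spanLeg_w]) y = x := by
    intro i j f x
    obtain ⟨y, hy⟩ := surj_aux' _ _ ((span p1 p2).map f) (spanLeg_w h.w f) x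
    refine ⟨j, f, 𝟙 _, y, ?_⟩
    simp only [Functor.map_id]
    exact hy
  rcases i with _ | (_ | _) <;> rcases j with _ | (_ | _)
  · exact key1 (𝟙 _) x
  · exact key1 WalkingSpan.Hom.fst x
  · exact key1 WalkingSpan.Hom.snd x
  · exact key2 WalkingSpan.Hom.fst x
  · exact key1 (𝟙 _) x
  · obtain ⟨y, hy⟩ := surj_pb h x
    exact ⟨WalkingSpan.zero, WalkingSpan.Hom.fst, WalkingSpan.Hom.snd, y, hy⟩
  · exact key2 WalkingSpan.Hom.snd x
  · obtain ⟨y, hy⟩ := surj_pb h.flip x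
    exact ⟨WalkingSpan.zero, WalkingSpan.Hom.snd, WalkingSpan.Hom.fst, y, hy⟩
  · exact key1 (𝟙 _) x

include h in
lemma span_open {i j : WalkingSpan} (f : i ⟶ j) : IsOpenImmersion ((span p1 p2).map f) := by
    have := spanLeg_open h i
    have := spanLeg_open h j
    have : IsOpenImmersion ((span p1 p2).map f ≫ spanLeg h.w j) := by
      rw [spanLeg_w]; assumption
    exact IsOpenImmersion.of_comp _ (spanLeg h.w j)

instance : (spanCover h hc).LocallyDirected where
  trans {i j} f := (span p1 p2).map f
  trans_id i := (span p1 p2).map_id i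
  trans_comp f g := (span p1 p2).map_comp f g
  w f := spanLeg_w h.w f
  directed {i j} x := span_dir h i j x
  property_trans {i j} f := span_open h f

end

variable {W1 W2 W12 : Scheme.{0}} {g1 : W1 ⟶ V1} {g2 : W2 ⟶ V2} {g12 : W12 ⟶ V12}
  {q1 : W12 ⟶ W1} {q2 : W12 ⟶ W2}

lemma rg_w {S : Scheme.{0}} {𝒰 : S.OpenCover} [Category 𝒰.I₀] [𝒰.LocallyDirected] [Small.{0} 𝒰.I₀] [Quiver.IsThin 𝒰.I₀]
    (d : 𝒰.RelativeGluingData) {i j : 𝒰.I₀} (f : i ⟶ j) : d.functor.map f ≫ colimit.ι d.functor j = colimit.ι d.functor i :=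
  colimit.w d.functor f

/-- gluing two schemes over a base. -/
theorem glue2 [IsOpenImmersion j1] [IsOpenImmersion j2] (h : IsPullback p1 p2 j1 j2)
    (hc : ∀ x : V, x ∈ Set.range j1 ∨ x ∈ Set.range j2)
    (h1 : IsPullback q1 g12 g1 p1) (h2 : IsPullback q2 g12 g2 p2) :
    ∃ (W : Scheme.{0}) (g : W ⟶ V) (r1 : W1 ⟶ W) (r2 : W2 ⟶ W), IsPullback r1 g1 g j1 ∧ IsPullback r2 g2 g j2 ∧ q1 ≫ r1 = q2 ≫ r2 := by
  let ap : ∀ i : WalkingSpan, (span q1 q2).obj i ⟶ (span p1 p2).obj i := fun i => match i with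
    | none => g12
    | some WalkingPair.left => g1
    | some WalkingPair.right => g2
  let nt : span q1 q2 ⟶ span p1 p2 :=
    { app := ap
      naturality := by
        rintro i j (_ | (_ | _))
        · exact (congrArg (· ≫ _) ((span q1 q2).map_id _)).trans ((Category.id_comp _).trans ((Category.comp_id _).symm.trans (congrArg (_ ≫ ·) ((span p1 p2).map_id _).symm)))
        · exact h1.w
        · exact h2.w }
  have hid : ∀ i : WalkingSpan, IsPullback ((span q1 q2).map (𝟙 i)) (ap i) (ap i) ((span p1 p2).map (𝟙 i)) := by
    intro i
    rw [CategoryTheory.Functor.map_id, CategoryTheory.Functor.map_id]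
    exact IsPullback.of_horiz_isIso ⟨by rw [Category.id_comp, Category.comp_id]⟩
  have heq : ∀ {i j : WalkingSpan} (f : i ⟶ j), IsPullback ((span q1 q2).map f) (ap i) (ap j) ((span p1 p2).map f) := by
    rintro i j (_ | (_ | _))
    · exact hid i
    · exact h1
    · exact h2
  let d : (spanCover h hc).RelativeGluingData :=
    { functor := span q1 q2
      natTrans := nt
      equifibered := fun {i j} f => heq f }
  have b1 := (d.isPullback_natTrans_ι_toBase WalkingSpan.left).flip
  have b2 := (d.isPullback_natTrans_ι_toBase WalkingSpan.right).flip
  have c := fun {i j : (spanCover h hc).I₀} (f : i ⟶ j) => rg_w d f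
  exact ⟨_, _, _, _, b1, b2, (c WalkingSpan.Hom.fst).trans (c WalkingSpan.Hom.snd).symm⟩

end Glue

end CW

namespace CW

section Glue

/-- two-element cover -/
def pairCover {V V1 V2 : Scheme.{0}} (j1 : V1 ⟶ V) (j2 : V2 ⟶ V) [IsOpenImmersion j1] [IsOpenImmersion j2]
    (hc : ∀ x : V, x ∈ Set.range j1 ∨ x ∈ Set.range j2) : V.OpenCover where
  I₀ := Bool
  X := fun b => match b with
    | false => V1
    | true => V2
  f := fun b => match b with
    | false => j1
    | true => j2
  mem₀ := by
    rw [Scheme.presieve₀_mem_precoverage_iff]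
    refine ⟨fun x => ?_, ?_⟩
    · rcases hc x with h | h
      · exact ⟨false, h⟩
      · exact ⟨true, h⟩
    · rintro (_ | _) <;> dsimp <;> infer_instance

lemma pb_transport {T T1 Z Z1 V W : Scheme.{0}} {k1 : T1 ⟶ T} {z : Z ⟶ T} {t : Z ⟶ W} {a : T ⟶ V} {g : W ⟶ V}
    {m1 : Z1 ⟶ Z} {z1 : Z1 ⟶ T1} (h : IsPullback m1 z1 z k1) (h' : IsPullback z1 (m1 ≫ t) (k1 ≫ a) g) :
    IsPullback (pullback.snd z k1) (pullback.fst z k1 ≫ t) (k1 ≫ a) g := by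
  refine IsPullback.of_iso h' h.isoPullback (Iso.refl _) (Iso.refl _) (Iso.refl _) ?_ ?_ ?_ ?_ <;> simp

lemma isPullback_two {T T1 T2 Z Z1 Z2 V W : Scheme.{0}} (k1 : T1 ⟶ T) (k2 : T2 ⟶ T) [IsOpenImmersion k1] [IsOpenImmersion k2]
    (hc : ∀ x : T, x ∈ Set.range k1 ∨ x ∈ Set.range k2) (z : Z ⟶ T) (t : Z ⟶ W) (a : T ⟶ V) (g : W ⟶ V)
    {m1 : Z1 ⟶ Z} {z1 : Z1 ⟶ T1} (h1 : IsPullback m1 z1 z k1) (h1' : IsPullback z1 (m1 ≫ t) (k1 ≫ a) g)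
    {m2 : Z2 ⟶ Z} {z2 : Z2 ⟶ T2} (h2 : IsPullback m2 z2 z k2) (h2' : IsPullback z2 (m2 ≫ t) (k2 ≫ a) g) :
    IsPullback z t a g := by
  refine Scheme.isPullback_of_openCover z t a g (pairCover k1 k2 hc) ?_
  rintro (_ | _)
  · exact pb_transport h1 h1'
  · exact pb_transport h2 h2'

lemma glue_hom2 {V V1 V2 V12 Y : Scheme.{0}} {j1 : V1 ⟶ V} {j2 : V2 ⟶ V} {p1 : V12 ⟶ V1} {p2 : V12 ⟶ V2}
    [IsOpenImmersion j1] [IsOpenImmersion j2] (h : IsPullback p1 p2 j1 j2)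
    (hc : ∀ x : V, x ∈ Set.range j1 ∨ x ∈ Set.range j2) (u1 : V1 ⟶ Y) (u2 : V2 ⟶ Y) (w : p1 ≫ u1 = p2 ≫ u2) :
    ∃ u : V ⟶ Y, j1 ≫ u = u1 ∧ j2 ≫ u = u2 := by
  let g : ∀ i : (spanCover h hc).I₀, (spanCover h hc).X i ⟶ Y := spanLeg w
  refine ⟨Scheme.OpenCover.glueMorphismsOfLocallyDirected (spanCover h hc) g (fun f => spanLeg_w w f), ?_, ?_⟩
  · exact Scheme.OpenCover.map_glueMorphismsOfLocallyDirected (spanCover h hc) g _ WalkingSpan.left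
  · exact Scheme.OpenCover.map_glueMorphismsOfLocallyDirected (spanCover h hc) g _ WalkingSpan.right

/-- finite étale -/
def FEt {W V : Scheme.{0}} (g : W ⟶ V) : Prop := IsFinite g ∧ Etale g

/-- existence of a model along `a` -/
def FMod {Z T V : Scheme.{0}} (a : T ⟶ V) (z : Z ⟶ T) : Prop :=
  ∃ (W : Scheme.{0}) (g : W ⟶ V) (t : Z ⟶ W), FEt g ∧ IsPullback t z g a

lemma FEt.of_isPullback {P Q R S : Scheme.{0}} {a : P ⟶ Q} {b : P ⟶ R} {f : Q ⟶ S} {g : R ⟶ S} (h : IsPullback a b f g) (hf : FEt f) : FEt b :=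
  ⟨MorphismProperty.of_isPullback (P := @IsFinite) h hf.1, MorphismProperty.of_isPullback (P := @Etale) h hf.2⟩

lemma FEt.two {V V1 V2 W W1 W2 : Scheme.{0}} (j1 : V1 ⟶ V) (j2 : V2 ⟶ V) [IsOpenImmersion j1] [IsOpenImmersion j2]
    (hc : ∀ x : V, x ∈ Set.range j1 ∨ x ∈ Set.range j2) {g : W ⟶ V} {g1 : W1 ⟶ V1} {g2 : W2 ⟶ V2} {r1 : W1 ⟶ W} {r2 : W2 ⟶ W}
    (h1 : IsPullback r1 g1 g j1) (h2 : IsPullback r2 g2 g j2) (e1 : FEt g1) (e2 : FEt g2) : FEt g := by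
  have i1 : FEt (pullback.snd g j1) := by
    rw [← h1.isoPullback_inv_snd]
    haveI := e1.1; haveI := e1.2
    exact ⟨inferInstance, inferInstance⟩
  have i2 : FEt (pullback.snd g j2) := by
    rw [← h2.isoPullback_inv_snd]
    haveI := e2.1; haveI := e2.2
    exact ⟨inferInstance, inferInstance⟩
  constructor
  · haveI : IsZariskiLocalAtTarget @IsFinite := (HasAffineProperty.iff.mp IsFinite.instHasAffinePropertyAndIsAffineFiniteCarrierObjOppositeOpensCarrierCarrierCommRingCatPresheafOpOpensTopHomAppTop).1
    refine IsZariskiLocalAtTarget.of_openCover (P := @IsFinite) (pairCover j1 j2 hc) ?_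
    rintro (_ | _)
    · exact i1.1
    · exact i2.1
  · haveI : IsZariskiLocalAtTarget @Etale := (HasAffineProperty.iff.mp (HasRingHomProperty.HasAffineProperty (Q := RingHom.Etale) @Etale)).1
    refine IsZariskiLocalAtTarget.of_openCover (P := @Etale) (pairCover j1 j2 hc) ?_
    rintro (_ | _)
    · exact i1.2
    · exact i2.2

lemma FMod.of_comp {Z T V V' : Scheme.{0}} (e : T ⟶ V') (c : V' ⟶ V) {a : T ⟶ V} (hec : e ≫ c = a) {z : Z ⟶ T} (h : FMod a z) : FMod e z := by
  obtain ⟨W, g, t, hg, hp⟩ := h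
  subst hec
  refine ⟨pullback g c, pullback.snd g c, pullback.lift t (z ≫ e) (by rw [hp.w, Category.assoc]), hg.of_isPullback (.of_hasPullback g c), ?_⟩
  refine IsPullback.of_right (h₁₂ := pullback.fst g c) (h₂₂ := c) (v₁₃ := g) ?_ (pullback.lift_snd _ _ _) (IsPullback.of_hasPullback g c)
  rw [pullback.lift_fst]
  exact hp

theorem glue_mod {V V1 V2 V12 W1 W2 W12 T T1 T2 Z Z1 Z2 Z12 : Scheme.{0}} {j1 : V1 ⟶ V} {j2 : V2 ⟶ V} 
    {p1 : V12 ⟶ V1} {p2 : V12 ⟶ V2} {g1 : W1 ⟶ V1} {g2 : W2 ⟶ V2} {g12 : W12 ⟶ V12}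
    {q1 : W12 ⟶ W1} {q2 : W12 ⟶ W2} [IsOpenImmersion j1] [IsOpenImmersion j2] (h : IsPullback p1 p2 j1 j2)
    (hc : ∀ x : V, x ∈ Set.range j1 ∨ x ∈ Set.range j2)
    (h1 : IsPullback q1 g12 g1 p1) (h2 : IsPullback q2 g12 g2 p2)
    (e1 : FEt g1) (e2 : FEt g2) (a : T ⟶ V) (z : Z ⟶ T)
    {k1 : T1 ⟶ T} {a1 : T1 ⟶ V1} (hT1 : IsPullback k1 a1 a j1)
    {k2 : T2 ⟶ T} {a2 : T2 ⟶ V2} (hT2 : IsPullback k2 a2 a j2)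
    {m1 : Z1 ⟶ Z} {z1 : Z1 ⟶ T1} (hZ1 : IsPullback m1 z1 z k1)
    {m2 : Z2 ⟶ Z} {z2 : Z2 ⟶ T2} (hZ2 : IsPullback m2 z2 z k2)
    {n1 : Z12 ⟶ Z1} {n2 : Z12 ⟶ Z2} (hZ12 : IsPullback n1 n2 m1 m2)
    {t1 : Z1 ⟶ W1} (ht1 : IsPullback t1 z1 g1 a1) {t2 : Z2 ⟶ W2} (ht2 : IsPullback t2 z2 g2 a2)
    (t12 : Z12 ⟶ W12) (w1 : t12 ≫ q1 = n1 ≫ t1) (w2 : t12 ≫ q2 = n2 ≫ t2) : FMod a z := by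
  obtain ⟨W, g, r1, r2, hr1, hr2, hw⟩ := glue2 h hc h1 h2
  haveI : IsOpenImmersion k1 := MorphismProperty.of_isPullback (P := @IsOpenImmersion) hT1.flip ‹_›
  haveI : IsOpenImmersion k2 := MorphismProperty.of_isPullback (P := @IsOpenImmersion) hT2.flip ‹_›
  haveI : IsOpenImmersion m1 := MorphismProperty.of_isPullback (P := @IsOpenImmersion) hZ1.flip ‹_›
  haveI : IsOpenImmersion m2 := MorphismProperty.of_isPullback (P := @IsOpenImmersion) hZ2.flip ‹_›
  have hcT : ∀ x : T, x ∈ Set.range k1 ∨ x ∈ Set.range k2 := by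
    intro x
    rcases hc (a x) with ⟨y, hy⟩ | ⟨y, hy⟩
    · obtain ⟨w, hw, -⟩ := Scheme.exists_preimage_of_isPullback hT1 x y hy.symm
      exact Or.inl ⟨w, hw⟩
    · obtain ⟨w, hw, -⟩ := Scheme.exists_preimage_of_isPullback hT2 x y hy.symm
      exact Or.inr ⟨w, hw⟩
  have hcZ : ∀ x : Z, x ∈ Set.range m1 ∨ x ∈ Set.range m2 := by
    intro x
    rcases hcT (z x) with ⟨y, hy⟩ | ⟨y, hy⟩
    · obtain ⟨w, hw, -⟩ := Scheme.exists_preimage_of_isPullback hZ1 x y hy.symm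
      exact Or.inl ⟨w, hw⟩
    · obtain ⟨w, hw, -⟩ := Scheme.exists_preimage_of_isPullback hZ2 x y hy.symm
      exact Or.inr ⟨w, hw⟩
  have hnt : n1 ≫ t1 ≫ r1 = n2 ≫ t2 ≫ r2 := by
    rw [← reassoc_of% w1, hw, reassoc_of% w2]
  obtain ⟨t, hm1, hm2⟩ : ∃ t : Z ⟶ W, m1 ≫ t = t1 ≫ r1 ∧ m2 ≫ t = t2 ≫ r2 := by
    exact glue_hom2 hZ12 hcZ _ _ hnt
  refine ⟨W, g, t, FEt.two j1 j2 hc hr1 hr2 e1 e2, ?_⟩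
  refine (isPullback_two k1 k2 hcT z t a g hZ1 ?_ hZ2 ?_).flip
  · rw [hm1, hT1.w]
    exact (ht1.paste_horiz hr1).flip
  · rw [hm2, hT2.w]
    exact (ht2.paste_horiz hr2).flip

end Glue

end CW

namespace CW

section BcF

variable {A k : Type} [CommRing A] [CommRing k] [Algebra A k]

/-- functoriality of base change -/
def bcF {V V' : Scheme.{0}} {v : V ⟶ Spec (CommRingCat.of A)} {v' : V' ⟶ Spec (CommRingCat.of A)} (f : V' ⟶ V)
    (e : f ≫ v = v') (B : FGS A k) : bc v' B ⟶ bc v B :=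
  pullback.lift (pullback.fst _ _ ≫ f) (pullback.snd _ _) (by rw [Category.assoc, e, pullback.condition])

variable {V V' : Scheme.{0}} {v : V ⟶ Spec (CommRingCat.of A)} {v' : V' ⟶ Spec (CommRingCat.of A)} (f : V' ⟶ V)
    (e : f ≫ v = v')

lemma bcF_fst (B : FGS A k) : bcF f e B ≫ pullback.fst v (sB A k B) = pullback.fst v' (sB A k B) ≫ f :=
  pullback.lift_fst _ _ _

lemma bcF_fst_assoc (B : FGS A k) {Q : Scheme.{0}} (r : V ⟶ Q) : bcF f e B ≫ pullback.fst v (sB A k B) ≫ r = pullback.fst v' (sB A k B) ≫ f ≫ r := by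
  rw [← Category.assoc, bcF_fst, Category.assoc]

lemma bcF_snd (B : FGS A k) : bcF f e B ≫ pullback.snd v (sB A k B) = pullback.snd v' (sB A k B) :=
  pullback.lift_snd _ _ _

lemma bcF_isPullback (B : FGS A k) : IsPullback (pullback.fst v' (sB A k B)) (bcF f e B) f (pullback.fst v (sB A k B)) := by
  refine (IsPullback.of_bot (v₂₁ := pullback.snd v (sB A k B)) (v₂₂ := v) (h₃₁ := sB A k B) ?_ (bcF_fst f e B).symm (IsPullback.of_hasPullback v (sB A k B)))
  rw [bcF_snd, e]
  exact IsPullback.of_hasPullback v' (sB A k B)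

lemma bcF_square {V V1 V2 V12 : Scheme.{0}} {v : V ⟶ Spec (CommRingCat.of A)} {v1 : V1 ⟶ Spec (CommRingCat.of A)} {v2 : V2 ⟶ Spec (CommRingCat.of A)}
    {v12 : V12 ⟶ Spec (CommRingCat.of A)} {j1 : V1 ⟶ V} {j2 : V2 ⟶ V} {p1 : V12 ⟶ V1} {p2 : V12 ⟶ V2} (h : IsPullback p1 p2 j1 j2)
    (e1 : j1 ≫ v = v1) (e2 : j2 ≫ v = v2) (d1 : p1 ≫ v1 = v12) (d2 : p2 ≫ v2 = v12) (B : FGS A k) :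
    IsPullback (bcF p1 d1 B) (bcF p2 d2 B) (bcF j1 e1 B) (bcF j2 e2 B) := by
  refine IsPullback.of_right (h₁₂ := pullback.fst v1 (sB A k B)) (h₂₂ := pullback.fst v (sB A k B)) (v₁₃ := j1) ?_ ?_ (bcF_isPullback j1 e1 B)
  · rw [bcF_fst, bcF_fst]
    exact (bcF_isPullback p2 d2 B).paste_horiz h
  · apply pullback.hom_ext
    · simp only [Category.assoc, bcF_fst, bcF_fst_assoc, h.w]
    · simp only [Category.assoc, bcF_snd]

variable {T T' : Scheme.{0}} {a : T ⟶ V} {b : T ⟶ Spec (CommRingCat.of k)} {a' : T' ⟶ V'} {b' : T' ⟶ Spec (CommRingCat.of k)}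

lemma bcMap_bcF (h : a ≫ v = b ≫ sK A k) (h' : a' ≫ v' = b' ≫ sK A k) (c : T' ⟶ T) (ha : a' ≫ f = c ≫ a) (hb : b' = c ≫ b) (B : FGS A k) :
    bcMap v' h' B ≫ bcF f e B = c ≫ bcMap v h B := by
  apply pullback.hom_ext
  · simp only [Category.assoc, bcF_fst, bcMap_fst, bcMap_fst_assoc, ha]
  · simp only [Category.assoc, bcF_snd, bcMap_snd, hb]

lemma bcMap_square (h : a ≫ v = b ≫ sK A k) (h' : a' ≫ v' = b' ≫ sK A k) (c : T' ⟶ T) (ha : IsPullback a' c f a) (hb : b' = c ≫ b) (B : FGS A k) :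
    IsPullback (bcMap v' h' B) c (bcF f e B) (bcMap v h B) := by
  refine IsPullback.of_right (h₁₂ := pullback.fst v' (sB A k B)) (h₂₂ := pullback.fst v (sB A k B)) (v₁₃ := f) ?_ (bcMap_bcF f e h h' c ha.w hb B) (bcF_isPullback f e B)
  rw [bcMap_fst, bcMap_fst]
  exact ha

end BcF

section Iso

variable {A k : Type} [CommRing A] [CommRing k] [Algebra A k]

lemma FMod.mono {V T Z : Scheme.{0}} {v : V ⟶ Spec (CommRingCat.of A)} {a : T ⟶ V} {b : T ⟶ Spec (CommRingCat.of k)} (h : a ≫ v = b ≫ sK A k)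
    {z : Z ⟶ T} {B C : FGS A k} (hBC : B ≤ C) (hm : FMod (bcMap v h B) z) : FMod (bcMap v h C) z :=
  FMod.of_comp _ (bcTr v hBC) (bcMap_bcTr v h hBC) hm

variable {U W W' Z T : Scheme.{0}} {u : U ⟶ Spec (CommRingCat.of A)} [CompactSpace U] [QuasiSeparatedSpace U]
  {a : T ⟶ U} {b : T ⟶ Spec (CommRingCat.of k)} (h : IsPullback a b u (sK A k)) {g : W ⟶ U} {g' : W' ⟶ U}
  (hg : FEt g) (hg' : FEt g') {t : Z ⟶ W} {t' : Z ⟶ W'} {z : Z ⟶ T} (ht : IsPullback t z g a) (ht' : IsPullback t' z g' a)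

/-- auxiliary map over stage -/
def alp {B : FGS A k} (w : bc (g ≫ u) B ⟶ W') (e : w ≫ g' = pullback.fst (g ≫ u) (sB A k B) ≫ g) : bc (g ≫ u) B ⟶ bc (g' ≫ u) B :=
  pullback.lift w (pullback.snd _ _) (by rw [reassoc_of% e, pullback.condition])

lemma alp_fst {B : FGS A k} (w : bc (g ≫ u) B ⟶ W') (e : w ≫ g' = pullback.fst (g ≫ u) (sB A k B) ≫ g) : 
  alp w e ≫ pullback.fst _ _ = w := pullback.lift_fst _ _ _

lemma alp_fst_assoc {B : FGS A k} (w : bc (g ≫ u) B ⟶ W') (e : w ≫ g' = pullback.fst (g ≫ u) (sB A k B) ≫ g) {Q : Scheme.{0}} (r : W' ⟶ Q) : alp w e ≫ pullback.fst _ _ ≫ r = w ≫ r := by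
  rw [← Category.assoc, alp_fst]

lemma alp_snd {B : FGS A k} (w : bc (g ≫ u) B ⟶ W') (e : w ≫ g' = pullback.fst (g ≫ u) (sB A k B) ≫ g) : 
  alp w e ≫ pullback.snd _ _ = pullback.snd _ _ := pullback.lift_snd _ _ _

lemma alp_snd_assoc {B : FGS A k} (w : bc (g ≫ u) B ⟶ W') (e : w ≫ g' = pullback.fst (g ≫ u) (sB A k B) ≫ g) {Q : Scheme.{0}} (r : Spec (CommRingCat.of B.1) ⟶ Q) : alp w e ≫ pullback.snd _ _ ≫ r = pullback.snd _ _ ≫ r := by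
  rw [← Category.assoc, alp_snd]

lemma alp_tr {B C : FGS A k} (hBC : B ≤ C) (w : bc (g ≫ u) B ⟶ W') (e : w ≫ g' = pullback.fst (g ≫ u) (sB A k B) ≫ g)
    (e' : (bcTr (g ≫ u) hBC ≫ w) ≫ g' = pullback.fst (g ≫ u) (sB A k C) ≫ g) :
    bcTr (g ≫ u) hBC ≫ alp w e = alp (bcTr (g ≫ u) hBC ≫ w) e' ≫ bcTr (g' ≫ u) hBC := by
  apply pullback.hom_ext
  · simp only [Category.assoc, alp_fst, bcTr_fst]
  · simp only [Category.assoc, alp_snd, bcTr_snd, alp_snd_assoc]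

include h hg hg' ht ht' in
theorem half_iso {B : FGS A k} (w : bc (g ≫ u) B ⟶ W') (e : w ≫ g' = pullback.fst (g ≫ u) (sB A k B) ≫ g)
    (hw : ∀ h', bcMap (g ≫ u) (a := t) (b := z ≫ b) h' B ≫ w = t')
    (w' : bc (g' ≫ u) B ⟶ W) (e' : w' ≫ g = pullback.fst (g' ≫ u) (sB A k B) ≫ g')
    (hw' : ∀ h', bcMap (g' ≫ u) (a := t') (b := z ≫ b) h' B ≫ w' = t) :
    ∃ (C : FGS A k) (_ : B ≤ C), ∀ (D : FGS A k) (hBD : B ≤ D), C ≤ D → ∀ e1 e2,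
      alp (g := g) (g' := g') (bcTr (g ≫ u) hBD ≫ w) e1 ≫ alp (g := g') (g' := g) (bcTr (g' ≫ u) hBD ≫ w') e2 = 𝟙 _ := by
  haveI := hg.1; haveI := hg.2
  haveI : CompactSpace W := QuasiCompact.compactSpace_of_compactSpace g
  have hW : IsPullback t (z ≫ b) (g ≫ u) (sK A k) := (ht.flip.paste_horiz h.flip).flip
  have hW' : IsPullback t' (z ≫ b) (g' ≫ u) (sK A k) := (ht'.flip.paste_horiz h.flip).flip
  have hab : bcMap (g ≫ u) hW.w B ≫ alp w e = bcMap (g' ≫ u) hW'.w B := by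
    apply pullback.hom_ext
    · simp only [Category.assoc, alp_fst, bcMap_fst, hw]
    · simp only [Category.assoc, alp_snd, bcMap_snd]
  obtain ⟨C, hBC, hC⟩ := hom_descent_unique (g ≫ u) hW g g (B := B) (alp w e ≫ w') (pullback.fst _ _) (by rw [Category.assoc, e', alp_fst_assoc, e]) rfl
    (by rw [reassoc_of% hab, hw', bcMap_fst])
  refine ⟨C, hBC, fun D hBD hCD e1 e2 => ?_⟩
  have hD : bcTr (g ≫ u) hBD ≫ alp w e ≫ w' = bcTr (g ≫ u) hBD ≫ pullback.fst _ _ := by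
    rw [← bcTr_trans (g ≫ u) hBC hCD hBD, Category.assoc, Category.assoc, hC]
  apply pullback.hom_ext
  · rw [Category.assoc, alp_fst, ← Category.assoc, ← alp_tr hBD w e e1, Category.assoc, hD, bcTr_fst, Category.id_comp]
  · rw [Category.assoc, alp_snd, alp_snd, Category.id_comp]

include h hg hg' ht ht' in
theorem iso_descent : ∃ (B : FGS A k) (w : bc (g ≫ u) B ⟶ W'),
    (∀ h', bcMap (g ≫ u) (a := t) (b := z ≫ b) h' B ≫ w = t') ∧ IsPullback w (bcF g rfl B) g' (pullback.fst u (sB A k B)) := by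
  have hW : IsPullback t (z ≫ b) (g ≫ u) (sK A k) := (ht.flip.paste_horiz h.flip).flip
  have hW' : IsPullback t' (z ≫ b) (g' ≫ u) (sK A k) := (ht'.flip.paste_horiz h.flip).flip
  obtain ⟨B, B', w, w', hw, hw', e, e'⟩ : ∃ (B B' : FGS A k) (w : bc (g ≫ u) B ⟶ W') (w' : bc (g' ≫ u) B' ⟶ W), bcMap (g ≫ u) hW.w B ≫ w = t' ∧ 
      bcMap (g' ≫ u) hW'.w B' ≫ w' = t ∧ w ≫ g' = pullback.fst (g ≫ u) (sB A k B) ≫ g ∧ w' ≫ g = pullback.fst (g' ≫ u) (sB A k B') ≫ g' := by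
    haveI := hg.1; haveI := hg.2
    haveI := hg'.1; haveI := hg'.2
    haveI : CompactSpace W := QuasiCompact.compactSpace_of_compactSpace g
    haveI : QuasiSeparatedSpace W := quasiSeparatedSpace_of_quasiSeparated g
    haveI : CompactSpace W' := QuasiCompact.compactSpace_of_compactSpace g'
    haveI : QuasiSeparatedSpace W' := quasiSeparatedSpace_of_quasiSeparated g'
    obtain ⟨B, w, hw, e⟩ := hom_descent (g ≫ u) hW g' g t' (by rw [ht.w, ht'.w])
    obtain ⟨B', w', hw', e'⟩ := hom_descent (g' ≫ u) hW' g g' t (by rw [ht.w, ht'.w])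
    exact ⟨B, B', w, w', hw, hw', e, e'⟩
  obtain ⟨C, hC, hC'⟩ := exists_ge_ge B B'
  obtain ⟨w, rfl⟩ : ∃ w0, w0 = bcTr (g ≫ u) hC ≫ w := ⟨_, rfl⟩
  have hE : (bcTr (g ≫ u) hC ≫ w) ≫ g' = pullback.fst (g ≫ u) (sB A k C) ≫ g := by rw [Category.assoc, e, bcTr_fst_assoc]
  have hE' : (bcTr (g' ≫ u) hC' ≫ w') ≫ g = pullback.fst (g' ≫ u) (sB A k C) ≫ g' := by rw [Category.assoc, e', bcTr_fst_assoc]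
  have hV : ∀ h', bcMap (g ≫ u) (a := t) (b := z ≫ b) h' C ≫ (bcTr (g ≫ u) hC ≫ w) = t' := fun h' => by rw [bcMap_bcTr_assoc, hw]
  have hV' : ∀ h', bcMap (g' ≫ u) (a := t') (b := z ≫ b) h' C ≫ (bcTr (g' ≫ u) hC' ≫ w') = t := fun h' => by rw [bcMap_bcTr_assoc, hw']
  obtain ⟨D1, h1, k1⟩ := half_iso h hg hg' ht ht' _ hE hV _ hE' hV'
  obtain ⟨D2, h2, k2⟩ := half_iso h hg' hg ht' ht _ hE' hV' _ hE hV
  obtain ⟨D, hD1, hD2⟩ := exists_ge_ge D1 D2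
  have hCD := h1.trans hD1
  have f1 : (bcTr (g ≫ u) hCD ≫ bcTr (g ≫ u) hC ≫ w) ≫ g' = pullback.fst (g ≫ u) (sB A k D) ≫ g := by
    rw [Category.assoc, hE, bcTr_fst_assoc]
  have f2 : (bcTr (g' ≫ u) hCD ≫ bcTr (g' ≫ u) hC' ≫ w') ≫ g = pullback.fst (g' ≫ u) (sB A k D) ≫ g' := by
    rw [Category.assoc, hE', bcTr_fst_assoc]
  let ε : bc (g ≫ u) D ≅ bc (g' ≫ u) D := ⟨alp _ f1, alp _ f2, k1 D hCD hD1 _ _, k2 D hCD hD2 _ _⟩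
  refine ⟨D, bcTr (g ≫ u) hCD ≫ bcTr (g ≫ u) hC ≫ w, fun h' => by rw [bcMap_bcTr_assoc, hV], ?_⟩
  refine IsPullback.of_iso (bcF_isPullback g' rfl D) ε.symm (Iso.refl _) (Iso.refl _) (Iso.refl _) ?_ ?_ ?_ ?_
  · have h3 : ε.hom ≫ pullback.fst _ _ = bcTr (g ≫ u) hCD ≫ bcTr (g ≫ u) hC ≫ w := alp_fst _ f1
    rw [Iso.refl_hom, Category.comp_id, ← h3, Iso.symm_hom, Iso.inv_hom_id_assoc]
  · have h3 : ε.hom ≫ bcF g' rfl D = bcF g rfl D := by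
      change alp _ f1 ≫ bcF g' rfl D = bcF g rfl D
      apply pullback.hom_ext
      · rw [Category.assoc, bcF_fst, alp_fst_assoc, f1, bcF_fst]
      · rw [Category.assoc, bcF_snd, alp_snd, bcF_snd]
    rw [Iso.refl_hom, Category.comp_id, ← h3, Iso.symm_hom, Iso.inv_hom_id_assoc]
  · simp
  · simp

end Iso

end CW

namespace CW

section Union

/-- base change of a pullback square along an intersection -/
lemma cube_pb {V V1 V2 V12 T T1 T2 T12 : Scheme.{0}} {a : T ⟶ V} {j1 : V1 ⟶ V} {j2 : V2 ⟶ V} {p1 : V12 ⟶ V1} {p2 : V12 ⟶ V2}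
    (h : IsPullback p1 p2 j1 j2) {k1 : T1 ⟶ T} {a1 : T1 ⟶ V1} (hT1 : IsPullback k1 a1 a j1)
    {k2 : T2 ⟶ T} {a2 : T2 ⟶ V2} (hT2 : IsPullback k2 a2 a j2) {l1 : T12 ⟶ T1} {l2 : T12 ⟶ T2} (hl : IsPullback l1 l2 k1 k2)
    (a12 : T12 ⟶ V12) (e1 : a12 ≫ p1 = l1 ≫ a1) (e2 : a12 ≫ p2 = l2 ≫ a2) : IsPullback l1 a12 a1 p1 ∧ IsPullback l2 a12 a2 p2 := by
  constructor
  · refine (IsPullback.of_right (h₁₂ := p2) (h₂₂ := j1) (v₁₃ := j2) (h₁₁ := a12) (h₂₁ := a1) ?_ e1 h.flip).flip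
    rw [e2, ← hT1.w]
    exact hl.flip.paste_horiz hT2.flip
  · refine (IsPullback.of_right (h₁₂ := p1) (h₂₂ := j2) (v₁₃ := j1) (h₁₁ := a12) (h₂₁ := a2) ?_ e2 h).flip
    rw [e1, ← hT2.w]
    exact hl.paste_horiz hT1.flip

variable {A k : Type} [CommRing A] [CommRing k] [Algebra A k]

theorem union0 {V V1 V2 T T1 T2 Z Z1 Z2 : Scheme.{0}} (v : V ⟶ Spec (CommRingCat.of A)) [CompactSpace V] [QuasiSeparatedSpace V]
    (j1 : V1 ⟶ V) (j2 : V2 ⟶ V) [IsOpenImmersion j1] [IsOpenImmersion j2] [CompactSpace V1] [CompactSpace V2]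
    (hc : ∀ x : V, x ∈ Set.range j1 ∨ x ∈ Set.range j2)
    {a : T ⟶ V} {b : T ⟶ Spec (CommRingCat.of k)} (h : IsPullback a b v (sK A k))
    {k1 : T1 ⟶ T} {a1 : T1 ⟶ V1} (hT1 : IsPullback k1 a1 a j1)
    {k2 : T2 ⟶ T} {a2 : T2 ⟶ V2} (hT2 : IsPullback k2 a2 a j2) {z : Z ⟶ T}
    {m1 : Z1 ⟶ Z} {z1 : Z1 ⟶ T1} (hZ1 : IsPullback m1 z1 z k1)
    {m2 : Z2 ⟶ Z} {z2 : Z2 ⟶ T2} (hZ2 : IsPullback m2 z2 z k2) (M1 : FMod a1 z1) (M2 : FMod a2 z2) :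
    ∃ B : FGS A k, FMod (bcMap v h.w B) z := by
  obtain ⟨W1, g1, t1, hg1, ht1⟩ := M1
  obtain ⟨W2, g2, t2, hg2, ht2⟩ := M2
  have hV12 := IsPullback.of_hasPullback j1 j2
  generalize pullback.fst j1 j2 = p1 at hV12
  generalize pullback.snd j1 j2 = p2 at hV12
  generalize pullback j1 j2 = V12 at p1 p2 hV12
  have hT12 := IsPullback.of_hasPullback k1 k2
  generalize pullback.fst k1 k2 = l1 at hT12
  generalize pullback.snd k1 k2 = l2 at hT12
  generalize pullback k1 k2 = T12 at l1 l2 hT12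
  have hZ12 := IsPullback.of_hasPullback m1 m2
  generalize pullback.fst m1 m2 = n1 at hZ12
  generalize pullback.snd m1 m2 = n2 at hZ12
  generalize pullback m1 m2 = Z12 at n1 n2 hZ12
  obtain ⟨a12, ha1, ha2⟩ : ∃ a12 : T12 ⟶ V12, a12 ≫ p1 = l1 ≫ a1 ∧ a12 ≫ p2 = l2 ≫ a2 :=
    ⟨hV12.lift (l1 ≫ a1) (l2 ≫ a2) (by rw [Category.assoc, ← hT1.w, Category.assoc, ← hT2.w, hT12.w_assoc]), hV12.lift_fst _ _ _, hV12.lift_snd _ _ _⟩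
  obtain ⟨z12, hz1, hz2⟩ : ∃ z12 : Z12 ⟶ T12, z12 ≫ l1 = n1 ≫ z1 ∧ z12 ≫ l2 = n2 ≫ z2 :=
    ⟨hT12.lift (n1 ≫ z1) (n2 ≫ z2) (by rw [Category.assoc, ← hZ1.w, Category.assoc, ← hZ2.w, hZ12.w_assoc]), hT12.lift_fst _ _ _, hT12.lift_snd _ _ _⟩
  obtain ⟨hA1, hA2⟩ := cube_pb hV12 hT1 hT2 hT12 a12 ha1 ha2
  obtain ⟨hB1, hB2⟩ := cube_pb hT12 hZ1 hZ2 hZ12 z12 hz1 hz2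
  -- pullbacks of the models to the intersection
  have hg1' := IsPullback.of_hasPullback g1 p1
  generalize pullback.fst g1 p1 = f1 at hg1'
  generalize pullback.snd g1 p1 = g1' at hg1'
  generalize pullback g1 p1 = W1' at f1 g1' hg1'
  have hg2' := IsPullback.of_hasPullback g2 p2
  generalize pullback.fst g2 p2 = f2 at hg2'
  generalize pullback.snd g2 p2 = g2' at hg2'
  generalize pullback g2 p2 = W2' at f2 g2' hg2'
  obtain ⟨t1', s1, s1'⟩ : ∃ t1' : Z12 ⟶ W1', t1' ≫ f1 = n1 ≫ t1 ∧ t1' ≫ g1' = z12 ≫ a12 :=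
    ⟨hg1'.lift (n1 ≫ t1) (z12 ≫ a12) (by rw [Category.assoc, ht1.w, Category.assoc, ha1, reassoc_of% hz1]), hg1'.lift_fst _ _ _, hg1'.lift_snd _ _ _⟩
  obtain ⟨t2', s2, s2'⟩ : ∃ t2' : Z12 ⟶ W2', t2' ≫ f2 = n2 ≫ t2 ∧ t2' ≫ g2' = z12 ≫ a12 :=
    ⟨hg2'.lift (n2 ≫ t2) (z12 ≫ a12) (by rw [Category.assoc, ht2.w, Category.assoc, ha2, reassoc_of% hz2]), hg2'.lift_fst _ _ _, hg2'.lift_snd _ _ _⟩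
  have ht1' : IsPullback t1' z12 g1' a12 := by
    refine IsPullback.of_right (h₁₂ := f1) (h₂₂ := p1) (v₁₃ := g1) ?_ s1' hg1'
    rw [s1, ha1]
    exact hB1.paste_horiz ht1
  have ht2' : IsPullback t2' z12 g2' a12 := by
    refine IsPullback.of_right (h₁₂ := f2) (h₂₂ := p2) (v₁₃ := g2) ?_ s2' hg2'
    rw [s2, ha2]
    exact hB2.paste_horiz ht2
  have hu : IsPullback a12 (l1 ≫ k1 ≫ b) (p1 ≫ j1 ≫ v) (sK A k) := by
    exact (hA1.paste_horiz (hT1.paste_horiz h.flip)).flip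
  haveI : QuasiSeparatedSpace V1 := quasiSeparatedSpace_of_quasiSeparated j1
  haveI : IsOpenImmersion p1 := MorphismProperty.of_isPullback (P := @IsOpenImmersion) hV12.flip ‹_›
  haveI : QuasiCompact p1 := by
    haveI : QuasiCompact j2 := inferInstance
    exact MorphismProperty.of_isPullback (P := @QuasiCompact) hV12.flip ‹_›
  haveI : CompactSpace V12 := QuasiCompact.compactSpace_of_compactSpace p1
  haveI : QuasiSeparatedSpace V12 := quasiSeparatedSpace_of_quasiSeparated p1
  obtain ⟨B, w, hw, hwp⟩ := iso_descent hu (hg1.of_isPullback hg1') (hg2.of_isPullback hg2') ht1' ht2'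
  have ew : f1 ≫ g1 ≫ j1 ≫ v = g1' ≫ p1 ≫ j1 ≫ v := hg1'.w_assoc _
  have ep : p2 ≫ j2 ≫ v = p1 ≫ j1 ≫ v := (hV12.w_assoc v).symm
  have e2 : (w ≫ f2) ≫ g2 ≫ j2 ≫ v = pullback.snd (g1' ≫ p1 ≫ j1 ≫ v) (sB A k B) ≫ sB A k B := by
    rw [← pullback.condition, Category.assoc, hg2'.w_assoc, ep, reassoc_of% hwp.w, bcF_fst_assoc]
  let q2 : bc (g1' ≫ p1 ≫ j1 ≫ v) B ⟶ bc (g2 ≫ j2 ≫ v) B := pullback.lift (w ≫ f2) (pullback.snd _ _) e2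
  have q2f : q2 ≫ pullback.fst _ _ = w ≫ f2 := pullback.lift_fst _ _ _
  have q2s : q2 ≫ pullback.snd _ _ = pullback.snd _ _ := pullback.lift_snd _ _ _
  have hq2 : IsPullback q2 (bcF g1' rfl B) (bcF g2 rfl B) (bcF p2 ep B) := by
    refine IsPullback.of_right (h₁₂ := pullback.fst _ _) (h₂₂ := pullback.fst _ _) (v₁₃ := g2) ?_ ?_ (bcF_isPullback g2 rfl B)
    · rw [q2f, bcF_fst]
      exact hwp.paste_horiz hg2'
    · apply pullback.hom_ext
      · rw [Category.assoc, Category.assoc, bcF_fst, reassoc_of% q2f, bcF_fst, hg2'.w, reassoc_of% hwp.w]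
      · rw [Category.assoc, Category.assoc, bcF_snd, q2s, bcF_snd, bcF_snd]
  have x1 : a1 ≫ j1 ≫ v = (k1 ≫ b) ≫ sK A k := by rw [← hT1.w_assoc, h.w, Category.assoc]
  have x2 : a2 ≫ j2 ≫ v = (k2 ≫ b) ≫ sK A k := by rw [← hT2.w_assoc, h.w, Category.assoc]
  have y1 : t1 ≫ g1 ≫ j1 ≫ v = (z1 ≫ k1 ≫ b) ≫ sK A k := by simp only [ht1.w_assoc, x1, Category.assoc]
  have y2 : t2 ≫ g2 ≫ j2 ≫ v = (z2 ≫ k2 ≫ b) ≫ sK A k := by simp only [ht2.w_assoc, x2, Category.assoc]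
  have y12 : t1' ≫ g1' ≫ p1 ≫ j1 ≫ v = (z12 ≫ l1 ≫ k1 ≫ b) ≫ sK A k := by simp only [reassoc_of% s1', hu.w, Category.assoc]
  haveI : IsOpenImmersion (bcF j1 (v := v) rfl B) := MorphismProperty.of_isPullback (P := @IsOpenImmersion) (bcF_isPullback j1 rfl B) ‹_›
  haveI : IsOpenImmersion (bcF j2 (v := v) rfl B) := MorphismProperty.of_isPullback (P := @IsOpenImmersion) (bcF_isPullback j2 rfl B) ‹_›
  refine ⟨B, glue_mod (bcF_square hV12 (v := v) rfl rfl rfl ep B) ?_ (bcF_square hg1' (v := j1 ≫ v) rfl rfl ew rfl B) hq2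
    (hg1.of_isPullback (bcF_isPullback g1 rfl B).flip.flip) (hg2.of_isPullback (bcF_isPullback g2 rfl B)) (bcMap v h.w B) z
    (bcMap_square j1 rfl h.w x1 k1 hT1.flip rfl B).flip (bcMap_square j2 rfl h.w x2 k2 hT2.flip rfl B).flip hZ1 hZ2 hZ12
    (bcMap_square g1 rfl x1 y1 z1 ht1 rfl B) (bcMap_square g2 rfl x2 y2 z2 ht2 rfl B) (bcMap _ y12 B) ?_ ?_⟩
  · intro x
    rcases hc (pullback.fst v (sB A k B) x) with ⟨y, hy⟩ | ⟨y, hy⟩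
    · obtain ⟨w, -, hw⟩ := Scheme.exists_preimage_of_isPullback (bcF_isPullback j1 rfl B) y x hy
      exact Or.inl ⟨w, hw⟩
    · obtain ⟨w, -, hw⟩ := Scheme.exists_preimage_of_isPullback (bcF_isPullback j2 rfl B) y x hy
      exact Or.inr ⟨w, hw⟩
  · exact bcMap_bcF _ _ _ _ _ s1 (by rw [← reassoc_of% hz1]) B
  · apply pullback.hom_ext
    · rw [Category.assoc, q2f, reassoc_of% (hw y12), s2, Category.assoc, bcMap_fst]
    · simp only [Category.assoc, q2s, bcMap_snd, hT12.w_assoc, reassoc_of% hz2]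

lemma fgs_restrict (B : FGS A k) (C : FGS B.1 k) : (C.1.restrictScalars A).FG := by
  haveI : Algebra.FiniteType A B.1 := B.1.fg_iff_finiteType.mp B.2
  haveI : Algebra.FiniteType B.1 C.1 := C.1.fg_iff_finiteType.mp C.2
  haveI : Algebra.FiniteType A C.1 := Algebra.FiniteType.trans (S := B.1) inferInstance inferInstance
  exact (Subalgebra.fg_iff_finiteType (C.1.restrictScalars A)).mpr ‹Algebra.FiniteType A C.1›

lemma stage {V T Z : Scheme.{0}} {v : V ⟶ Spec (CommRingCat.of A)} {a : T ⟶ V} {b : T ⟶ Spec (CommRingCat.of k)} (h : a ≫ v = b ≫ sK A k)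
    {z : Z ⟶ T} (B : FGS A k) (h' : bcMap v h B ≫ pullback.snd v (sB A k B) = b ≫ sK B.1 k) (C : FGS B.1 k)
    (M : FMod (bcMap (pullback.snd v (sB A k B)) h' C) z) : ∃ C' : FGS A k, FMod (bcMap v h C') z := by
  let C' : FGS A k := ⟨C.1.restrictScalars A, fgs_restrict B C⟩
  have hBC : B ≤ C' := fun x hx => C.1.algebraMap_mem ⟨x, hx⟩
  obtain ⟨i, e, e'⟩ : ∃ i : Spec (CommRingCat.of C'.1) ⟶ Spec (CommRingCat.of C.1), i ≫ sB B.1 k C = tr A k hBC ∧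
      tB A k C' ≫ i = tB B.1 k C :=
    ⟨𝟙 (Spec (CommRingCat.of C.1)), Category.id_comp (sB B.1 k C), Category.comp_id (tB B.1 k C)⟩
  refine ⟨C', FMod.of_comp _ (pullback.lift (bcTr v hBC) (pullback.snd v (sB A k C') ≫ i) ?_) ?_ M⟩
  · rw [bcTr_snd, Category.assoc, e]
  · apply pullback.hom_ext
    · rw [Category.assoc, pullback.lift_fst, bcMap_fst, bcMap_bcTr]
    · rw [Category.assoc, pullback.lift_snd, bcMap_snd_assoc, bcMap_snd, e']

theorem union {V V1 V2 T T1 T2 Z Z1 Z2 : Scheme.{0}} (v : V ⟶ Spec (CommRingCat.of A)) [CompactSpace V] [QuasiSeparatedSpace V]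
    (j1 : V1 ⟶ V) (j2 : V2 ⟶ V) [IsOpenImmersion j1] [IsOpenImmersion j2] [CompactSpace V1] [CompactSpace V2]
    (hc : ∀ x : V, x ∈ Set.range j1 ∨ x ∈ Set.range j2)
    {a : T ⟶ V} {b : T ⟶ Spec (CommRingCat.of k)} (h : IsPullback a b v (sK A k))
    {k1 : T1 ⟶ T} {a1 : T1 ⟶ V1} (hT1 : IsPullback k1 a1 a j1)
    {k2 : T2 ⟶ T} {a2 : T2 ⟶ V2} (hT2 : IsPullback k2 a2 a j2) {z : Z ⟶ T}
    {m1 : Z1 ⟶ Z} {z1 : Z1 ⟶ T1} (hZ1 : IsPullback m1 z1 z k1)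
    {m2 : Z2 ⟶ Z} {z2 : Z2 ⟶ T2} (hZ2 : IsPullback m2 z2 z k2) 
    (x1 : a1 ≫ j1 ≫ v = (k1 ≫ b) ≫ sK A k) (x2 : a2 ≫ j2 ≫ v = (k2 ≫ b) ≫ sK A k)
    (M1 : ∃ B : FGS A k, FMod (bcMap (j1 ≫ v) x1 B) z1) (M2 : ∃ B : FGS A k, FMod (bcMap (j2 ≫ v) x2 B) z2) :
    ∃ B : FGS A k, FMod (bcMap v h.w B) z := by
  obtain ⟨B1, M1⟩ := M1
  obtain ⟨B2, M2⟩ := M2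
  obtain ⟨B, hB1, hB2⟩ := exists_ge_ge B1 B2
  replace M1 := M1.mono x1 hB1
  replace M2 := M2.mono x2 hB2
  have h' : IsPullback (bcMap v h.w B) b (pullback.snd v (sB A k B)) (sK B.1 k) := bcMap_isPullback v h B
  haveI : CompactSpace (bc v B) := QuasiCompact.compactSpace_of_compactSpace (pullback.fst v (sB A k B))
  haveI : QuasiSeparatedSpace (bc v B) := quasiSeparatedSpace_of_quasiSeparated (pullback.fst v (sB A k B))
  haveI : CompactSpace (bc (j1 ≫ v) B) := QuasiCompact.compactSpace_of_compactSpace (pullback.fst (j1 ≫ v) (sB A k B))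
  haveI : CompactSpace (bc (j2 ≫ v) B) := QuasiCompact.compactSpace_of_compactSpace (pullback.fst (j2 ≫ v) (sB A k B))
  haveI : IsOpenImmersion (bcF j1 (v := v) rfl B) := MorphismProperty.of_isPullback (P := @IsOpenImmersion) (bcF_isPullback j1 rfl B) ‹_›
  haveI : IsOpenImmersion (bcF j2 (v := v) rfl B) := MorphismProperty.of_isPullback (P := @IsOpenImmersion) (bcF_isPullback j2 rfl B) ‹_›
  obtain ⟨C, M⟩ := union0 (pullback.snd v (sB A k B)) (bcF j1 (v := v) rfl B) (bcF j2 (v := v) rfl B) (by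
    intro x
    rcases hc (pullback.fst v (sB A k B) x) with ⟨y, hy⟩ | ⟨y, hy⟩
    · obtain ⟨w, -, hw⟩ := Scheme.exists_preimage_of_isPullback (bcF_isPullback j1 rfl B) y x hy
      exact Or.inl ⟨w, hw⟩
    · obtain ⟨w, -, hw⟩ := Scheme.exists_preimage_of_isPullback (bcF_isPullback j2 rfl B) y x hy
      exact Or.inr ⟨w, hw⟩) h' (bcMap_square j1 rfl h.w x1 k1 hT1.flip rfl B).flip (bcMap_square j2 rfl h.w x2 k2 hT2.flip rfl B).flip 
      hZ1 hZ2 M1 M2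
  exact stage h.w B h'.w C M

end Union

end CW

namespace CW

section Aff

open TensorProduct Polynomial

lemma integral_descent (A0 R S0 : Type) [CommRing A0] [CommRing R] [CommRing S0] [Algebra A0 R] [Algebra A0 S0]
    [Algebra.FiniteType A0 S0] [Module.Flat A0 S0] [Module.Finite R (R ⊗[A0] S0)] :
    ∃ A1 : Subalgebra A0 R, A1.FG ∧ Module.Finite A1 (A1 ⊗[A0] S0) := by
  obtain ⟨G, hG⟩ := ‹Algebra.FiniteType A0 S0›.out
  have hint : ∀ s : S0, ∃ P : R[X], P.Monic ∧ aeval ((1 : R) ⊗ₜ[A0] s) P = 0 := fun s =>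
    Algebra.IsIntegral.isIntegral (R := R) ((1 : R) ⊗ₜ[A0] s)
  choose P hPm hP using hint
  classical
  let E : Finset R := G.biUnion fun s => (P s).coeffs
  let A1 : Subalgebra A0 R := Algebra.adjoin A0 (E : Set R)
  have hinj : Function.Injective (Algebra.TensorProduct.map A1.val (AlgHom.id A0 S0)) := by
    have := Module.Flat.rTensor_preserves_injective_linearMap (M := S0) A1.val.toLinearMap Subtype.val_injective
    exact this
  refine ⟨A1, ⟨E, rfl⟩, ⟨?_⟩⟩
  have htop : Algebra.adjoin A1 (((1 : A1) ⊗ₜ[A0] ·) '' (G : Set S0)) = ⊤ := Algebra.TensorProduct.adjoin_one_tmul_image_eq_top _ hG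
  rw [← Algebra.top_toSubmodule, ← htop]
  refine fg_adjoin_of_finite (G.finite_toSet.image _) ?_
  rintro _ ⟨s, hs, rfl⟩
  have hlift : P s ∈ lifts A1.val.toRingHom := by
    rw [lifts_iff_coeff_lifts]
    intro n
    by_cases h0 : (P s).coeff n = 0
    · exact ⟨0, by rw [h0]; rfl⟩
    · exact ⟨⟨(P s).coeff n, Algebra.subset_adjoin (Finset.mem_coe.mpr (Finset.mem_biUnion.mpr ⟨s, hs, coeff_mem_coeffs h0⟩))⟩, rfl⟩
  obtain ⟨q, hq, -, hqm⟩ := lifts_and_natDegree_eq_and_monic hlift (hPm s)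
  refine ⟨q, hqm, ?_⟩
  apply hinj
  rw [map_zero]
  have h1 : (Algebra.TensorProduct.map A1.val (AlgHom.id A0 S0)) (eval₂ (algebraMap A1 (A1 ⊗[A0] S0)) ((1 : A1) ⊗ₜ[A0] s) q) =
      aeval ((1 : R) ⊗ₜ[A0] s) (q.map A1.val.toRingHom) := by
    change (Algebra.TensorProduct.map A1.val (AlgHom.id A0 S0)).toRingHom _ = _
    rw [hom_eval₂, aeval_def, eval₂_map]
    congr 1
  exact h1.trans (by rw [hq, hP])

lemma tensor_pb (A0 R S0 : Type) [CommRing A0] [CommRing R] [CommRing S0] [Algebra A0 R] [Algebra A0 S0] :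
    IsPullback (Spec.map (CommRingCat.ofHom (algebraMap R (R ⊗[A0] S0)))) (Spec.map (CommRingCat.ofHom (Algebra.TensorProduct.includeRight.toRingHom : S0 →+* R ⊗[A0] S0)))
      (Spec.map (CommRingCat.ofHom (algebraMap A0 R))) (Spec.map (CommRingCat.ofHom (algebraMap A0 S0))) :=
    isPullback_SpecMap_of_isPushout _ _ _ _ (CommRingCat.isPushout_tensorProduct A0 R S0)

lemma tensor_pb_equiv (A0 R S0 S : Type) [CommRing A0] [CommRing R] [CommRing S0] [CommRing S] [Algebra A0 R] [Algebra A0 S0]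
    [Algebra R S] (e : S ≃ₐ[R] R ⊗[A0] S0) :
    IsPullback (Spec.map (CommRingCat.ofHom ((e.symm : R ⊗[A0] S0 →+* S).comp (Algebra.TensorProduct.includeRight.toRingHom : S0 →+* R ⊗[A0] S0)))) (Spec.map (CommRingCat.ofHom (algebraMap R S))) 
      (Spec.map (CommRingCat.ofHom (algebraMap A0 S0))) (Spec.map (CommRingCat.ofHom (algebraMap A0 R))) := by
  have hr : IsPushout (CommRingCat.ofHom (algebraMap A0 R)) (CommRingCat.ofHom (algebraMap A0 S0))
      (CommRingCat.ofHom (algebraMap R S)) (CommRingCat.ofHom ((e.symm : R ⊗[A0] S0 →+* S).comp (Algebra.TensorProduct.includeRight.toRingHom : S0 →+* R ⊗[A0] S0))) := by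
    refine (CommRingCat.isPushout_tensorProduct A0 R S0).of_iso (Iso.refl _) (Iso.refl _) (Iso.refl _) e.symm.toRingEquiv.toCommRingCatIso (by simp) (by simp) ?_ ?_
    · ext x
      simpa using e.symm.commutes x
    · ext x
      simp
  exact (isPullback_SpecMap_of_isPushout _ _ _ _ hr).flip

theorem affine_alg (A R S : Type) [CommRing A] [CommRing R] [CommRing S] [Algebra A R] [Algebra R S] [Module.Finite R S] [Algebra.Etale R S] :
    ∃ (A1 : Type) (_ : CommRing A1) (_ : Algebra A A1) (_ : Algebra A1 R), Algebra.FiniteType A A1 ∧ IsScalarTower A A1 R ∧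
      FMod (Spec.map (CommRingCat.ofHom (algebraMap A1 R))) (Spec.map (CommRingCat.ofHom (algebraMap R S))) := by
  obtain ⟨A0, S0, _, _, hA0, hE, ⟨e⟩⟩ := Algebra.Etale.exists_subalgebra_fg A R S
  haveI : Module.Finite R (R ⊗[A0] S0) := Module.Finite.equiv e.toLinearEquiv
  obtain ⟨A1, hA1, hfin⟩ := integral_descent A0 R S0
  haveI : Algebra.FiniteType A A0 := A0.fg_iff_finiteType.mp hA0
  haveI : Algebra.FiniteType A0 A1 := A1.fg_iff_finiteType.mp hA1
  refine ⟨A1, inferInstance, inferInstance, inferInstance, Algebra.FiniteType.trans (S := A0) inferInstance inferInstance, inferInstance, ?_⟩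
  have hp1 := tensor_pb A0 A1 S0
  have hpS := tensor_pb_equiv A0 R S0 S e
  have hx : Spec.map (CommRingCat.ofHom (algebraMap A1 R)) ≫ Spec.map (CommRingCat.ofHom (algebraMap A0 A1)) = Spec.map (CommRingCat.ofHom (algebraMap A0 R)) := by
    rw [← Spec.map_comp]; rfl
  have hw := hpS.w
  rw [← hx, ← Category.assoc (Spec.map (CommRingCat.ofHom (algebraMap R S)))] at hw
  refine ⟨_, Spec.map (CommRingCat.ofHom (algebraMap A1 (A1 ⊗[A0] S0))), hp1.flip.lift _ _ hw, ⟨?_, ?_⟩, ?_⟩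
  · rw [IsFinite.SpecMap_iff]
    exact RingHom.finite_algebraMap.mpr hfin
  · rw [HasRingHomProperty.Spec_iff (P := @Etale)]
    exact RingHom.etale_algebraMap.mpr inferInstance
  · refine IsPullback.of_right ?_ (hp1.flip.lift_snd _ _ _) hp1.flip
    rw [hp1.flip.lift_fst, hx]
    exact hpS

end Aff

end CW

namespace CW

section AffCase

lemma FMod.comp_pb {T' T V Z Z' : Scheme.{0}} {a : T ⟶ V} {z : Z ⟶ T} (h : FMod a z) {t : Z' ⟶ Z} {z' : Z' ⟶ T'} {i : T' ⟶ T}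
    (hp : IsPullback t z' z i) : FMod (i ≫ a) z' := by
  obtain ⟨W, g, u, hg, hu⟩ := h
  exact ⟨W, g, _, hg, hp.paste_horiz hu⟩

theorem affine_case {A k : Type} [CommRing A] [IsNoetherianRing A] [CommRing k] [Algebra A k] {V T Z : Scheme.{0}}
    (v : V ⟶ Spec (CommRingCat.of A)) [IsAffine V] {a : T ⟶ V} {b : T ⟶ Spec (CommRingCat.of k)} (h : IsPullback a b v (sK A k))
    (z : Z ⟶ T) (hz : FEt z) : ∃ B : FGS A k, FMod (bcMap v h.w B) z := by
  haveI : IsFinite z := hz.1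
  haveI : Etale z := hz.2
  haveI : IsAffineHom a := MorphismProperty.of_isPullback (P := @IsAffineHom) h.flip (by unfold sK; infer_instance)
  haveI : IsAffine T := isAffine_of_isAffineHom a
  haveI : IsAffine Z := isAffine_of_isAffineHom z
  let φ : CommRingCat.of A ⟶ Γ(T, ⊤) := Spec.preimage (T.isoSpec.inv ≫ a ≫ v)
  have hφ : Spec.map φ = T.isoSpec.inv ≫ a ≫ v := Spec.map_preimage _
  letI : Algebra A Γ(T, ⊤) := φ.hom.toAlgebra
  letI : Algebra Γ(T, ⊤) Γ(Z, ⊤) := z.appTop.hom.toAlgebra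
  have hsq : Z.isoSpec.hom ≫ Spec.map z.appTop = z ≫ T.isoSpec.hom := Scheme.isoSpec_hom_naturality z
  have hpb : IsPullback Z.isoSpec.hom z (Spec.map z.appTop) T.isoSpec.hom := IsPullback.of_horiz_isIso ⟨hsq⟩
  have hz' : FEt (Spec.map z.appTop) := by
    have : FEt z := hz
    refine FEt.of_isPullback (IsPullback.of_horiz_isIso (fst := Z.isoSpec.inv) (g := T.isoSpec.inv) (f := z) ⟨?_⟩) hz
    rw [Iso.inv_comp_eq, ← Category.assoc, hsq, Category.assoc, Iso.hom_inv_id, Category.comp_id]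
  haveI : Module.Finite Γ(T, ⊤) Γ(Z, ⊤) := by
    rw [← RingHom.finite_algebraMap]
    exact (IsFinite.SpecMap_iff _).mp hz'.1
  haveI : Algebra.Etale Γ(T, ⊤) Γ(Z, ⊤) := by
    rw [← RingHom.etale_algebraMap]
    exact (HasRingHomProperty.Spec_iff (P := @Etale)).mp hz'.2
  obtain ⟨A1, _, _, _, hft, hst, hF⟩ := affine_alg A Γ(T, ⊤) Γ(Z, ⊤)
  have hF1 : FMod (T.isoSpec.hom ≫ Spec.map (CommRingCat.ofHom (algebraMap A1 Γ(T, ⊤)))) z := hF.comp_pb hpb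
  haveI : Algebra.FinitePresentation A A1 := Algebra.FinitePresentation.of_finiteType.mp hft
  haveI : LocallyOfFinitePresentation (Spec.map (CommRingCat.ofHom (algebraMap A A1))) := by
    rw [HasRingHomProperty.Spec_iff (P := @LocallyOfFinitePresentation)]
    exact RingHom.finitePresentation_algebraMap.mpr inferInstance
  obtain ⟨B, w, hw, -⟩ := hom_descent v h (Spec.map (CommRingCat.ofHom (algebraMap A A1))) v (T.isoSpec.hom ≫ Spec.map (CommRingCat.ofHom (algebraMap A1 Γ(T, ⊤)))) (by
    rw [Category.assoc, ← Spec.map_comp, ← CommRingCat.ofHom_comp, ← IsScalarTower.algebraMap_eq A A1]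
    change T.isoSpec.hom ≫ Spec.map φ = _
    rw [hφ, Iso.hom_inv_id_assoc])
  exact ⟨B, FMod.of_comp _ _ hw hF1⟩

end AffCase

end CW

namespace CW

section Glob

variable {A k : Type} [CommRing A] [IsNoetherianRing A] [CommRing k] [Algebra A k]

/-- descent holds for every structure map on the scheme -/
def Desc (A k : Type) [CommRing A] [CommRing k] [Algebra A k] (V : Scheme.{0}) : Prop :=
  ∀ (v : V ⟶ Spec (CommRingCat.of A)) (T : Scheme.{0}) (a : T ⟶ V) (b : T ⟶ Spec (CommRingCat.of k)) (h : IsPullback a b v (sK A k))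
    (Z : Scheme.{0}) (z : Z ⟶ T) (_ : FEt z), ∃ B : FGS A k, FMod (bcMap v h.w B) z

lemma Desc.union {V V1 V2 : Scheme.{0}} [CompactSpace V] [QuasiSeparatedSpace V] (j1 : V1 ⟶ V) (j2 : V2 ⟶ V) [IsOpenImmersion j1] [IsOpenImmersion j2]
    [CompactSpace V1] [CompactSpace V2] (hc : ∀ x : V, x ∈ Set.range j1 ∨ x ∈ Set.range j2) (h1 : Desc A k V1) (h2 : Desc A k V2) : Desc A k V := by
  intro v T a b h Z z hz
  have hT1 : IsPullback (pullback.fst a j1) (pullback.snd a j1) a j1 := IsPullback.of_hasPullback a j1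
  have hT2 : IsPullback (pullback.fst a j2) (pullback.snd a j2) a j2 := IsPullback.of_hasPullback a j2
  have hZ1 := IsPullback.of_hasPullback z (pullback.fst a j1)
  have hZ2 := IsPullback.of_hasPullback z (pullback.fst a j2)
  have p1 : IsPullback (pullback.snd a j1) (pullback.fst a j1 ≫ b) (j1 ≫ v) (sK A k) := hT1.flip.paste_vert h
  have p2 : IsPullback (pullback.snd a j2) (pullback.fst a j2 ≫ b) (j2 ≫ v) (sK A k) := hT2.flip.paste_vert h
  exact CW.union v j1 j2 hc h hT1 hT2 hZ1 hZ2 p1.w p2.w (h1 _ _ _ _ p1 _ _ (hz.of_isPullback hZ1)) (h2 _ _ _ _ p2 _ _ (hz.of_isPullback hZ2))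

lemma Desc.of_affine (V : Scheme.{0}) [IsAffine V] : Desc A k V := fun v _ _ _ h _ z hz => affine_case v h z hz

theorem Desc.all (V : Scheme.{0}) [CompactSpace V] [QuasiSeparatedSpace V] : Desc A k V := by
  have key : ∀ W : V.Opens, IsCompact (W : Set V) → Desc A k W := by
    intro W hW
    refine compact_open_induction_on (P := fun W : V.Opens => Desc A k W) W hW ?_ ?_
    · haveI : IsEmpty (⊥ : V.Opens) := ⟨fun x => x.2⟩
      exact Desc.of_affine _
    · intro S hS U hP
      haveI : CompactSpace S := isCompact_iff_compactSpace.mp hS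
      haveI : CompactSpace (U.1 : V.Opens) := isCompact_iff_compactSpace.mp U.2.isCompact
      haveI : IsAffine (U.1 : V.Opens) := U.2
      haveI : CompactSpace (S ⊔ U.1 : V.Opens) := isCompact_iff_compactSpace.mp (hS.union U.2.isCompact)
      haveI : QuasiSeparatedSpace (S ⊔ U.1 : V.Opens) := (S ⊔ U.1).ι.isOpenEmbedding.quasiSeparatedSpace
      refine Desc.union (V.homOfLE le_sup_left) (V.homOfLE le_sup_right) ?_ hP (Desc.of_affine _)
      rintro ⟨x, hx | hx⟩
      · exact Or.inl ⟨⟨x, hx⟩, Subtype.ext (by simp)⟩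
      · exact Or.inr ⟨⟨x, hx⟩, Subtype.ext (by simp)⟩
  have ht := key ⊤ isCompact_univ
  haveI : CompactSpace (⊤ : V.Opens) := isCompact_iff_compactSpace.mp isCompact_univ
  exact Desc.union (⊤ : V.Opens).ι (⊤ : V.Opens).ι (fun x => Or.inl ⟨⟨x, trivial⟩, rfl⟩) ht ht

end Glob

end CW

namespace CW

section Fib

open TensorProduct

lemma affine_spec {R : Type} [CommRing R] {X : Scheme.{0}} (f : X ⟶ Spec (CommRingCat.of R)) [IsAffineHom f] :
    ∃ (S : Type) (_ : CommRing S) (_ : Algebra R S) (i : Spec (CommRingCat.of S) ≅ X), i.hom ≫ f = Spec.map (CommRingCat.ofHom (algebraMap R S)) := by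
  haveI : IsAffine X := isAffine_of_isAffineHom f
  let φ : CommRingCat.of R ⟶ Γ(X, ⊤) := Spec.preimage (X.isoSpec.inv ≫ f)
  exact ⟨Γ(X, ⊤), inferInstance, φ.hom.toAlgebra, X.isoSpec.symm, (Spec.map_preimage _).symm⟩

lemma finite_spec {R : Type} [CommRing R] {P X Y : Scheme.{0}} {a : P ⟶ X} {b : P ⟶ Spec (CommRingCat.of R)} {f : X ⟶ Y} {j : Spec (CommRingCat.of R) ⟶ Y}
    (h : IsPullback a b f j) [IsFinite f] :
    ∃ (S : Type) (_ : CommRing S) (_ : Algebra R S) (u : Spec (CommRingCat.of S) ⟶ X), IsPullback u (Spec.map (CommRingCat.ofHom (algebraMap R S))) f j ∧ Module.Finite R S := by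
  haveI : IsFinite b := MorphismProperty.of_isPullback (P := @IsFinite) h inferInstance
  obtain ⟨S, _, _, i, hi⟩ := affine_spec b
  have hp : IsPullback (i.hom ≫ a) (Spec.map (CommRingCat.ofHom (algebraMap R S))) f j :=
    h.of_iso' i (Iso.refl _) (Iso.refl _) (Iso.refl _) (by simp) (by simp [hi]) (by simp) (by simp)
  refine ⟨S, _, _, _, hp, ?_⟩
  have := MorphismProperty.of_isPullback (P := @IsFinite) hp inferInstance
  exact RingHom.finite_algebraMap.mp ((IsFinite.SpecMap_iff _).mp this)

lemma spec_pb_equiv {R K S D : Type} [CommRing R] [CommRing K] [CommRing S] [CommRing D] [Algebra R K] [Algebra R S] [Algebra K D]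
    {u : Spec (CommRingCat.of D) ⟶ Spec (CommRingCat.of S)}
    (hp : IsPullback u (Spec.map (CommRingCat.ofHom (algebraMap K D))) (Spec.map (CommRingCat.ofHom (algebraMap R S))) (Spec.map (CommRingCat.ofHom (algebraMap R K)))) :
    Nonempty (D ≃ₐ[K] K ⊗[R] S) := by
  let i := hp.isoIsPullback _ _ (tensor_pb R K S).flip
  have hi : i.hom ≫ Spec.map (CommRingCat.ofHom (algebraMap K (K ⊗[R] S))) = Spec.map (CommRingCat.ofHom (algebraMap K D)) := hp.isoIsPullback_hom_snd _ _ _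
  let e : K ⊗[R] S →+* D := (Spec.preimage i.hom).hom
  have he : Spec.map (CommRingCat.ofHom e) = i.hom := Spec.map_preimage _
  have hc : e.comp (algebraMap K (K ⊗[R] S)) = algebraMap K D := by
    rw [← he, ← Spec.map_comp] at hi
    exact congrArg (fun x => x.hom) (Spec.map_injective hi)
  haveI : IsIso (Spec.map (CommRingCat.ofHom e)) := by rw [he]; infer_instance
  let e' : K ⊗[R] S →ₐ[K] D := { e with commutes' := fun x => RingHom.congr_fun hc x }
  exact ⟨(AlgEquiv.ofBijective e' (isIso_SpecMap_iff.mp this)).symm⟩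

lemma finrank_le_gens {R S : Type} [CommRing R] [CommRing S] [Algebra R S] [Module.Finite R S] : ∃ n : ℕ, ∀ (K : Type) [Field K] [Algebra R K],
    Module.finrank K (K ⊗[R] S) ≤ n := by
  obtain ⟨n, f, hf⟩ := Module.Finite.exists_fin' R S
  refine ⟨n, fun K _ _ => ?_⟩
  have h1 : Function.Surjective (f.baseChange K) := LinearMap.lTensor_surjective K hf
  rcases subsingleton_or_nontrivial R with hR | hR
  · haveI := (algebraMap R K).domain_nontrivial
    exact absurd hR (not_subsingleton R)
  have := LinearMap.finrank_le_finrank_of_surjective h1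
  rwa [Module.finrank_baseChange (M' := Fin n → R), Module.finrank_fin_fun] at this

lemma local_bound {K : Type} [Field K] {X Y : Scheme.{0}} (f : X ⟶ Y) [IsFinite f] {R : Type} [CommRing R] (j : Spec (CommRingCat.of R) ⟶ Y) [IsOpenImmersion j] :
    ∃ n : ℕ, ∀ (q : Spec (CommRingCat.of K) ⟶ Y) (_ : Set.range q ⊆ Set.range j) (D : Type) [CommRing D] [Algebra K D] (u : Spec (CommRingCat.of D) ⟶ X),
      IsPullback u (Spec.map (CommRingCat.ofHom (algebraMap K D))) f q → Module.finrank K D ≤ n := by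
  obtain ⟨S, _, _, w, hw, _⟩ := finite_spec (IsPullback.of_hasPullback f j)
  obtain ⟨n, hn⟩ := finrank_le_gens (R := R) (S := S)
  refine ⟨n, fun q hq D _ _ u hu => ?_⟩
  let q' := IsOpenImmersion.lift j q hq
  have hq' : q' ≫ j = q := IsOpenImmersion.lift_fac j q hq
  letI : Algebra R K := (Spec.preimage q').hom.toAlgebra
  have hs : Spec.map (CommRingCat.ofHom (algebraMap R K)) = q' := Spec.map_preimage _
  rw [← hq', ← hs] at hu
  have hw1 := hu.w
  rw [← Category.assoc] at hw1
  have hpb : IsPullback (hw.lift _ _ hw1) (Spec.map (CommRingCat.ofHom (algebraMap K D))) (Spec.map (CommRingCat.ofHom (algebraMap R S))) (Spec.map (CommRingCat.ofHom (algebraMap R K))) := by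
    refine IsPullback.of_right ?_ (hw.lift_snd _ _ _) hw
    rw [hw.lift_fst]; exact hu
  obtain ⟨e⟩ := spec_pb_equiv hpb
  rw [e.toLinearEquiv.finrank_eq]
  exact hn K

theorem fibre_bound (K : Type) [Field K] {X Y : Scheme.{0}} (f : X ⟶ Y) [IsFinite f] [CompactSpace Y] :
    ∃ n : ℕ, ∀ (q : Spec (CommRingCat.of K) ⟶ Y) (D : Type) [CommRing D] [Algebra K D] (u : Spec (CommRingCat.of D) ⟶ X),
      IsPullback u (Spec.map (CommRingCat.ofHom (algebraMap K D))) f q → Module.finrank K D ≤ n := by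
  have hl : ∀ y : Y, ∃ (s : Set Y) (n : ℕ), IsOpen s ∧ y ∈ s ∧ ∀ (q : Spec (CommRingCat.of K) ⟶ Y) (_ : Set.range q ⊆ s) (D : Type) [CommRing D] [Algebra K D] (u : Spec (CommRingCat.of D) ⟶ X),
      IsPullback u (Spec.map (CommRingCat.ofHom (algebraMap K D))) f q → Module.finrank K D ≤ n := by
    intro y
    obtain ⟨R, j, hj, hy⟩ : ∃ (R : CommRingCat.{0}) (j : Spec R ⟶ Y), IsOpenImmersion j ∧ y ∈ Set.range j :=
      ⟨_, Y.affineCover.f (Y.affineCover.idx y), Y.affineCover.map_prop _, Y.affineCover.covers y⟩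
    obtain ⟨n, hn⟩ := local_bound (K := K) f (R := R) j
    exact ⟨_, n, IsOpenImmersion.isOpen_range j, hy, hn⟩
  choose s n hs hy hn using hl
  obtain ⟨t, ht⟩ := CompactSpace.elim_nhds_subcover s (fun y => (hs y).mem_nhds (hy y))
  refine ⟨t.sup n, fun q D _ _ u hu => ?_⟩
  let x0 : Spec (CommRingCat.of K) := (⟨⊥, Ideal.isPrime_bot⟩ : PrimeSpectrum K)
  have h0 : q x0 ∈ ⋃ x ∈ t, s x := by
    have : q x0 ∈ (⊤ : Set Y) := trivial
    rwa [← ht] at this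
  obtain ⟨y, hyt, hyq⟩ := Set.mem_iUnion₂.mp h0
  refine (hn y q ?_ D u hu).trans (Finset.le_sup hyt)
  rintro _ ⟨x, rfl⟩
  have : x = x0 := Subsingleton.elim (α := PrimeSpectrum K) x x0
  rwa [this]

end Fib

end CW

namespace CW

section Rk

open TensorProduct

lemma etcov_of_fibre {k : Type} [Field k] (B : Subring k) (D : Type) [CommRing D] [Algebra B D] [Module.Finite B D] [Algebra.Etale B D] (d : ℕ)
    (h1 : 1 ≤ Module.finrank k (k ⊗[B] D)) (h2 : Module.finrank k (k ⊗[B] D) ≤ d) : EtCov B D d := by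
  haveI : Module.Flat B D := inferInstance
  have key : ∀ p : PrimeSpectrum B, Module.rankAtStalk D p = Module.finrank k (k ⊗[B] D) := by
    intro p
    let x0 : PrimeSpectrum k := ⟨⊥, Ideal.isPrime_bot⟩
    have e1 := Module.rankAtStalk_baseChange (R := B) (S := k) (M := D) x0
    have e2 := Module.rankAtStalk_eq_finrank_of_free (R := k) (M := k ⊗[B] D)
    have hle : PrimeSpectrum.comap (algebraMap B k) x0 ≤ p := by
      rw [← PrimeSpectrum.asIdeal_le_asIdeal]
      intro b hb
      have : (b : k) = 0 := hb
      have : b = 0 := Subtype.ext this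
      rw [this]; exact zero_mem _
    have e3 := Module.rankAtStalk_eq_of_le_of_finite_of_flat (M := D) hle
    rw [← e3, ← e1, e2]; rfl
  exact ⟨inferInstance, inferInstance, fun p => by rw [key]; exact h1, fun p => by rw [key]; exact h2⟩

end Rk

end CW

namespace CW

section LiftPts

open TensorProduct

theorem lift_points {k : Type} [Field k] [IsAlgClosed k] [CharZero k] (B : Subring k) (hB : Algebra.FiniteType ℤ B)
    {X Y W V : Scheme.{0}} (f : X ⟶ Y) [IsFinite f] [Surjective f] [CompactSpace Y] (g : W ⟶ V) (hg : FEt g) (t : X ⟶ W) (c : Y ⟶ V)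
    (hp : IsPullback t f g c) :
    ∃ (C : Subring k) (hBC : B ≤ C), Algebra.FiniteType ℤ C ∧ ∀ (s : Spec (CommRingCat.of B) ⟶ V) (q : Spec (CommRingCat.of k) ⟶ Y),
      q ≫ c = Spec.map (CommRingCat.ofHom B.subtype) ≫ s → ∃ σ : Spec (CommRingCat.of C) ⟶ W, σ ≫ g = Spec.map (CommRingCat.ofHom (Subring.inclusion hBC)) ≫ s := by
  obtain ⟨d, hd⟩ := fibre_bound k f
  obtain ⟨C, hC, hBC, hφ⟩ := hermite_final B hB d
  refine ⟨C, hBC, hC, fun s q hsq => ?_⟩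
  haveI : IsFinite g := hg.1
  obtain ⟨D, _, _, u, hu, _⟩ := finite_spec (IsPullback.of_hasPullback g s)
  haveI : Algebra.Etale B D := by
    rw [← RingHom.etale_algebraMap]
    exact (HasRingHomProperty.Spec_iff (P := @Etale)).mp (MorphismProperty.of_isPullback (P := @Etale) hu hg.2)
  have h1 := (tensor_pb B k D).flip.paste_horiz hu
  have hsq' : Spec.map (CommRingCat.ofHom (algebraMap B k)) ≫ s = q ≫ c := hsq.symm
  rw [hsq'] at h1
  have hw := h1.w
  rw [← Category.assoc _ q c] at hw
  have h2 : IsPullback (hp.lift _ _ hw) (Spec.map (CommRingCat.ofHom (algebraMap k (k ⊗[B] D)))) f q := by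
    refine IsPullback.of_right ?_ (hp.lift_snd _ _ _) hp
    rw [hp.lift_fst]; exact h1
  have hle := hd q (k ⊗[B] D) _ h2
  have hge : 1 ≤ Module.finrank k (k ⊗[B] D) := by
    haveI : Surjective (Spec.map (CommRingCat.ofHom (algebraMap k (k ⊗[B] D)))) := MorphismProperty.of_isPullback (P := @Surjective) h2 inferInstance
    obtain ⟨x, -⟩ := (Spec.map (CommRingCat.ofHom (algebraMap k (k ⊗[B] D)))).surjective (⟨⊥, Ideal.isPrime_bot⟩ : PrimeSpectrum k)
    haveI : Nontrivial (k ⊗[B] D) := PrimeSpectrum.nontrivial (p := (x : PrimeSpectrum (k ⊗[B] D)))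
    exact Module.finrank_pos
  obtain ⟨φ, h3, h4⟩ := hφ D (etcov_of_fibre B D d hge hle)
  refine ⟨Spec.map (CommRingCat.ofHom (φ.codRestrict C h4)) ≫ u, ?_⟩
  rw [Category.assoc, hu.w, ← Category.assoc, ← Spec.map_comp, ← CommRingCat.ofHom_comp]
  congr 3
  ext b
  exact RingHom.congr_fun h3 b

end LiftPts

end CW

namespace CW

section Top

lemma exists_component {X : Type} [TopologicalSpace X] {F : Set X} (hF : IsClosed F) (x : X) (hx : x ∈ F) :
    ∃ T : Set X, x ∈ T ∧ IsIrreducible T ∧ IsClosed T ∧ T ⊆ F ∧ ∀ T' : Set X, IsIrreducible T' → IsClosed T' → T' ⊆ F → T ⊆ T' → T = T' := by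
  refine ⟨Subtype.val '' irreducibleComponent (⟨x, hx⟩ : F), ⟨_, mem_irreducibleComponent, rfl⟩,
    isIrreducible_irreducibleComponent.image _ continuous_subtype_val.continuousOn,
    hF.isClosedEmbedding_subtypeVal.isClosedMap _ isClosed_irreducibleComponent, by rintro _ ⟨y, -, rfl⟩; exact y.2, ?_⟩
  intro T' hT' _ hsub hle
  have hpre : IsPreirreducible ((Subtype.val : F → X) ⁻¹' T') := by
    rintro u v hu hv ⟨a, ha, hau⟩ ⟨b, hb, hbv⟩
    obtain ⟨u', hu', rfl⟩ := isOpen_induced_iff.mp hu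
    obtain ⟨v', hv', rfl⟩ := isOpen_induced_iff.mp hv
    obtain ⟨c, hc, hcu, hcv⟩ := hT'.2 u' v' hu' hv' ⟨a, ha, hau⟩ ⟨b, hb, hbv⟩
    exact ⟨⟨c, hsub hc⟩, hc, hcu, hcv⟩
  have := eq_irreducibleComponent (x := (⟨x, hx⟩ : F)) hpre (fun y hy => hle ⟨y, hy, rfl⟩)
  rw [← this, Subtype.image_preimage_coe, Set.inter_eq_right.mpr hsub]

theorem components_image {X Y : Scheme.{0}} (f : X ⟶ Y) (hf : IsClosedMap f) (Δ s : Set X) (r : Set Y) (hr : r ⊆ f '' s)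
    (h : ComponentsModulo Δ s) : ComponentsModulo (f '' Δ) r := by
  intro T hT hTc hTr _ hns
  have hcl : closure r ⊆ f '' closure s :=
    closure_minimal (hr.trans (Set.image_mono subset_closure)) (hf _ isClosed_closure)
  have hgen := hT.isGenericPoint_genericPoint hTc
  obtain ⟨x, hx, hxη⟩ := hcl (hTr hgen.mem)
  obtain ⟨T', hxT', hi, hc, hsub, hmax⟩ := exists_component isClosed_closure x hx
  have hTT' : T ⊆ f '' T' := by
    rw [← hgen.def]
    exact closure_minimal (Set.singleton_subset_iff.mpr ⟨x, hxT', hxη⟩) (hf _ hc)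
  have hΔ := h T' hi hc hsub hmax (fun hs => hns ((hs.image f).anti hTT'))
  exact hTT'.trans (Set.image_mono hΔ)

end Top

section Main

/-- `Spec k` to `Spec A` for a subring. -/
abbrev iS {k : Type} [Field k] (A : Subring k) : SR k ⟶ SR A := Spec.map (CommRingCat.ofHom A.subtype)

/-- `Spec` of an inclusion of subrings. -/
abbrev iI {k : Type} [Field k] {A B : Subring k} (h : A ≤ B) : SR B ⟶ SR A := Spec.map (CommRingCat.ofHom (Subring.inclusion h))

lemma iS_iI {k : Type} [Field k] {A B : Subring k} (h : A ≤ B) : iS B ≫ iI h = iS A := by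
  rw [← Spec.map_comp]; rfl

/-- the set of points of a model -/
def pts {k : Type} [Field k] {A : Subring k} {X : OverR k} (𝒳 : SchemeModel k A X) : Set X.left :=
  {x : X.left | ∃ s : SR A ⟶ 𝒳.M, s ≫ 𝒳.str = 𝟙 (SR A) ∧ 𝒳.InducesPoint (Spec.map (CommRingCat.ofHom A.subtype) ≫ s) x}

lemma model_pb {k : Type} [Field k] {A : Subring k} {X : OverR k} (𝒳 : SchemeModel k A X) :
    IsPullback (𝒳.base.inv ≫ pullback.fst 𝒳.str (iS A)) X.hom 𝒳.str (iS A) :=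
  (IsPullback.of_hasPullback 𝒳.str (iS A)).of_iso 𝒳.base (Iso.refl _) (Iso.refl _) (Iso.refl _) (by
    rw [Iso.refl_hom, Category.comp_id, Iso.hom_inv_id_assoc]) (by
    rw [Iso.refl_hom, Category.comp_id]; exact 𝒳.base_w.symm) (by simp) (by simp)

lemma pts_of_model {k : Type} [Field k] {A : Subring k} {X : OverR k} (𝒳 : SchemeModel k A X) (y : X.left) (hy : y ∈ pts 𝒳) :
    ∃ (s : SR A ⟶ 𝒳.M) (q : SR k ⟶ X.left), s ≫ 𝒳.str = 𝟙 (SR A) ∧ q ≫ 𝒳.base.inv ≫ pullback.fst 𝒳.str (iS A) = iS A ≫ s ∧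
      q ≫ X.hom = 𝟙 _ ∧ y = q (specPt k) := by
  obtain ⟨s, hs, q, h1, h2, h3⟩ := hy
  refine ⟨s, q, hs, h1, ?_, h3⟩
  rw [← h2, ← 𝒳.base_w, Iso.inv_hom_id_assoc]

lemma model_of_pb {k : Type} [Field k] {C : Subring k} {X : OverR k} {N : Scheme.{0}} (n : N ⟶ SR C) (h1 : LocallyOfFiniteType n) (h2 : QuasiCompact n)
    (h3 : IsSeparated n) (p : X.left ⟶ N) (h : IsPullback p X.hom n (iS C)) :
    ∃ 𝒳 : SchemeModel k C X, ∀ (σ : SR C ⟶ N) (q : SR k ⟶ X.left), σ ≫ n = 𝟙 _ → q ≫ p = iS C ≫ σ → q ≫ X.hom = 𝟙 _ → q (specPt k) ∈ pts 𝒳 := by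
  have e1 : h.isoPullback.symm.hom ≫ X.hom = pullback.snd n (iS C) := h.isoPullback_inv_snd
  refine ⟨⟨N, n, h1, h2, h3, h.isoPullback.symm, e1⟩, ?_⟩
  intro σ q hσ hq hqX
  refine ⟨σ, hσ, q, ?_, ?_, rfl⟩
  · rw [← hq]
    congr 1
    exact h.isoPullback_hom_fst
  · rw [← hqX]
    congr 1
    exact h.isoPullback_hom_snd

lemma spread {k : Type} [Field k] [IsAlgClosed k] [CharZero k]
    {X Y : OverR k} (f : X.left ⟶ Y.left) (hf : FEt f) (A : Subring k) (hA : Algebra.FiniteType ℤ A) (𝒴 : SchemeModel k A Y) :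
    ∃ (B : Subring k) (_ : Algebra.FiniteType ℤ B) (V W : Scheme.{0}) (v : V ⟶ SR B) (g : W ⟶ V) (t : X.left ⟶ W) (c : Y.left ⟶ V),
      LocallyOfFiniteType v ∧ QuasiCompact v ∧ IsSeparated v ∧ FEt g ∧ IsPullback t f g c ∧ IsPullback c Y.hom v (iS B) ∧
      ∀ (s : SR A ⟶ 𝒴.M) (q : SR k ⟶ Y.left), s ≫ 𝒴.str = 𝟙 (SR A) → q ≫ 𝒴.base.inv ≫ pullback.fst 𝒴.str (iS A) = iS A ≫ s →
        q ≫ Y.hom = 𝟙 _ → ∃ s' : SR B ⟶ V, s' ≫ v = 𝟙 _ ∧ q ≫ c = iS B ≫ s' := by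
  have := 𝒴.lft; have := 𝒴.qc; have := 𝒴.sep
  haveI : IsNoetherianRing A := Algebra.FiniteType.isNoetherianRing ℤ A
  haveI : CompactSpace 𝒴.M := QuasiCompact.compactSpace_of_compactSpace 𝒴.str
  haveI : QuasiSeparatedSpace 𝒴.M := quasiSeparatedSpace_of_quasiSeparated 𝒴.str
  have h : IsPullback (𝒴.base.inv ≫ pullback.fst 𝒴.str (iS A)) Y.hom 𝒴.str (sK A k) := model_pb 𝒴
  obtain ⟨B, W, g, t, hg, ht⟩ := Desc.all (A := A) (k := k) 𝒴.M 𝒴.str _ _ _ h _ f hf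
  haveI : Algebra.FiniteType A B.1 := B.1.fg_iff_finiteType.mp B.2
  have hB : Algebra.FiniteType ℤ B.1.toSubring := Algebra.FiniteType.trans (S := A) (A := B.1) hA inferInstance
  refine ⟨B.1.toSubring, hB, bc 𝒴.str B, W, pullback.snd 𝒴.str (sB A k B), g, t, bcMap 𝒴.str h.w B, inferInstance, inferInstance, inferInstance, hg, ht, bcMap_isPullback 𝒴.str h B, ?_⟩
  intro s q hs hq hqY
  refine ⟨pullback.lift (sB A k B ≫ s) (𝟙 _) (by rw [Category.assoc, hs, Category.comp_id, Category.id_comp]), pullback.lift_snd _ _ _, ?_⟩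
  change q ≫ bcMap 𝒴.str h.w B = tB A k B ≫ _
  apply pullback.hom_ext
  · rw [Category.assoc, bcMap_fst, hq, Category.assoc, pullback.lift_fst, ← Category.assoc, tB_sB]
    rfl
  · rw [Category.assoc, bcMap_snd, ← Category.assoc, hqY, Category.assoc, pullback.lift_snd, Category.id_comp]
    exact (Category.comp_id _).symm

theorem exists_model {k : Type} [Field k] [IsAlgClosed k] [CharZero k]
    {X Y : OverR k} (hY : IsVarietyOver Y)
    (f : X ⟶ Y) [IsFinite f.left] [Etale f.left] [Surjective f.left] (A : Subring k) (hA : Algebra.FiniteType ℤ A) (𝒴 : SchemeModel k A Y) :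
    ∃ (C : Subring k) (_ : Algebra.FiniteType ℤ C) (𝒳 : SchemeModel k C X), pts 𝒴 ⊆ f.left '' pts 𝒳 := by
  haveI := hY.2.1
  haveI : CompactSpace Y.left := QuasiCompact.compactSpace_of_compactSpace Y.hom
  obtain ⟨B, hB, V, W, v, g, t, c, h1, h2, h3, hg, ht, hc, hs'⟩ := spread f.left ⟨inferInstance, inferInstance⟩ A hA 𝒴
  obtain ⟨C, hBC, hC, hσ⟩ := lift_points B hB f.left g hg t c ht
  haveI := hg.1
  have hXY : f.left ≫ Y.hom = X.hom := Over.w f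
  have hW : IsPullback t X.hom (g ≫ v) (iS B) := by
    rw [← hXY]; exact ht.paste_vert hc
  rw [← iS_iI hBC] at hW
  have hw := hW.w
  rw [← Category.assoc X.hom] at hw
  have hN : IsPullback (pullback.lift t (X.hom ≫ iS C) hw) X.hom (pullback.snd (g ≫ v) (iI hBC)) (iS C) := by
    refine IsPullback.of_right ?_ (pullback.lift_snd _ _ _) (IsPullback.of_hasPullback (g ≫ v) (iI hBC))
    rw [pullback.lift_fst]; exact hW
  obtain ⟨𝒳, h𝒳⟩ := model_of_pb (X := X) (pullback.snd (g ≫ v) (iI hBC)) inferInstance inferInstance inferInstance _ hN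
  refine ⟨C, hC, 𝒳, ?_⟩
  intro y hy
  obtain ⟨s, q, e1, e2, e3, rfl⟩ := pts_of_model 𝒴 y hy
  obtain ⟨s', e4, e5⟩ := hs' s q e1 e2 e3
  obtain ⟨σ, e6⟩ := hσ s' q e5
  have e7 : (iS C ≫ σ) ≫ g = q ≫ c := by
    rw [Category.assoc, e6, ← Category.assoc, iS_iI, e5]
  have e8 : ht.lift _ _ e7 ≫ f.left = q := ht.lift_snd _ _ _
  have e9 : ht.lift _ _ e7 ≫ X.hom = 𝟙 _ := by
    rw [← hXY, ← Category.assoc, e8, e3]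
  refine ⟨ht.lift _ _ e7 (specPt k), h𝒳 (pullback.lift σ (𝟙 _) ?_) _ (pullback.lift_snd _ _ _) ?_ e9, ?_⟩
  · rw [← Category.assoc, e6, Category.assoc, e4, Category.comp_id, Category.id_comp]
  · apply pullback.hom_ext
    · rw [Category.assoc, pullback.lift_fst, ht.lift_fst, Category.assoc, pullback.lift_fst]
    · rw [Category.assoc, pullback.lift_snd, Category.assoc, pullback.lift_snd, ← Category.assoc, e9, Category.id_comp, Category.comp_id]
  · rw [← Scheme.Hom.comp_apply, e8]

end Main

end CW

/-- **Chevalley–Weil.** Let `k` be an algebraically closed field of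
characteristic zero, let `f : X ⟶ Y` be a finite étale surjective morphism of varieties
over `k`, and let `Δ ⊆ X` be closed. If `X` is arithmetically hyperbolic modulo `Δ` over
`k`, then `Y` is arithmetically hyperbolic modulo `f(Δ)` over `k`. -/
theorem stmt_17 (k : Type) [Field k] [IsAlgClosed k] [CharZero k]
    (X Y : OverR k) (hX : IsVarietyOver X) (hY : IsVarietyOver Y)
    (f : X ⟶ Y) (hfin : IsFinite f.left) (hetale : IsEtale f.left)
    (hsurj : Function.Surjective f.left.base)
    (Δ : Set X.left) (hΔ : IsClosed Δ)
    (h : ArithmeticallyHyperbolicModulo k X Δ) :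
    ArithmeticallyHyperbolicModulo k Y (f.left.base '' Δ) := by
  intro A hA 𝒴
  haveI : Etale f.left := hetale
  haveI : Surjective f.left := ⟨hsurj⟩
  obtain ⟨C, hC, 𝒳, hsub⟩ := CW.exists_model hY f A hA 𝒴
  exact CW.components_image f.left f.left.isClosedMap Δ _ _ hsub (h C hC 𝒳)

end
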